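/- There exists a constant M > 0 such that for all integers 𝒳 ≥ 4 and n ≥ 2, one has θ_{𝒳−3, n−1} ≤ θ_{𝒳, n} + M/(𝒳−1). -/

import Mathlib

open scoped BigOperators

noncomputable section

namespace WittenAsym

/-- `g(d)` as a rational number: `g(d) = 1 + (∑ⱼ dⱼ − n)/3`. -/
def gQ (l : List ℕ) : ℚ := 1 + ((l.sum : ℚ) - (l.length : ℚ)) / 3

/-- `X(d)` as a rational number: `X(d) = (∑ⱼ (2dⱼ+1))/3 = 2g(d) − 2 + n`. -/
def XQ (l : List ℕ) : ℚ := (2 * (l.sum : ℚ) + (l.length : ℚ)) / 3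

/-- `X(d)` as a natural number (the correct value whenever `X(d)` is an integer). -/
def XN (l : List ℕ) : ℕ := (2 * l.sum + l.length) / 3

/-- `g(d)` is a nonnegative integer. -/
def IntegralG (l : List ℕ) : Prop := ∃ g : ℕ, (g : ℚ) = gQ l

/-- The subtuple of `r` indexed by the finite index set `I`. -/
def select (r : List ℕ) (I : Finset (Fin r.length)) : List ℕ :=
  ((List.finRange r.length).filter (fun i => i ∈ I)).map r.get

/-- The characterization of the normalized Witten intersection numbers
`C(d) = 2^{2g(d)} ∏ⱼ (2dⱼ+1)!! / (3^{2g(d)-2+n} (2g(d)-3+n)!) ∫ ψ₁^{d₁}⋯ψₙ^{dₙ}`: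
they form the unique family of rationals, symmetric in the entries of `d`, vanishing
when `g(d)` is not a nonnegative integer, with `C(0,0,0) = 1/3`, `C(1) = 1/6`,
and satisfying the DVV recursion whenever `X(d) = 2g(d) - 2 + n ≥ 2`. -/
structure IsNormalizedWitten (C : List ℕ → ℚ) : Prop where
  symm : ∀ {l l' : List ℕ}, l.Perm l' → C l = C l'
  init3 : C [0, 0, 0] = 1/3
  init1 : C [1] = 1/6
  vanish : ∀ l : List ℕ, ¬ IntegralG l → C l = 0
  dvv : ∀ (d₁ : ℕ) (r : List ℕ), IntegralG (d₁ :: r) → 2 ≤ XQ (d₁ :: r) →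
    C (d₁ :: r) =
      (∑ j : Fin r.length,
        if 1 ≤ d₁ + r.get j then
          (2 * (r.get j : ℚ) + 1) / (3 * (XQ (d₁ :: r) - 1)) *
            C (r.set j.val (d₁ + r.get j - 1))
        else 0)
      + ∑ a ∈ Finset.range (d₁ - 1),
          (2 / (3 * (XQ (d₁ :: r) - 1)) * C (a :: (d₁ - 2 - a) :: r)
          + ∑ I : Finset (Fin r.length),
              if 3 ∣ (2 * (a + (select r I).sum) + (1 + (select r I).length)) then
                ((XN (a :: select r I) - 1).factorial : ℚ) *
                  ((XN ((d₁ - 2 - a) :: select r Iᶜ) - 1).factorial : ℚ) /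
                  (6 * ((XN (d₁ :: r) - 1).factorial : ℚ)) *
                  C (a :: select r I) * C ((d₁ - 2 - a) :: select r Iᶜ)
              else 0)

/-- `θ_{𝒳,m}`: the maximum of `C(e)` over tuples `e ∈ (ℤ_{≥1})^m` with `g(e) ∈ ℤ`
and `X(e) = 𝒳` (a maximum over a finite set, equal to `0` if the set is empty,
by the convention `sSup ∅ = 0` in `ℝ`). -/
noncomputable def theta (C : List ℕ → ℚ) (X m : ℕ) : ℝ :=
  sSup {x : ℝ | ∃ e : List ℕ, e.length = m ∧ (∀ i ∈ e, 1 ≤ i) ∧ IntegralG e ∧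
    XQ e = (X : ℚ) ∧ (C e : ℝ) = x}

end WittenAsym

namespace WittenAsym

/-! ### The convolution algebra of functions on multisets -/

/-- Functions on multisets, with the labelled-splitting convolution product. -/
def Alg : Type := Multiset ℕ → ℚ

namespace Alg

instance : AddCommGroup Alg := inferInstanceAs (AddCommGroup (Multiset ℕ → ℚ))
instance : Module ℚ Alg := inferInstanceAs (Module ℚ (Multiset ℕ → ℚ))

/-- evaluation -/
def ev (s : Multiset ℕ) (φ : Alg) : ℚ := φ s

/-- the derivation adding a leg `k` -/
def sh (k : ℕ) (φ : Alg) : Alg := fun s => φ (k ::ₘ s)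

@[ext] theorem ext {φ ψ : Alg} (h : ∀ s, φ s = ψ s) : φ = ψ := funext h

@[simp] theorem add_app (φ ψ : Alg) (s) : (φ + ψ) s = φ s + ψ s := rfl
@[simp] theorem sub_app (φ ψ : Alg) (s) : (φ - ψ) s = φ s - ψ s := rfl
@[simp] theorem neg_app (φ : Alg) (s) : (-φ) s = - φ s := rfl
@[simp] theorem zero_app (s) : (0 : Alg) s = 0 := rfl
@[simp] theorem smul_app (c : ℚ) (φ : Alg) (s) : (c • φ) s = c * φ s := rfl
@[simp] theorem sh_app (k) (φ : Alg) (s) : sh k φ s = φ (k ::ₘ s) := rfl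

instance : Mul Alg := ⟨fun φ ψ s => (s.antidiagonal.map fun p => φ p.1 * ψ p.2).sum⟩
instance : One Alg := ⟨fun s => if s = 0 then 1 else 0⟩

theorem mul_app (φ ψ : Alg) (s) : (φ * ψ) s = (s.antidiagonal.map fun p => φ p.1 * ψ p.2).sum := rfl
theorem one_app (s) : (1 : Alg) s = if s = 0 then 1 else 0 := rfl

@[simp] theorem mul_zero_app (φ ψ : Alg) : (φ * ψ) 0 = φ 0 * ψ 0 := by
  simp [mul_app]

theorem mul_cons (φ ψ : Alg) (k s) : (φ * ψ) (k ::ₘ s) = (sh k φ * ψ) s + (φ * sh k ψ) s := by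
  simp [mul_app, Multiset.antidiagonal_cons, add_comm]

@[simp] theorem sh_add (k) (φ ψ : Alg) : sh k (φ + ψ) = sh k φ + sh k ψ := rfl
@[simp] theorem sh_sub (k) (φ ψ : Alg) : sh k (φ - ψ) = sh k φ - sh k ψ := rfl
@[simp] theorem sh_neg (k) (φ : Alg) : sh k (-φ) = - sh k φ := rfl
@[simp] theorem sh_zero (k) : sh k (0 : Alg) = 0 := rfl
@[simp] theorem sh_smul (k) (c : ℚ) (φ : Alg) : sh k (c • φ) = c • sh k φ := rfl
theorem sh_mul (k) (φ ψ : Alg) : sh k (φ * ψ) = sh k φ * ψ + φ * sh k ψ := by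
  ext s; simp [mul_cons]
@[simp] theorem sh_one (k) : sh k (1 : Alg) = 0 := by
  ext s; simp [one_app]
theorem sh_comm (k l) (φ : Alg) : sh k (sh l φ) = sh l (sh k φ) := by
  ext s; simp [Multiset.cons_swap]

theorem left_distrib' (φ ψ χ : Alg) : φ * (ψ + χ) = φ * ψ + φ * χ := by
  ext s; simp [mul_app, mul_add]
theorem mul_comm' (φ ψ : Alg) : φ * ψ = ψ * φ := by
  ext s
  induction s using Multiset.induction generalizing φ ψ with
  | empty => simp [mul_comm]
  | cons k s ih => rw [mul_cons, mul_cons, ih, ih φ]; ring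
theorem right_distrib' (φ ψ χ : Alg) : (φ + ψ) * χ = φ * χ + ψ * χ := by
  ext s; simp [mul_app, add_mul]
theorem mul_assoc' (φ ψ χ : Alg) : φ * ψ * χ = φ * (ψ * χ) := by
  ext s
  induction s using Multiset.induction generalizing φ ψ χ with
  | empty => simp [mul_assoc]
  | cons k s ih =>
    simp only [mul_cons, sh_mul, right_distrib', left_distrib', add_app, ih]; ring
theorem smul_mul' (c : ℚ) (φ ψ : Alg) : (c • φ) * ψ = c • (φ * ψ) := by
  ext s
  simp [mul_app, mul_assoc, Multiset.sum_map_mul_left]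
theorem zero_mul' (φ : Alg) : 0 * φ = 0 := by
  ext s; simp [mul_app]
theorem one_mul' (φ : Alg) : 1 * φ = φ := by
  ext s
  induction s using Multiset.induction generalizing φ with
  | empty => simp [one_app]
  | cons k s ih => simp [mul_cons, zero_mul', ih]

instance : CommRing Alg :=
  { (inferInstance : AddCommGroup Alg) with
    mul := (· * ·)
    one := 1
    left_distrib := left_distrib'
    right_distrib := right_distrib'
    zero_mul := zero_mul'
    mul_zero := fun φ => by rw [mul_comm', zero_mul']
    mul_assoc := mul_assoc'
    one_mul := one_mul'
    mul_one := fun φ => by rw [mul_comm', one_mul']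
    mul_comm := mul_comm' }

instance : Algebra ℚ Alg := Algebra.ofModule smul_mul' (fun c φ ψ => by
  rw [mul_comm', smul_mul', mul_comm'])


/-- `sh k` as a derivation. -/
def shD (k : ℕ) : Derivation ℚ Alg Alg where
  toFun := sh k
  map_add' := sh_add k
  map_smul' := fun c φ => rfl
  map_one_eq_zero' := sh_one k
  leibniz' := fun φ ψ => by
    change sh k (φ * ψ) = φ * sh k ψ + ψ * sh k φ
    rw [sh_mul]; ring

theorem sh_pow (k n : ℕ) (φ : Alg) : sh k (φ ^ n) = n * φ ^ (n-1) * sh k φ := by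
  have := (shD k).leibniz_pow φ n
  change sh k (φ^n) = n • φ^(n-1) • sh k φ at this
  rw [this]; simp [mul_assoc]

theorem sh_natCast (k n : ℕ) : sh k (n : Alg) = 0 := (shD k).map_natCast n
theorem sh_ofNat (k n : ℕ) [n.AtLeastTwo] : sh k (OfNat.ofNat n : Alg) = 0 := (shD k).map_natCast n

theorem sh_sum {ι} (k) (t : Finset ι) (f : ι → Alg) : sh k (∑ i ∈ t, f i) = ∑ i ∈ t, sh k (f i) :=
  map_sum (shD k) f t

theorem sum_app {ι} (t : Finset ι) (f : ι → Alg) (s) : (∑ i ∈ t, f i) s = ∑ i ∈ t, f i s := by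
  induction t using Finset.cons_induction with
  | empty => simp
  | cons a t ha ih => simp [Finset.sum_cons, ih]

end Alg
end WittenAsym

set_option autoImplicit false
namespace WittenAsym
namespace Alg

theorem natCast_app_mul (n : ℕ) (φ : Alg) (s) : ((n : Alg) * φ) s = n * φ s := by
  rw [← nsmul_eq_mul]
  induction n with
  | zero => simp
  | succ n ih => rw [succ_nsmul, add_app, ih]; push_cast; ring

theorem ofNat_mul_app (n : ℕ) [n.AtLeastTwo] (φ : Alg) (s) :
    ((OfNat.ofNat n : Alg) * φ) s = (OfNat.ofNat n : ℚ) * φ s := natCast_app_mul n φ s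

theorem sh_two (k) : sh k (2 : Alg) = 0 := sh_natCast k 2
theorem sh_three (k) : sh k (3 : Alg) = 0 := sh_natCast k 3
theorem sh_four (k) : sh k (4 : Alg) = 0 := sh_natCast k 4
theorem sh_six (k) : sh k (6 : Alg) = 0 := sh_natCast k 6
theorem sh_eight (k) : sh k (8 : Alg) = 0 := sh_natCast k 8

/-- weighted sum over legs -/
def S (φ : ℕ → Alg) : Alg := fun s => (s.map fun j : ℕ => 4 * (2 * (j:ℚ) + 1) * φ j (s.erase j)).sum

theorem S_app (φ : ℕ → Alg) (s) :
    S φ s = (s.map fun j : ℕ => 4 * (2 * (j:ℚ) + 1) * φ j (s.erase j)).sum := rfl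

@[simp] theorem S_zero_app (φ : ℕ → Alg) : S φ 0 = 0 := rfl

theorem S_add (φ ψ : ℕ → Alg) : S (fun j => φ j + ψ j) = S φ + S ψ := by
  ext s; simp [S_app, mul_add]
theorem S_sub (φ ψ : ℕ → Alg) : S (fun j => φ j - ψ j) = S φ - S ψ := by
  ext s; simp [S_app, mul_sub]

theorem sh_S (k) (φ : ℕ → Alg) :
    sh k (S φ) = S (fun j => sh k (φ j)) + (4 * (2 * (k:ℚ) + 1)) • φ k := by
  ext s
  simp only [sh_app, S_app, Multiset.map_cons, Multiset.sum_cons, Multiset.erase_cons_head,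
    add_app, smul_app]
  rw [add_comm]
  congr 2
  apply Multiset.map_congr rfl
  intro j hj
  by_cases h : j = k
  · subst h; rw [Multiset.erase_cons_head, Multiset.cons_erase hj]
  · rw [Multiset.erase_cons_tail _ (Ne.symm h)]

theorem S_mul (ψ : Alg) (φ : ℕ → Alg) : S (fun j => ψ * φ j) = ψ * S φ := by
  ext s
  induction s using Multiset.induction generalizing φ ψ with
  | empty => simp
  | cons k s ih =>
    change sh k (S (fun j => ψ * φ j)) s = sh k (ψ * S φ) s
    simp only [sh_S, sh_mul, S_add, add_app, ih, smul_app, mul_add, mul_smul_comm]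
    ring

theorem S_ofNat_mul (n : ℕ) [n.AtLeastTwo] (φ : ℕ → Alg) :
    S (fun j => OfNat.ofNat n * φ j) = OfNat.ofNat n * S φ := S_mul _ φ

/-- `L_n`, `n ≥ 0` -/
def Lp (n : ℕ) (φ : Alg) : Alg := S (fun j => sh (j + n) φ)
/-- lowering family -/
def dn (φ : Alg) (j : ℕ) : Alg := if j = 0 then 0 else sh (j - 1) φ
/-- `L_{-1}` -/
def Lm (φ : Alg) : Alg := S (dn φ)
/-- four times the indicator of `{0}` -/
def T : Alg := S (fun j => if j = 0 then 1 else 0)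

theorem S_ite (φ : Alg) : S (fun j => if j = 0 then φ else 0) = φ * T := by
  rw [T, ← S_mul]; congr 1; ext j s; split_ifs <;> simp

theorem sh0_T : sh 0 T = 4 := by
  rw [T, sh_S]
  have : (fun j => sh 0 (if j = 0 then (1:Alg) else 0)) = fun j => (0:Alg) * 0 := by
    ext j s; split_ifs
    · rw [sh_one]; simp
    · simp
  rw [this, S_mul]
  ext s
  have := ofNat_mul_app 4 (1:Alg) s
  simp at this
  simp [this]

theorem sh_dn (k) (φ : Alg) (j) : sh k (dn φ j) = dn (sh k φ) j := by
  unfold dn; split_ifs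
  · simp
  · rw [sh_comm]

theorem sh_Lp (k n) (φ : Alg) :
    sh k (Lp n φ) = Lp n (sh k φ) + (4 * (2 * (k:ℚ) + 1)) • sh (k + n) φ := by
  rw [Lp, sh_S, Lp]; simp only [sh_comm k]

theorem sh_Lm (k) (φ : Alg) :
    sh k (Lm φ) = Lm (sh k φ) + (4 * (2 * (k:ℚ) + 1)) • dn φ k := by
  rw [Lm, sh_S, Lm]; simp only [sh_dn]

theorem sh0_Lm (φ : Alg) : sh 0 (Lm φ) = Lm (sh 0 φ) := by
  rw [sh_Lm]; simp [dn]

theorem smul_ofNat' (φ : Alg) : (4 * (2 * ((0:ℕ):ℚ) + 1)) • φ = 4 * φ := by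
  ext s; rw [smul_app, ofNat_mul_app]; norm_num

theorem sh0_Lp (n) (φ : Alg) : sh 0 (Lp n φ) = Lp n (sh 0 φ) + 4 * sh n φ := by
  rw [sh_Lp, smul_ofNat', zero_add]

theorem Lm_add (φ ψ : Alg) : Lm (φ + ψ) = Lm φ + Lm ψ := by
  rw [Lm, Lm, Lm, ← S_add]; congr 1; ext j s; unfold dn; split_ifs <;> simp
theorem Lm_mul (φ ψ : Alg) : Lm (φ * ψ) = Lm φ * ψ + φ * Lm ψ := by
  rw [Lm, Lm, Lm, mul_comm (S _), ← S_mul, ← S_mul, ← S_add]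
  congr 1; ext j s; unfold dn; split_ifs
  · simp
  · rw [sh_mul, mul_comm ψ]

/-- Virasoro-type hypotheses -/
structure Vir (F E : Alg) : Prop where
  hE : sh 0 E = 2 * T
  hE1 : ∀ k, sh (k+1) E = 0
  hE0 : E 0 = 0
  vm : sh 0 F = Lm F + E
  v0 : sh 1 F = Lp 0 F + 4
  vs : ∀ m, sh (m+2) F = Lp (m+1) F + 8 * (∑ p ∈ Finset.HasAntidiagonal.antidiagonal m, sh p.1 (sh p.2 F))
      + ∑ p ∈ Finset.HasAntidiagonal.antidiagonal m, sh p.1 F * sh p.2 F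

variable {F E : Alg}

/-- shorthand -/
def U (F : Alg) : Alg := sh 0 (sh 0 F)
/-- shorthand -/
def gg (F : Alg) (m : ℕ) : Alg := sh 0 (sh m F)
/-- twice the Lenard operator -/
def NN (F : Alg) (φ : Alg) : Alg :=
  2 * sh 0 (sh 0 (sh 0 φ)) + 2 * U F * sh 0 φ + sh 0 (U F) * φ
/-- Lenard defect -/
def KK (F : Alg) : ℕ → Alg
  | 0 => 0
  | m+1 => 2 * sh 0 (gg F (m+1)) - NN F (gg F m)
/-- index set of pairs with sum `n-1` -/
def AD : ℕ → Finset (ℕ × ℕ)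
  | 0 => ∅
  | m+1 => Finset.HasAntidiagonal.antidiagonal m

theorem gg_zero : gg F 0 = U F := rfl

theorem vir_all (h : Vir F E) (n) : sh (n+1) F = Lp n F
      + 8 * (∑ p ∈ AD n, sh p.1 (sh p.2 F))
      + ∑ p ∈ AD n, sh p.1 F * sh p.2 F + (if n = 0 then 4 else 0) := by
  cases n with
  | zero => simp [AD, h.v0]
  | succ m => simp [AD, h.vs m]

theorem sum_ad_swap (m : ℕ) (f : ℕ → ℕ → Alg) :
    ∑ p ∈ AD m, f p.1 p.2 = ∑ p ∈ AD m, f p.2 p.1 := by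
  cases m with
  | zero => rfl
  | succ m => exact (Finset.Nat.sum_antidiagonal_swap (n := m) (f := fun p => f p.2 p.1))

theorem sum_ad_split (m : ℕ) (f : ℕ → ℕ → Alg) :
    ∑ p ∈ Finset.HasAntidiagonal.antidiagonal m, f p.1 p.2 = f m 0 + ∑ p ∈ AD m, f p.1 (p.2+1) := by
  cases m with
  | zero => simp [AD]
  | succ m =>
    rw [Finset.Nat.antidiagonal_succ', Finset.sum_cons]
    simp [AD]

/-- The first KdV relation. -/
theorem K_one (h : Vir F E) : KK F 1 = S (KK F) := by
  have e0 : sh 0 (sh 0 (sh 1 F)) = Lp 0 (U F) + 8 * U F := by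
    rw [h.v0]; simp only [sh_add, sh0_Lp, sh_mul, sh_four, sh_zero]; simp only [U]; ring
  have e1 : gg F 0 = Lm (sh 0 F) + 2 * T := by
    rw [← h.hE, gg]; have := congrArg (sh 0) h.vm; rwa [sh_add, sh0_Lm] at this
  have e2 : sh 0 (gg F 0) = Lm (U F) + 8 := by
    rw [e1]; simp only [sh_add, sh0_Lm, sh_mul, sh_two, sh0_T, U]; ring
  have e3 : sh 0 (sh 0 (sh 0 (gg F 0))) = Lm (sh 0 (sh 0 (U F))) := by
    rw [e2]; simp only [sh_add, sh0_Lm, sh_eight, sh_zero]; ring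
  have e4 : S (KK F) = 2 * Lp 0 (U F) - 2 * Lm (sh 0 (sh 0 (U F))) - 2 * U F * Lm (U F)
      - sh 0 (U F) * Lm (sh 0 F) - 2 * sh 0 (U F) * T := by
    simp only [Lp, Lm, ← S_ite, ← S_mul, ← S_sub]
    congr 1
    ext1 j
    cases j with
    | zero => simp [KK, dn]
    | succ j =>
      simp only [KK, NN, gg, U, dn]
      simp only [sh_comm _ 0]
      simp
      ring
  rw [e4]
  simp only [KK, NN]
  rw [e3, gg, e0, e2, e1]
  ring

end Alg
end WittenAsym

set_option autoImplicit false
namespace WittenAsym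
namespace Alg
variable {F E : Alg}

/-- antidiagonal -/
abbrev ad (m : ℕ) : Finset (ℕ × ℕ) := Finset.HasAntidiagonal.antidiagonal m

theorem NN_add (φ ψ : Alg) : NN F (φ + ψ) = NN F φ + NN F ψ := by
  simp only [NN, sh_add]; ring
theorem NN_eight (φ : Alg) : NN F (8 * φ) = 8 * NN F φ := by
  simp only [NN, sh_mul, sh_eight, zero_mul, zero_add]; ring
theorem NN_zero : NN F 0 = 0 := by simp [NN]
theorem NN_sum {ι : Type} (t : Finset ι) (f : ι → Alg) : NN F (∑ i ∈ t, f i) = ∑ i ∈ t, NN F (f i) := by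
  simp only [NN, sh_sum, Finset.mul_sum, Finset.sum_add_distrib]

/-- linear part -/
theorem L_part (m : ℕ) : 2 * sh 0 (sh 0 (Lp (m+1) F)) - NN F (sh 0 (Lp m F))
    = S (fun j => KK F (j + (m+1))) + 16 * gg F (m+1) - 32 * sh 0 (sh 0 (gg F m)) - 16 * U F * gg F m
      - 4 * sh 0 (U F) * sh m F := by
  have e4 : S (fun j => KK F (j + (m+1))) = 2 * Lp (m+1) (U F) - 2 * Lp m (sh 0 (sh 0 (U F)))
      - 2 * U F * Lp m (U F) - sh 0 (U F) * Lp m (sh 0 F) := by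
    simp only [Lp, ← S_mul, ← S_sub]
    congr 1
    ext1 j
    rw [← add_assoc]
    simp only [KK, NN, gg, U]
    rw [sh_comm (j+m+1) 0, sh_comm (j+m+1) 0]
    simp only [sh_comm (j+m) 0]
    ring
  rw [e4]
  simp only [NN, sh0_Lp, sh_add, sh_mul, sh_four, zero_mul, zero_add, gg, U]
  simp only [sh_comm m 0, sh_comm (m+1) 0]
  ring

theorem W1_part (m : ℕ) : 2 * sh 0 (sh 0 (∑ p ∈ ad m, sh p.1 (sh p.2 F)))
      - NN F (sh 0 (∑ p ∈ AD m, sh p.1 (sh p.2 F)))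
    = (∑ p ∈ ad m, sh p.1 (KK F p.2)) + 2 * sh 0 (sh 0 (gg F m))
      + ∑ p ∈ AD m, (2 * sh 0 (gg F p.1) * sh 0 (gg F p.2) + sh 0 (sh 0 (gg F p.1)) * gg F p.2) := by
  rw [sum_ad_split m (fun a b => sh a (sh b F)), sum_ad_split m (fun a b => sh a (KK F b))]
  simp only [KK, sh_zero, sh_add, sh_sum, NN_sum, Finset.mul_sum, mul_add, zero_add]
  rw [show sh 0 (sh 0 (sh m (sh 0 F))) = sh 0 (sh 0 (gg F m)) by rw [gg, sh_comm m 0]]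
  rw [add_sub_assoc, ← Finset.sum_sub_distrib, add_comm _ (2 * sh 0 (sh 0 (gg F m))), add_assoc,
    ← Finset.sum_add_distrib]
  congr 1
  apply Finset.sum_congr rfl
  intro p _
  simp only [NN, gg, U, sh_sub, sh_add, sh_mul, sh_two, zero_mul, zero_add]
  simp only [sh_comm p.1 0]
  ring

theorem W2_part (m : ℕ) : 2 * sh 0 (sh 0 (∑ p ∈ ad m, sh p.1 F * sh p.2 F))
      - NN F (sh 0 (∑ p ∈ AD m, sh p.1 F * sh p.2 F))
    = 2 * (∑ p ∈ ad m, sh p.1 F * KK F p.2) + 4 * sh m F * sh 0 (U F)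
      + 4 * (∑ p ∈ ad m, gg F p.1 * gg F p.2)
      - ∑ p ∈ AD m, (16 * sh 0 (sh 0 (gg F p.1)) * gg F p.2 + 12 * sh 0 (gg F p.1) * sh 0 (gg F p.2)
          + 4 * U F * gg F p.1 * gg F p.2) := by
  have s1 : 2 * sh 0 (sh 0 (∑ p ∈ ad m, sh p.1 F * sh p.2 F))
      = 4 * (∑ p ∈ ad m, gg F p.1 * gg F p.2) + 4 * (∑ p ∈ ad m, sh p.1 F * sh 0 (gg F p.2)) := by
    have sw := sum_ad_swap (m+1) (fun a b => sh a F * sh 0 (gg F b))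
    simp only [AD] at sw
    rw [show (4:Alg) * (∑ p ∈ ad m, sh p.1 F * sh 0 (gg F p.2))
      = 2 * (∑ p ∈ ad m, sh p.1 F * sh 0 (gg F p.2)) + 2 * (∑ p ∈ ad m, sh p.2 F * sh 0 (gg F p.1)) by
        rw [sw]; ring]
    simp only [sh_sum, Finset.mul_sum, ← Finset.sum_add_distrib]
    apply Finset.sum_congr rfl
    intro p _
    simp only [gg, sh_mul, sh_add]; ring
  have s2 : NN F (sh 0 (∑ p ∈ AD m, sh p.1 F * sh p.2 F)) = 2 * ∑ p ∈ AD m, NN F (sh p.1 F * gg F p.2) := by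
    have sw := sum_ad_swap m (fun a b => NN F (sh a F * gg F b))
    rw [two_mul]; nth_rewrite 2 [sw]
    rw [sh_sum, NN_sum, ← Finset.sum_add_distrib]
    apply Finset.sum_congr rfl
    intro p _
    rw [← NN_add, sh_mul, gg, gg]; congr 1; ring
  have s3 : (∑ p ∈ AD m, (16 * sh 0 (sh 0 (gg F p.1)) * gg F p.2 + 12 * sh 0 (gg F p.1) * sh 0 (gg F p.2)
          + 4 * U F * gg F p.1 * gg F p.2)) = ∑ p ∈ AD m, (12 * gg F p.1 * sh 0 (sh 0 (gg F p.2))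
          + 4 * sh 0 (sh 0 (gg F p.1)) * gg F p.2 + 12 * sh 0 (gg F p.1) * sh 0 (gg F p.2)
          + 4 * U F * gg F p.1 * gg F p.2) := by
    have sw := sum_ad_swap m (fun a b => 12 * sh 0 (sh 0 (gg F a)) * gg F b)
    rw [← sub_eq_zero, ← Finset.sum_sub_distrib] at sw ⊢
    rw [← sw]
    apply Finset.sum_congr rfl; intro p _; ring
  rw [s1, s2, s3, sum_ad_split m (fun a b => sh a F * sh 0 (gg F b)),
    sum_ad_split m (fun a b => sh a F * KK F b)]
  have s5 : (2:Alg) * ∑ p ∈ AD m, sh p.1 F * KK F (p.2+1) = 4 * (∑ p ∈ AD m, sh p.1 F * sh 0 (gg F (p.2+1)))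
     - (2 * ∑ p ∈ AD m, NN F (sh p.1 F * gg F p.2)) + (∑ p ∈ AD m, (12 * gg F p.1 * sh 0 (sh 0 (gg F p.2))
          + 4 * sh 0 (sh 0 (gg F p.1)) * gg F p.2 + 12 * sh 0 (gg F p.1) * sh 0 (gg F p.2)
          + 4 * U F * gg F p.1 * gg F p.2)) := by
    simp only [Finset.mul_sum, ← Finset.sum_add_distrib, ← Finset.sum_sub_distrib]
    apply Finset.sum_congr rfl
    intro p _
    simp only [KK, NN, sh_mul, sh_add]
    simp only [gg]
    ring
  rw [mul_add 2, s5]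
  simp only [KK, gg_zero]
  ring

/-- the quadratic defect -/
def Q (F : Alg) (m : ℕ) : Alg := 8 * gg F (m+1) - 8 * sh 0 (sh 0 (gg F m)) - 8 * U F * gg F m
   + 2 * (∑ p ∈ ad m, gg F p.1 * gg F p.2)
   - ∑ p ∈ AD m, (4 * sh 0 (sh 0 (gg F p.1)) * gg F p.2 - 2 * sh 0 (gg F p.1) * sh 0 (gg F p.2)
       + 2 * U F * gg F p.1 * gg F p.2)

theorem K_succ (h : Vir F E) (m : ℕ) : KK F (m+2) = S (fun j => KK F (j + (m+1)))
    + 8 * (∑ p ∈ ad m, sh p.1 (KK F p.2)) + 2 * (∑ p ∈ ad m, sh p.1 F * KK F p.2) + 2 * Q F m := by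
  have a1 : sh 0 (gg F (m+2)) = sh 0 (sh 0 (Lp (m+1) F)) + 8 * sh 0 (sh 0 (∑ p ∈ ad m, sh p.1 (sh p.2 F)))
      + sh 0 (sh 0 (∑ p ∈ ad m, sh p.1 F * sh p.2 F)) := by
    rw [gg, h.vs m]; simp only [sh_add, sh_mul, sh_eight, zero_mul, zero_add]
  have a2 : gg F (m+1) = sh 0 (Lp m F) + 8 * sh 0 (∑ p ∈ AD m, sh p.1 (sh p.2 F))
      + sh 0 (∑ p ∈ AD m, sh p.1 F * sh p.2 F) := by
    rw [gg, vir_all h m]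
    have : sh 0 (if m = 0 then (4:Alg) else 0) = 0 := by split_ifs; exact sh_four 0; rfl
    simp only [sh_add, sh_mul, sh_eight, zero_mul, zero_add, this, add_zero]
  have a3 : KK F (m+2) = 2 * sh 0 (gg F (m+2)) - NN F (gg F (m+1)) := rfl
  have b1 := L_part (F := F) m
  have b2 := W1_part (F := F) m
  have b3 := W2_part (F := F) m
  rw [a3, a1]
  nth_rewrite 1 [a2]
  rw [NN_add, NN_add, NN_eight]
  have c : (2 * (∑ p ∈ AD m, (4 * sh 0 (sh 0 (gg F p.1)) * gg F p.2 - 2 * sh 0 (gg F p.1) * sh 0 (gg F p.2)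
       + 2 * U F * gg F p.1 * gg F p.2)) : Alg) = (∑ p ∈ AD m, (16 * sh 0 (sh 0 (gg F p.1)) * gg F p.2 + 12 * sh 0 (gg F p.1) * sh 0 (gg F p.2)
          + 4 * U F * gg F p.1 * gg F p.2)) - 8 * ∑ p ∈ AD m, (2 * sh 0 (gg F p.1) * sh 0 (gg F p.2) + sh 0 (sh 0 (gg F p.1)) * gg F p.2) := by
    simp only [Finset.mul_sum, ← Finset.sum_add_distrib, ← Finset.sum_sub_distrib]
    apply Finset.sum_congr rfl
    intro p _
    ring
  rw [Q]
  linear_combination b1 + 8 * b2 + b3 + c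

theorem sw_ad (m : ℕ) (f : ℕ → ℕ → Alg) :
    ∑ p ∈ ad m, f p.1 p.2 = ∑ p ∈ ad m, f p.2 p.1 := sum_ad_swap (m+1) f

/-- derivative of the quadratic defect -/
theorem sh_Q (m : ℕ) : 2 * sh 0 (Q F m) = 8 * KK F (m+1) + 4 * ∑ p ∈ ad m, gg F p.1 * KK F p.2 := by
  have s1 : sh 0 (∑ p ∈ ad m, gg F p.1 * gg F p.2) = 2 * gg F m * sh 0 (U F)
      + 2 * ∑ p ∈ AD m, gg F p.1 * sh 0 (gg F (p.2+1)) := by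
    have : sh 0 (∑ p ∈ ad m, gg F p.1 * gg F p.2) = 2 * ∑ p ∈ ad m, gg F p.1 * sh 0 (gg F p.2) := by
      have sw := sw_ad m (fun a b => gg F a * sh 0 (gg F b))
      rw [two_mul]; nth_rewrite 2 [sw]
      rw [sh_sum, ← Finset.sum_add_distrib]
      apply Finset.sum_congr rfl
      intro p _
      rw [sh_mul]; ring
    rw [this, sum_ad_split m (fun a b => gg F a * sh 0 (gg F b)), gg_zero]; ring
  have s2 : sh 0 (∑ p ∈ AD m, (4 * sh 0 (sh 0 (gg F p.1)) * gg F p.2 - 2 * sh 0 (gg F p.1) * sh 0 (gg F p.2)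
       + 2 * U F * gg F p.1 * gg F p.2)) = ∑ p ∈ AD m, 2 * gg F p.1 * NN F (gg F p.2) := by
    have sw1 := sum_ad_swap m (fun a b => 4 * sh 0 (sh 0 (sh 0 (gg F a))) * gg F b)
    have sw2 := sum_ad_swap m (fun a b => 2 * sh 0 (sh 0 (gg F a)) * sh 0 (gg F b))
    have sw3 := sum_ad_swap m (fun a b => 2 * U F * sh 0 (gg F a) * gg F b)
    rw [← sub_eq_zero] at sw1 sw2 sw3 ⊢
    rw [← Finset.sum_sub_distrib] at sw1 sw2 sw3
    rw [sh_sum, ← Finset.sum_sub_distrib]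
    rw [show (0:Alg) = 0 + 0 + 0 by ring]
    refine Eq.trans ?_ (congrArg₂ (· + ·) (congrArg₂ (· + ·) sw1 sw2) sw3)
    simp only [← Finset.sum_add_distrib]
    apply Finset.sum_congr rfl
    intro p _
    simp only [sh_sub, sh_add, sh_mul, sh_two, sh_four, NN, zero_mul, zero_add]
    ring
  have s3 : (4 * ∑ p ∈ ad m, gg F p.1 * KK F p.2 : Alg) = 8 * (∑ p ∈ AD m, gg F p.1 * sh 0 (gg F (p.2+1)))
     - 2 * ∑ p ∈ AD m, 2 * gg F p.1 * NN F (gg F p.2) := by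
    rw [sum_ad_split m (fun a b => gg F a * KK F b)]
    simp only [KK, mul_zero, zero_add, Finset.mul_sum, ← Finset.sum_sub_distrib]
    apply Finset.sum_congr rfl
    intro p _
    ring
  rw [s3, Q]
  simp only [sh_sub, sh_add, sh_mul, sh_two, sh_eight, zero_mul, zero_add, s1, s2, KK, NN]
  ring

end Alg
end WittenAsym

set_option autoImplicit false
namespace WittenAsym
namespace Alg
variable {F E : Alg}

theorem mem_ad {m : ℕ} {p : ℕ × ℕ} (hp : p ∈ ad m) : p.1 + p.2 = m :=
  Finset.HasAntidiagonal.mem_antidiagonal.1 hp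
theorem c8_app (φ : Alg) (s) : ((8:Alg) * φ) s = 8 * φ s := natCast_app_mul 8 φ s
theorem c12_app (φ : Alg) (s) : ((12:Alg) * φ) s = 12 * φ s := natCast_app_mul 12 φ s

theorem S_app_zero (φ : ℕ → Alg) (s : Multiset ℕ) (h : ∀ j ∈ s, φ j (s.erase j) = 0) : S φ s = 0 := by
  rw [S_app]
  apply Multiset.sum_eq_zero
  intro x hx
  obtain ⟨j, hj, rfl⟩ := Multiset.mem_map.1 hx
  rw [h j hj, mul_zero]

theorem mul_app_zero (φ ψ : Alg) (s : Multiset ℕ) (h : ∀ t u, t + u = s → ψ u = 0) : (φ * ψ) s = 0 := by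
  rw [mul_app]
  apply Multiset.sum_eq_zero
  intro x hx
  obtain ⟨p, hp, rfl⟩ := Multiset.mem_map.1 hx
  rw [h p.1 p.2 (Multiset.mem_antidiagonal.1 hp), mul_zero]

theorem erase_lvl {s : Multiset ℕ} {j : ℕ} (h : j ∈ s) :
    (s.erase j).sum + j = s.sum ∧ Multiset.card (s.erase j) + 1 = Multiset.card s := by
  obtain ⟨t, rfl⟩ := Multiset.exists_cons_of_mem h
  simp [add_comm]

theorem DK (h : Vir F E) (m : ℕ) : sh 0 (KK F (m+2)) = S (fun j => sh 0 (KK F (j + (m+1))))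
    + 12 * KK F (m+1) + 8 * (∑ p ∈ ad m, sh p.1 (sh 0 (KK F p.2)))
    + ((∑ p ∈ ad m, 6 * gg F p.1 * KK F p.2) + ∑ p ∈ ad m, 2 * sh p.1 F * sh 0 (KK F p.2)) := by
  have hq := sh_Q (F := F) m
  have h0 := smul_ofNat' (KK F (m+1))
  rw [K_succ h m]
  simp only [sh_add, sh_mul, sh_two, sh_eight, zero_mul, zero_add, sh_S, sh_sum, h0]
  rw [hq]
  have e1 : (2 * ∑ p ∈ ad m, (sh 0 (sh p.1 F) * KK F p.2 + sh p.1 F * sh 0 (KK F p.2)) : Alg)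
     + 4 * (∑ p ∈ ad m, gg F p.1 * KK F p.2) = ((∑ p ∈ ad m, 6 * gg F p.1 * KK F p.2) + ∑ p ∈ ad m, 2 * sh p.1 F * sh 0 (KK F p.2)) := by
    simp only [Finset.mul_sum, ← Finset.sum_add_distrib]
    apply Finset.sum_congr rfl
    intro p _
    simp only [gg]; ring
  rw [← e1]
  simp only [fun k => sh_comm 0 k]
  ring

/-- `D - L_{-1}` -/
def del (φ : Alg) : Alg := sh 0 φ - Lm φ
theorem del_add (φ ψ : Alg) : del (φ + ψ) = del φ + del ψ := by
  simp only [del, sh_add, Lm_add]; ring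
theorem Lm_neg (φ : Alg) : Lm (-φ) = - Lm φ := by
  have h := Lm_add φ (-φ)
  have h0 := Lm_add 0 0
  simp at h h0
  rw [h0] at h
  linear_combination -h
theorem del_sub (φ ψ : Alg) : del (φ - ψ) = del φ - del ψ := by
  rw [sub_eq_add_neg, del_add, sub_eq_add_neg]; congr 1
  rw [del, Lm_neg, del]; simp; ring
theorem del_mul (φ ψ : Alg) : del (φ * ψ) = del φ * ψ + φ * del ψ := by
  simp only [del, sh_mul, Lm_mul]; ring
theorem del_one : del 1 = 0 := by
  have := del_mul 1 1
  simp at this; exact this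
theorem del_natCast (n : ℕ) : del (n : Alg) = 0 := by
  induction n with
  | zero => simp [del]; have h0 := Lm_add 0 0; simpa using h0
  | succ n ih => push_cast; rw [del_add, ih, del_one, add_zero]
theorem del_two : del 2 = 0 := del_natCast 2
theorem del_sh0 (φ : Alg) : del (sh 0 φ) = sh 0 (del φ) := by
  simp only [del, sh_sub, sh0_Lm]
theorem del_shs (k : ℕ) (φ : Alg) : del (sh (k+1) φ) = sh (k+1) (del φ) + ((8 * k + 12 : ℕ) : Alg) * sh k φ := by
  simp only [del, sh_sub, sh_Lm, dn]
  ext s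
  simp only [add_app, sub_app, natCast_app_mul, smul_app, sh_app]
  rw [if_neg (by omega), Multiset.cons_swap]; push_cast; simp; ring
theorem sh_T (k : ℕ) : sh (k+1) T = 0 := by
  rw [T, sh_S]
  have : (fun j => sh (k+1) (if j = 0 then (1:Alg) else 0)) = fun j => (0:Alg) * 0 := by
    ext j s; split_ifs
    · rw [sh_one]; simp
    · simp
  rw [this, S_mul]; simp

theorem delF (h : Vir F E) : del F = E := by rw [del, h.vm]; ring
theorem del_g0 (h : Vir F E) : del (gg F 0) = 8 := by
  rw [gg, del_sh0, del_sh0, delF h, h.hE, sh_mul, sh_two, sh0_T]; ring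
theorem del_U (h : Vir F E) : del (U F) = 8 := del_g0 h
theorem del_gs (h : Vir F E) (m : ℕ) : del (gg F (m+1)) = ((8 * m + 12 : ℕ) : Alg) * gg F m := by
  rw [gg, del_sh0, del_shs, sh_add, sh_comm 0, delF h, h.hE, sh_mul, sh_mul, sh_T, sh_two, sh_natCast, gg]
  ring

theorem delK (h : Vir F E) (m : ℕ) : del (KK F (m+1)) = ((8 * m + 4 : ℕ) : Alg) * KK F m := by
  cases m with
  | zero =>
    simp only [KK, NN, del_sub, del_add, del_mul, del_sh0, del_two, del_gs h, del_g0 h, del_U h, sh_mul,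
      sh_natCast, sh_eight, sh_zero]
    push_cast
    simp only [gg_zero]
    ring
  | succ m =>
    simp only [KK, NN, del_sub, del_add, del_mul, del_sh0, del_two, del_gs h, del_U h, sh_mul,
      sh_natCast, sh_eight, sh_zero, sh_add]
    push_cast
    ring

theorem KK_eq_zero (h : Vir F E) (m : ℕ) : KK F m = 0 := by
  suffices H : ∀ L m s, 2 * (m + s.sum) + Multiset.card s = L → KK F m s = 0 by
    ext s; exact H _ m s rfl
  intro L
  induction L using Nat.strong_induction_on with
  | _ L IH =>
  have IH' : ∀ m s, 2 * (m + s.sum) + Multiset.card s < L → KK F m s = 0 := fun m s hl => IH _ hl m s rfl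
  have z1 : ∀ s, 2 * (1 + s.sum) + Multiset.card s = L → KK F 1 s = 0 := by
    intro s hs
    rw [K_one h]
    apply S_app_zero
    intro j hj
    have := erase_lvl hj
    apply IH'; omega
  have z0 : ∀ m s, 2 * (m + s.sum) + Multiset.card s + 1 = L → KK F m (0 ::ₘ s) = 0 := by
    intro m s hs
    rcases m with _ | _ | m
    · rfl
    · apply z1; simp; omega
    · change sh 0 (KK F (m+2)) s = 0
      rw [DK h]
      have t1 : S (fun j => sh 0 (KK F (j + (m+1)))) s = 0 := by
        apply S_app_zero
        intro j hj
        have := erase_lvl hj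
        apply IH'; simp; omega
      have t2 : KK F (m+1) s = 0 := by apply IH'; omega
      have t3 : ∀ p ∈ ad m, sh p.1 (sh 0 (KK F p.2)) s = 0 := by
        intro p hp
        have := mem_ad hp
        apply IH'; simp; omega
      have t4 : ∀ p ∈ ad m, (6 * gg F p.1 * KK F p.2) s = 0 := by
        intro p hp
        have := mem_ad hp
        apply mul_app_zero
        rintro t u rfl
        apply IH'; simp at hs; omega
      have t5 : ∀ p ∈ ad m, (2 * sh p.1 F * sh 0 (KK F p.2)) s = 0 := by
        intro p hp
        have := mem_ad hp
        apply mul_app_zero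
        rintro t u rfl
        apply IH'; simp at hs ⊢; omega
      simp only [add_app, c8_app, c12_app, sum_app]
      rw [t1, t2, Finset.sum_eq_zero t3, Finset.sum_eq_zero t4, Finset.sum_eq_zero t5]; norm_num
  have main : ∀ N m s, s.sum = N → 2 * (m + s.sum) + Multiset.card s = L → KK F m s = 0 := by
    intro N
    induction N using Nat.strong_induction_on with
    | _ N IN =>
    intro m s hN hs
    rcases m with _ | _ | m
    · rfl
    · exact z1 s (by omega)
    have a1 : KK F (m+3) (0 ::ₘ s) = 12 * KK F (m+2) s := by
      change sh 0 (KK F ((m+1)+2)) s = _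
      rw [DK h]
      have t1 : S (fun j => sh 0 (KK F (j + (m+1+1)))) s = 0 := by
        apply S_app_zero
        intro j hj
        have := erase_lvl hj
        apply z0; omega
      have t3 : ∀ p ∈ ad (m+1), sh p.1 (sh 0 (KK F p.2)) s = 0 := by
        intro p hp
        have := mem_ad hp
        apply z0; simp; omega
      have t4 : ∀ p ∈ ad (m+1), (6 * gg F p.1 * KK F p.2) s = 0 := by
        intro p hp
        have := mem_ad hp
        apply mul_app_zero
        rintro t u rfl
        apply IH'; simp at hs; omega
      have t5 : ∀ p ∈ ad (m+1), (2 * sh p.1 F * sh 0 (KK F p.2)) s = 0 := by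
        intro p hp
        have := mem_ad hp
        apply mul_app_zero
        rintro t u rfl
        apply IH'; simp at hs ⊢; omega
      simp only [add_app, c8_app, c12_app, sum_app]
      rw [t1, Finset.sum_eq_zero t3, Finset.sum_eq_zero t4, Finset.sum_eq_zero t5]; norm_num
    have a2 := congrFun (delK h (m+2)) s
    rw [del] at a2
    simp only [sub_app, sh_app, natCast_app_mul] at a2
    have a3 : Lm (KK F (m+3)) s = 0 := by
      apply S_app_zero
      intro j hj
      have := erase_lvl hj
      unfold dn
      split_ifs with h0
      · rfl
      · have := erase_lvl hj
        refine IN (s.sum - 1) (by omega) _ _ ?_ ?_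
        · simp; omega
        · simp; omega
    change KK F (m+3) (0 ::ₘ s) - Lm (KK F (m+3)) s = _ at a2
    rw [a1, a3] at a2
    push_cast at a2
    have : (8 * (m:ℚ) + 8) * KK F (m+2) s = 0 := by linear_combination -a2
    rcases mul_eq_zero.1 this with h' | h'
    · have : (0:ℚ) ≤ m := Nat.cast_nonneg m
      linarith
    · exact h'
  intro m s hs
  exact main _ m s rfl hs

end Alg
end WittenAsym

set_option autoImplicit false
set_option maxHeartbeats 1000000
set_option linter.unusedSimpArgs false
namespace WittenAsym
namespace Alg
variable {F E : Alg}

theorem cancel_nat (n : ℕ) (hn : n ≠ 0) (φ ψ : Alg) (h : (n : Alg) * φ = n * ψ) : φ = ψ := by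
  ext s
  have := congrFun h s
  rw [natCast_app_mul, natCast_app_mul] at this
  exact mul_left_cancel₀ (by exact_mod_cast hn) this

theorem Q_eq_zero (h : Vir F E) (m : ℕ) : Q F m = 0 := by
  have := K_succ h m
  simp only [KK_eq_zero h, sh_zero, mul_zero, Finset.sum_const_zero] at this
  have e : S (fun _ => (0:Alg)) = 0 := by ext s; simp [S_app]
  rw [e] at this
  apply cancel_nat 2 (by norm_num)
  push_cast
  linear_combination -this

/-- `D^k U` -/
def u (F : Alg) : ℕ → Alg
  | 0 => U F
  | k+1 => sh 0 (u F k)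

theorem sh0_u (k : ℕ) : sh 0 (u F k) = u F (k+1) := rfl
theorem gg0_u : gg F 0 = u F 0 := rfl
theorem U_u : U F = u F 0 := rfl

theorem sh_lit (k n : ℕ) [n.AtLeastTwo] : sh k (no_index (OfNat.ofNat n) : Alg) = 0 := sh_natCast k n
theorem del_lit (n : ℕ) [n.AtLeastTwo] : del (no_index (OfNat.ofNat n) : Alg) = 0 := del_natCast n

theorem mulE {a b c d : Alg} (h : a = b) (h' : c = d) : a * c = b * d := by rw [h, h']
theorem sum_ad0 (f : ℕ × ℕ → Alg) : ∑ p ∈ ad 0, f p = f (0, 0) := by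
  simp [ad, Finset.Nat.antidiagonal_succ, add_assoc]
theorem sum_ad1 (f : ℕ × ℕ → Alg) : ∑ p ∈ ad 1, f p = f (0, 1) + f (1, 0) := by
  simp [ad, Finset.Nat.antidiagonal_succ, add_assoc]
theorem sum_ad2 (f : ℕ × ℕ → Alg) : ∑ p ∈ ad 2, f p = f (0, 2) + f (1, 1) + f (2, 0) := by
  simp [ad, Finset.Nat.antidiagonal_succ, add_assoc]
theorem sum_ad3 (f : ℕ × ℕ → Alg) : ∑ p ∈ ad 3, f p = f (0, 3) + f (1, 2) + f (2, 1) + f (3, 0) := by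
  simp [ad, Finset.Nat.antidiagonal_succ, add_assoc]
theorem g1_eq (h : Vir F E) : 8 * gg F 1 = 8*(u F 2) + 6*(u F 0*u F 0) := by
  have hq := Q_eq_zero h 0
  have h0 : u F 0 = u F 0 := rfl
  have h0' : u F 1 = u F 1 := rfl
  have h0'' : u F 2 = u F 2 := rfl
  rw [Q, AD, sum_ad0, Finset.sum_empty] at hq
  simp only [gg0_u, U_u, sh0_u, zero_add, Nat.reduceAdd] at hq
  linear_combination 1 * hq + 8*h0'' + 8*u F 0*h0 - 2 * mulE h0 h0
theorem g2_eq (h : Vir F E) : 64 * gg F 2 = 64*(u F 4) + 160*(u F 0*u F 2) + 80*(u F 1*u F 1) + 40*(u F 0*u F 0*u F 0) := by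
  have hq := Q_eq_zero h 1
  have h0 : u F 0 = u F 0 := rfl
  have h0' : u F 1 = u F 1 := rfl
  have h0'' : u F 2 = u F 2 := rfl
  have h1 := g1_eq h
  have h1' := congrArg (sh 0) h1
  have h1'' := congrArg (sh 0) h1'
  simp only [sh_add, sh_mul, sh0_u, sh_lit, zero_mul, zero_add, Nat.reduceAdd] at h1' h1''
  rw [Q, sum_ad1, show AD 1 = ad 0 from rfl, sum_ad0] at hq
  simp only [gg0_u, U_u, sh0_u, zero_add, Nat.reduceAdd] at hq
  linear_combination 8 * hq + 8*h1'' + 8*u F 0*h1 - 2 * mulE h0 h1 - 2 * mulE h1 h0 + 8*(4*mulE h0'' h0 - 2*mulE h0' h0' + 2*u F 0*mulE h0 h0)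
theorem g3_eq (h : Vir F E) : 512 * gg F 3 = 512*(u F 6) + 1792*(u F 0*u F 4) + 3584*(u F 1*u F 3) + 2688*(u F 2*u F 2) + 2240*(u F 0*u F 0*u F 2) + 2240*(u F 0*u F 1*u F 1) + 280*(u F 0*u F 0*u F 0*u F 0) := by
  have hq := Q_eq_zero h 2
  have h0 : u F 0 = u F 0 := rfl
  have h0' : u F 1 = u F 1 := rfl
  have h0'' : u F 2 = u F 2 := rfl
  have h1 := g1_eq h
  have h1' := congrArg (sh 0) h1
  have h1'' := congrArg (sh 0) h1'
  simp only [sh_add, sh_mul, sh0_u, sh_lit, zero_mul, zero_add, Nat.reduceAdd] at h1' h1''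
  have h2 := g2_eq h
  have h2' := congrArg (sh 0) h2
  have h2'' := congrArg (sh 0) h2'
  simp only [sh_add, sh_mul, sh0_u, sh_lit, zero_mul, zero_add, Nat.reduceAdd] at h2' h2''
  rw [Q, sum_ad2, show AD 2 = ad 1 from rfl, sum_ad1] at hq
  simp only [gg0_u, U_u, sh0_u, zero_add, Nat.reduceAdd] at hq
  linear_combination 64 * hq + 8*h2'' + 8*u F 0*h2 - 2 * mulE h0 h2 - 2 * mulE h1 h1 - 2 * mulE h2 h0 + 8*(4*mulE h0'' h1 - 2*mulE h0' h1' + 2*u F 0*mulE h0 h1) + 8*(4*mulE h1'' h0 - 2*mulE h1' h0' + 2*u F 0*mulE h1 h0)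
theorem g4_eq (h : Vir F E) : 4096 * gg F 4 = 4096*(u F 8) + 18432*(u F 0*u F 6) + 55296*(u F 1*u F 5) + 116736*(u F 2*u F 4) + 70656*(u F 3*u F 3) + 32256*(u F 0*u F 0*u F 4) + 129024*(u F 0*u F 1*u F 3) + 96768*(u F 0*u F 2*u F 2) + 118272*(u F 1*u F 1*u F 2) + 26880*(u F 0*u F 0*u F 0*u F 2) + 40320*(u F 0*u F 0*u F 1*u F 1) + 2016*(u F 0*u F 0*u F 0*u F 0*u F 0) := by
  have hq := Q_eq_zero h 3
  have h0 : u F 0 = u F 0 := rfl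
  have h0' : u F 1 = u F 1 := rfl
  have h0'' : u F 2 = u F 2 := rfl
  have h1 := g1_eq h
  have h1' := congrArg (sh 0) h1
  have h1'' := congrArg (sh 0) h1'
  simp only [sh_add, sh_mul, sh0_u, sh_lit, zero_mul, zero_add, Nat.reduceAdd] at h1' h1''
  have h2 := g2_eq h
  have h2' := congrArg (sh 0) h2
  have h2'' := congrArg (sh 0) h2'
  simp only [sh_add, sh_mul, sh0_u, sh_lit, zero_mul, zero_add, Nat.reduceAdd] at h2' h2''
  have h3 := g3_eq h
  have h3' := congrArg (sh 0) h3
  have h3'' := congrArg (sh 0) h3'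
  simp only [sh_add, sh_mul, sh0_u, sh_lit, zero_mul, zero_add, Nat.reduceAdd] at h3' h3''
  rw [Q, sum_ad3, show AD 3 = ad 2 from rfl, sum_ad2] at hq
  simp only [gg0_u, U_u, sh0_u, zero_add, Nat.reduceAdd] at hq
  linear_combination 512 * hq + 8*h3'' + 8*u F 0*h3 - 2 * mulE h0 h3 - 2 * mulE h1 h2 - 2 * mulE h2 h1 - 2 * mulE h3 h0 + 8*(4*mulE h0'' h2 - 2*mulE h0' h2' + 2*u F 0*mulE h0 h2) + 8*(4*mulE h1'' h1 - 2*mulE h1' h1' + 2*u F 0*mulE h1 h1) + 8*(4*mulE h2'' h0 - 2*mulE h2' h0' + 2*u F 0*mulE h2 h0)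
theorem d1u0 (h : Vir F E) : 2 * sh 1 (u F 0) = 2 * u F 3 + 3 * (u F 0 * u F 1) := by
  have hk := KK_eq_zero h 1
  simp only [KK, NN, gg0_u, U_u, sh0_u, zero_add, Nat.reduceAdd] at hk
  have e : sh 0 (gg F 1) = sh 1 (u F 0) := by
    rw [gg, u, U, sh_comm 1, sh_comm 1]
  rw [e] at hk
  linear_combination hk
theorem d1u1 (h : Vir F E) : 2 * sh 1 (u F 1) = 2*(u F 4) + 3*(u F 0*u F 2) + 3*(u F 1*u F 1) := by
  have hk := congrArg (sh 0) (d1u0 h)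
  simp only [sh_add, sh_mul, sh0_u, sh_lit, zero_mul, zero_add, Nat.reduceAdd, sh_comm 0 1] at hk
  linear_combination hk
theorem d1u2 (h : Vir F E) : 2 * sh 1 (u F 2) = 2*(u F 5) + 3*(u F 0*u F 3) + 9*(u F 1*u F 2) := by
  have hk := congrArg (sh 0) (d1u1 h)
  simp only [sh_add, sh_mul, sh0_u, sh_lit, zero_mul, zero_add, Nat.reduceAdd, sh_comm 0 1] at hk
  linear_combination hk
theorem d1u3 (h : Vir F E) : 2 * sh 1 (u F 3) = 2*(u F 6) + 3*(u F 0*u F 4) + 12*(u F 1*u F 3) + 9*(u F 2*u F 2) := by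
  have hk := congrArg (sh 0) (d1u2 h)
  simp only [sh_add, sh_mul, sh0_u, sh_lit, zero_mul, zero_add, Nat.reduceAdd, sh_comm 0 1] at hk
  linear_combination hk
theorem d1u4 (h : Vir F E) : 2 * sh 1 (u F 4) = 2*(u F 7) + 3*(u F 0*u F 5) + 15*(u F 1*u F 4) + 30*(u F 2*u F 3) := by
  have hk := congrArg (sh 0) (d1u3 h)
  simp only [sh_add, sh_mul, sh0_u, sh_lit, zero_mul, zero_add, Nat.reduceAdd, sh_comm 0 1] at hk
  linear_combination hk
theorem d1u5 (h : Vir F E) : 2 * sh 1 (u F 5) = 2*(u F 8) + 3*(u F 0*u F 6) + 18*(u F 1*u F 5) + 45*(u F 2*u F 4) + 30*(u F 3*u F 3) := by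
  have hk := congrArg (sh 0) (d1u4 h)
  simp only [sh_add, sh_mul, sh0_u, sh_lit, zero_mul, zero_add, Nat.reduceAdd, sh_comm 0 1] at hk
  linear_combination hk
theorem d1u6 (h : Vir F E) : 2 * sh 1 (u F 6) = 2*(u F 9) + 3*(u F 0*u F 7) + 21*(u F 1*u F 6) + 63*(u F 2*u F 5) + 105*(u F 3*u F 4) := by
  have hk := congrArg (sh 0) (d1u5 h)
  simp only [sh_add, sh_mul, sh0_u, sh_lit, zero_mul, zero_add, Nat.reduceAdd, sh_comm 0 1] at hk
  linear_combination hk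
theorem d1u7 (h : Vir F E) : 2 * sh 1 (u F 7) = 2*(u F 10) + 3*(u F 0*u F 8) + 24*(u F 1*u F 7) + 84*(u F 2*u F 6) + 168*(u F 3*u F 5) + 105*(u F 4*u F 4) := by
  have hk := congrArg (sh 0) (d1u6 h)
  simp only [sh_add, sh_mul, sh0_u, sh_lit, zero_mul, zero_add, Nat.reduceAdd, sh_comm 0 1] at hk
  linear_combination hk
theorem d1u8 (h : Vir F E) : 2 * sh 1 (u F 8) = 2*(u F 11) + 3*(u F 0*u F 9) + 27*(u F 1*u F 8) + 108*(u F 2*u F 7) + 252*(u F 3*u F 6) + 378*(u F 4*u F 5) := by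
  have hk := congrArg (sh 0) (d1u7 h)
  simp only [sh_add, sh_mul, sh0_u, sh_lit, zero_mul, zero_add, Nat.reduceAdd, sh_comm 0 1] at hk
  linear_combination hk

theorem del_u0 (h : Vir F E) : del (u F 0) = 8 := del_U h
theorem del_us (h : Vir F E) (k : ℕ) : del (u F (k+1)) = 0 := by
  induction k with
  | zero => rw [u, del_sh0, del_u0 h, sh_eight]
  | succ k ih => rw [u, del_sh0, ih, sh_zero]
theorem Lm_app_zero (φ : Alg) : Lm φ 0 = 0 := rfl
theorem u_app_zero (h : Vir F E) (k : ℕ) : u F (k+2) 0 = 0 := by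
  have := congrFun (del_us h k) 0
  rw [del] at this
  simpa [Lm_app_zero, sh0_u] using this
theorem u1_app_zero (h : Vir F E) : u F 1 0 = 8 := by
  have := congrFun (del_u0 h) 0
  rw [del] at this
  have e8 : (8 : Alg) 0 = 8 := by
    have := c8_app 1 0
    rw [mul_one] at this; rw [this, one_app]; norm_num
  rw [e8] at this
  simpa [Lm_app_zero, sh0_u] using this
theorem F0 (h : Vir F E) : F {0} = 0 := by
  have := congrFun h.vm 0
  simpa [Lm_app_zero, h.hE0] using this
theorem u0_app_zero (h : Vir F E) : u F 0 0 = 0 := by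
  have := congrFun (del_sh0 F) 0
  rw [delF h, h.hE, del] at this
  have e : (2 * T) 0 = 0 := by rw [mul_zero_app]; simp [T]
  rw [e] at this
  simpa [Lm_app_zero, u, U] using this

theorem eq_zero_of (φ : Alg) (hD : sh 0 φ = 0) (hL : Lm φ = 0) (h0 : φ 0 = 0) : φ = 0 := by
  have key : ∀ N M s, s.sum = N → φ (M ::ₘ s) = 0 := by
    intro N
    induction N using Nat.strong_induction_on with
    | _ N IN =>
    intro M s hs
    have h1 := congrFun hL ((M+1) ::ₘ s)
    change sh (M+1) (Lm φ) s = 0 at h1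
    rw [sh_Lm] at h1
    have h2 : Lm (sh (M+1) φ) s = 0 := by
      apply S_app_zero
      intro j hj
      have := erase_lvl hj
      unfold dn
      split_ifs with h0
      · rfl
      · refine IN (((j-1) ::ₘ s.erase j).sum) (by simp; omega) (M+1) _ rfl
    rw [add_app, h2, smul_app, dn, if_neg (by omega)] at h1
    simp only [sh_app, Nat.add_sub_cancel, zero_add] at h1
    rcases mul_eq_zero.1 h1 with h3 | h3
    · exfalso
      have : (0:ℚ) ≤ (M+1 : ℕ) := Nat.cast_nonneg _
      linarith
    · exact h3
  ext s
  induction s using Multiset.induction with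
  | empty => exact h0
  | cons M s _ => exact key _ M s rfl

theorem eq_zero_of' (φ : Alg) (hD : sh 0 φ = 0) (hL : del φ = 0) (h0 : φ 0 = 0) : φ = 0 := by
  refine eq_zero_of φ hD ?_ h0
  rw [del, hD] at hL
  linear_combination -hL
theorem N1 (h : Vir F E) : F {1} = 4 := by
  have := congrFun h.v0 0
  have e4 : (4 : Alg) 0 = 4 := by
    have := natCast_app_mul 4 1 0
    push_cast at this
    rw [mul_one] at this; rw [this, one_app]; norm_num
  simpa [Lp, e4] using this
theorem pr (F : Alg) (a b : ℕ) : F (a ::ₘ {b}) = F (b ::ₘ {a}) := by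
  congr 1; exact Multiset.pair_comm a b
theorem v0s (h : Vir F E) (m : ℕ) : F (1 ::ₘ {m}) = 4 * (2 * m + 1) * F {m} := by
  have := congrFun (congrArg (sh m) h.v0) 0
  rw [sh_add, sh_four, sh_Lp] at this
  simpa [Lp] using this
theorem vms (h : Vir F E) (m : ℕ) : F (0 ::ₘ {m+1}) = 4 * (2 * m + 3) * F {m} := by
  have := congrFun (congrArg (sh (m+1)) h.vm) 0
  rw [sh_add, h.hE1, sh_Lm] at this
  simp [Lm_app_zero, dn] at this
  rw [this]; ring
theorem vss (h : Vir F E) (m : ℕ) : F {m+2} = 8 * (∑ p ∈ ad m, F (p.2 ::ₘ {p.1})) + ∑ p ∈ ad m, F {p.1} * F {p.2} := by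
  have := congrFun (h.vs m) 0
  rw [add_app, add_app, c8_app] at this
  simp only [sum_app, mul_zero_app, Lp, S_zero_app, zero_add, sh_app] at this
  exact this
theorem F00 (h : Vir F E) : F (0 ::ₘ {0}) = 0 := u0_app_zero h
theorem sum_ad0q (f : ℕ × ℕ → ℚ) : ∑ p ∈ ad 0, f p = f (0,0) := by simp [ad]
theorem sum_ad1q (f : ℕ × ℕ → ℚ) : ∑ p ∈ ad 1, f p = f (0,1) + f (1,0) := by
  simp [ad, Finset.Nat.antidiagonal_succ]
theorem sum_ad2q (f : ℕ × ℕ → ℚ) : ∑ p ∈ ad 2, f p = f (0,2) + f (1,1) + f (2,0) := by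
  simp [ad, Finset.Nat.antidiagonal_succ, add_assoc]
theorem N2 (h : Vir F E) : F {2} = 0 := by
  have := vss h 0
  rw [sum_ad0q, sum_ad0q] at this
  simpa [F00 h, F0 h] using this
theorem N01 (h : Vir F E) : F (0 ::ₘ {1}) = 0 := by
  have := vms h 0
  rw [F0 h] at this; simpa using this
theorem N3 (h : Vir F E) : F {3} = 0 := by
  have := vss h 1
  rw [sum_ad1q, sum_ad1q] at this
  simpa [F0 h, N01 h, pr F 1 0] using this
theorem N4 (h : Vir F E) : F {4} = 1680 := by
  have := vss h 2
  rw [sum_ad2q, sum_ad2q] at this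
  have e1 := vms h 1
  have e2 := v0s h 1
  simp only [Nat.reduceAdd] at this e1 e2
  rw [this, pr F 2 0, e1, e2, N1 h, N2 h]; norm_num
theorem lit_mul_app (n : ℕ) [n.AtLeastTwo] (φ : Alg) (s) :
    ((no_index (OfNat.ofNat n) : Alg) * φ) s = (OfNat.ofNat n : ℚ) * φ s := natCast_app_mul n φ s

theorem du1 (h : Vir F E) : del (u F 1) = 0 := del_us h 0
theorem du2 (h : Vir F E) : del (u F 2) = 0 := del_us h 1
theorem uz2 (h : Vir F E) : u F 2 0 = 0 := u_app_zero h 0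
theorem du3 (h : Vir F E) : del (u F 3) = 0 := del_us h 2
theorem uz3 (h : Vir F E) : u F 3 0 = 0 := u_app_zero h 1
theorem du4 (h : Vir F E) : del (u F 4) = 0 := del_us h 3
theorem uz4 (h : Vir F E) : u F 4 0 = 0 := u_app_zero h 2
theorem du5 (h : Vir F E) : del (u F 5) = 0 := del_us h 4
theorem uz5 (h : Vir F E) : u F 5 0 = 0 := u_app_zero h 3
theorem du6 (h : Vir F E) : del (u F 6) = 0 := del_us h 5
theorem uz6 (h : Vir F E) : u F 6 0 = 0 := u_app_zero h 4
theorem du7 (h : Vir F E) : del (u F 7) = 0 := del_us h 6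
theorem uz7 (h : Vir F E) : u F 7 0 = 0 := u_app_zero h 5
theorem du8 (h : Vir F E) : del (u F 8) = 0 := del_us h 7
theorem uz8 (h : Vir F E) : u F 8 0 = 0 := u_app_zero h 6
theorem du9 (h : Vir F E) : del (u F 9) = 0 := del_us h 8
theorem uz9 (h : Vir F E) : u F 9 0 = 0 := u_app_zero h 7
theorem du10 (h : Vir F E) : del (u F 10) = 0 := del_us h 9
theorem uz10 (h : Vir F E) : u F 10 0 = 0 := u_app_zero h 8
theorem F11_app (h : Vir F E) : (8 * sh 1 (sh 1 F) - (8*(u F 4) + 24*(u F 0*u F 2) + 6*(u F 1*u F 1) + 6*(u F 0*u F 0*u F 0))) 0 = 0 := by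
  have e := v0s h 1
  have e' : sh 1 (sh 1 F) 0 = F (1 ::ₘ {1}) := pr F 1 1
  simp only [add_app, sub_app, lit_mul_app, mul_zero_app, e', e, N1 h, u0_app_zero h, u1_app_zero h, uz2 h, uz3 h, uz4 h, uz5 h, uz6 h, uz7 h, uz8 h, uz9 h, uz10 h]
  norm_num
theorem F11_eq (h : Vir F E) : 8 * sh 1 (sh 1 F) = 8*(u F 4) + 24*(u F 0*u F 2) + 6*(u F 1*u F 1) + 6*(u F 0*u F 0*u F 0) := by
  rw [← sub_eq_zero]
  have hg := g1_eq h
  have hg1 := congrArg (sh 1) hg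
  have ec : sh 1 (gg F 1) = sh 0 (sh 1 (sh 1 F)) := by rw [gg, sh_comm 1 0]
  simp only [sh_add, sh_mul, sh_lit, zero_mul, zero_add, ec] at hg1
  refine eq_zero_of' _ ?_ ?_ (F11_app h)
  · apply cancel_nat 2 (by norm_num)
    simp only [sh_sub, sh_add, sh_mul, sh0_u, sh_lit, zero_mul, zero_add, Nat.reduceAdd, Nat.cast_ofNat]
    linear_combination 2*hg1 + (12*(u F 0))*d1u0 h + (8)*d1u2 h
  · have e1 : del (sh 1 (sh 1 F)) = 12 * gg F 1 + 12 * gg F 1 := by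
      have := del_shs 0 (sh 1 F)
      rw [zero_add] at this; rw [this, del_shs 0 F, delF h, h.hE1]
      simp only [sh_add, sh_mul, sh_zero, sh_natCast, zero_add, zero_mul, gg, sh_comm 1 0]; push_cast; ring
    simp only [del_sub, del_add, del_mul, del_lit, e1, del_u0 h, du1 h, du2 h, du3 h, du4 h, du5 h, du6 h, du7 h, du8 h, du9 h, du10 h, zero_mul, zero_add, mul_zero, add_zero]
    linear_combination 24*hg
theorem F12_app (h : Vir F E) : (64 * sh 1 (sh 2 F) - (64*(u F 6) + 256*(u F 0*u F 4) + 384*(u F 1*u F 3) + 368*(u F 2*u F 2) + 360*(u F 0*u F 0*u F 2) + 240*(u F 0*u F 1*u F 1) + 45*(u F 0*u F 0*u F 0*u F 0))) 0 = 0 := by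
  have e := v0s h 2
  have e' : sh 1 (sh 2 F) 0 = F (1 ::ₘ {2}) := pr F 2 1
  simp only [add_app, sub_app, lit_mul_app, mul_zero_app, e', e, N2 h, u0_app_zero h, u1_app_zero h, uz2 h, uz3 h, uz4 h, uz5 h, uz6 h, uz7 h, uz8 h, uz9 h, uz10 h]
  norm_num
theorem F12_eq (h : Vir F E) : 64 * sh 1 (sh 2 F) = 64*(u F 6) + 256*(u F 0*u F 4) + 384*(u F 1*u F 3) + 368*(u F 2*u F 2) + 360*(u F 0*u F 0*u F 2) + 240*(u F 0*u F 1*u F 1) + 45*(u F 0*u F 0*u F 0*u F 0) := by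
  rw [← sub_eq_zero]
  have hg := g2_eq h
  have hg1 := congrArg (sh 1) hg
  have ec : sh 1 (gg F 2) = sh 0 (sh 1 (sh 2 F)) := by rw [gg, sh_comm 1 0]
  simp only [sh_add, sh_mul, sh_lit, zero_mul, zero_add, ec] at hg1
  refine eq_zero_of' _ ?_ ?_ (F12_app h)
  · apply cancel_nat 2 (by norm_num)
    simp only [sh_sub, sh_add, sh_mul, sh0_u, sh_lit, zero_mul, zero_add, Nat.reduceAdd, Nat.cast_ofNat]
    linear_combination 2*hg1 + (160*(u F 2) + 120*(u F 0*u F 0))*d1u0 h + (160*(u F 1))*d1u1 h + (160*(u F 0))*d1u2 h + (64)*d1u4 h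
  · have e1 : del (sh 1 (sh 2 F)) = 12 * gg F 2 + 20 * sh 1 (sh 1 F) := by
      have := del_shs 0 (sh 2 F)
      rw [zero_add] at this; rw [this, del_shs 1 F, delF h, h.hE1]
      simp only [sh_add, sh_mul, sh_zero, sh_natCast, zero_add, zero_mul, gg, sh_comm 1 0]; push_cast; ring
    simp only [del_sub, del_add, del_mul, del_lit, e1, del_u0 h, du1 h, du2 h, du3 h, du4 h, du5 h, du6 h, du7 h, du8 h, du9 h, du10 h, zero_mul, zero_add, mul_zero, add_zero]
    linear_combination 12*hg + 160*F11_eq h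
theorem F13_app (h : Vir F E) : (512 * sh 1 (sh 3 F) - (512*(u F 8) + 2560*(u F 0*u F 6) + 6400*(u F 1*u F 5) + 15104*(u F 2*u F 4) + 8576*(u F 3*u F 3) + 4928*(u F 0*u F 0*u F 4) + 16128*(u F 0*u F 1*u F 3) + 14336*(u F 0*u F 2*u F 2) + 12992*(u F 1*u F 1*u F 2) + 4480*(u F 0*u F 0*u F 0*u F 2) + 5040*(u F 0*u F 0*u F 1*u F 1) + 336*(u F 0*u F 0*u F 0*u F 0*u F 0))) 0 = 0 := by
  have e := v0s h 3
  have e' : sh 1 (sh 3 F) 0 = F (1 ::ₘ {3}) := pr F 3 1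
  simp only [add_app, sub_app, lit_mul_app, mul_zero_app, e', e, N3 h, u0_app_zero h, u1_app_zero h, uz2 h, uz3 h, uz4 h, uz5 h, uz6 h, uz7 h, uz8 h, uz9 h, uz10 h]
  norm_num
theorem F13_eq (h : Vir F E) : 512 * sh 1 (sh 3 F) = 512*(u F 8) + 2560*(u F 0*u F 6) + 6400*(u F 1*u F 5) + 15104*(u F 2*u F 4) + 8576*(u F 3*u F 3) + 4928*(u F 0*u F 0*u F 4) + 16128*(u F 0*u F 1*u F 3) + 14336*(u F 0*u F 2*u F 2) + 12992*(u F 1*u F 1*u F 2) + 4480*(u F 0*u F 0*u F 0*u F 2) + 5040*(u F 0*u F 0*u F 1*u F 1) + 336*(u F 0*u F 0*u F 0*u F 0*u F 0) := by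
  rw [← sub_eq_zero]
  have hg := g3_eq h
  have hg1 := congrArg (sh 1) hg
  have ec : sh 1 (gg F 3) = sh 0 (sh 1 (sh 3 F)) := by rw [gg, sh_comm 1 0]
  simp only [sh_add, sh_mul, sh_lit, zero_mul, zero_add, ec] at hg1
  refine eq_zero_of' _ ?_ ?_ (F13_app h)
  · apply cancel_nat 2 (by norm_num)
    simp only [sh_sub, sh_add, sh_mul, sh0_u, sh_lit, zero_mul, zero_add, Nat.reduceAdd, Nat.cast_ofNat]
    linear_combination 2*hg1 + (1792*(u F 4) + 4480*(u F 0*u F 2) + 2240*(u F 1*u F 1) + 1120*(u F 0*u F 0*u F 0))*d1u0 h + (3584*(u F 3) + 4480*(u F 0*u F 1))*d1u1 h + (5376*(u F 2) + 2240*(u F 0*u F 0))*d1u2 h + (3584*(u F 1))*d1u3 h + (1792*(u F 0))*d1u4 h + (512)*d1u6 h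
  · have e1 : del (sh 1 (sh 3 F)) = 12 * gg F 3 + 28 * sh 1 (sh 2 F) := by
      have := del_shs 0 (sh 3 F)
      rw [zero_add] at this; rw [this, del_shs 2 F, delF h, h.hE1]
      simp only [sh_add, sh_mul, sh_zero, sh_natCast, zero_add, zero_mul, gg, sh_comm 1 0]; push_cast; ring
    simp only [del_sub, del_add, del_mul, del_lit, e1, del_u0 h, du1 h, du2 h, du3 h, du4 h, du5 h, du6 h, du7 h, du8 h, du9 h, du10 h, zero_mul, zero_add, mul_zero, add_zero]
    linear_combination 12*hg + 224*F12_eq h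
theorem F14_app (h : Vir F E) : (4096 * sh 1 (sh 4 F) - (4096*(u F 10) + 24576*(u F 0*u F 8) + 86016*(u F 1*u F 7) + 251904*(u F 2*u F 6) + 423936*(u F 3*u F 5) + 261120*(u F 4*u F 4) + 59904*(u F 0*u F 0*u F 6) + 313344*(u F 0*u F 1*u F 5) + 718848*(u F 0*u F 2*u F 4) + 414720*(u F 0*u F 3*u F 3) + 385536*(u F 1*u F 1*u F 4) + 1391616*(u F 1*u F 2*u F 3) + 364032*(u F 2*u F 2*u F 2) + 75264*(u F 0*u F 0*u F 0*u F 4) + 387072*(u F 0*u F 0*u F 1*u F 3) + 330624*(u F 0*u F 0*u F 2*u F 2) + 645120*(u F 0*u F 1*u F 1*u F 2) + 60480*(u F 1*u F 1*u F 1*u F 1) + 50400*(u F 0*u F 0*u F 0*u F 0*u F 2) + 80640*(u F 0*u F 0*u F 0*u F 1*u F 1) + 2520*(u F 0*u F 0*u F 0*u F 0*u F 0*u F 0))) 0 = 0 := by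
  have e := v0s h 4
  have e' : sh 1 (sh 4 F) 0 = F (1 ::ₘ {4}) := pr F 4 1
  simp only [add_app, sub_app, lit_mul_app, mul_zero_app, e', e, N4 h, u0_app_zero h, u1_app_zero h, uz2 h, uz3 h, uz4 h, uz5 h, uz6 h, uz7 h, uz8 h, uz9 h, uz10 h]
  norm_num
theorem F14_eq (h : Vir F E) : 4096 * sh 1 (sh 4 F) = 4096*(u F 10) + 24576*(u F 0*u F 8) + 86016*(u F 1*u F 7) + 251904*(u F 2*u F 6) + 423936*(u F 3*u F 5) + 261120*(u F 4*u F 4) + 59904*(u F 0*u F 0*u F 6) + 313344*(u F 0*u F 1*u F 5) + 718848*(u F 0*u F 2*u F 4) + 414720*(u F 0*u F 3*u F 3) + 385536*(u F 1*u F 1*u F 4) + 1391616*(u F 1*u F 2*u F 3) + 364032*(u F 2*u F 2*u F 2) + 75264*(u F 0*u F 0*u F 0*u F 4) + 387072*(u F 0*u F 0*u F 1*u F 3) + 330624*(u F 0*u F 0*u F 2*u F 2) + 645120*(u F 0*u F 1*u F 1*u F 2) + 60480*(u F 1*u F 1*u F 1*u F 1) + 50400*(u F 0*u F 0*u F 0*u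 F 0*u F 2) + 80640*(u F 0*u F 0*u F 0*u F 1*u F 1) + 2520*(u F 0*u F 0*u F 0*u F 0*u F 0*u F 0) := by
  rw [← sub_eq_zero]
  have hg := g4_eq h
  have hg1 := congrArg (sh 1) hg
  have ec : sh 1 (gg F 4) = sh 0 (sh 1 (sh 4 F)) := by rw [gg, sh_comm 1 0]
  simp only [sh_add, sh_mul, sh_lit, zero_mul, zero_add, ec] at hg1
  refine eq_zero_of' _ ?_ ?_ (F14_app h)
  · apply cancel_nat 2 (by norm_num)
    simp only [sh_sub, sh_add, sh_mul, sh0_u, sh_lit, zero_mul, zero_add, Nat.reduceAdd, Nat.cast_ofNat]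
    linear_combination 2*hg1 + (18432*(u F 6) + 64512*(u F 0*u F 4) + 129024*(u F 1*u F 3) + 96768*(u F 2*u F 2) + 80640*(u F 0*u F 0*u F 2) + 80640*(u F 0*u F 1*u F 1) + 10080*(u F 0*u F 0*u F 0*u F 0))*d1u0 h + (55296*(u F 5) + 129024*(u F 0*u F 3) + 236544*(u F 1*u F 2) + 80640*(u F 0*u F 0*u F 1))*d1u1 h + (116736*(u F 4) + 193536*(u F 0*u F 2) + 118272*(u F 1*u F 1) + 26880*(u F 0*u F 0*u F 0))*d1u2 h + (141312*(u F 3) + 129024*(u F 0*u F 1))*d1u3 h + (116736*(u F 2) + 32256*(u F 0*u F 0))*d1u4 h + (55296*(u F 1))*d1u5 h + (18432*(u F 0))*d1u6 h + (4096)*d1u8 h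
  · have e1 : del (sh 1 (sh 4 F)) = 12 * gg F 4 + 36 * sh 1 (sh 3 F) := by
      have := del_shs 0 (sh 4 F)
      rw [zero_add] at this; rw [this, del_shs 3 F, delF h, h.hE1]
      simp only [sh_add, sh_mul, sh_zero, sh_natCast, zero_add, zero_mul, gg, sh_comm 1 0]; push_cast; ring
    simp only [del_sub, del_add, del_mul, del_lit, e1, del_u0 h, du1 h, du2 h, du3 h, du4 h, du5 h, du6 h, du7 h, du8 h, du9 h, du10 h, zero_mul, zero_add, mul_zero, add_zero]
    linear_combination 12*hg + 288*F13_eq h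
theorem F1111_eq (h : Vir F E) : 16 * sh 1 (sh 1 (sh 1 (sh 1 F))) = 16*(u F 10) + 96*(u F 0*u F 8) + 336*(u F 1*u F 7) + 960*(u F 2*u F 6) + 1704*(u F 3*u F 5) + 984*(u F 4*u F 4) + 216*(u F 0*u F 0*u F 6) + 1296*(u F 0*u F 1*u F 5) + 2592*(u F 0*u F 2*u F 4) + 1728*(u F 0*u F 3*u F 3) + 1404*(u F 1*u F 1*u F 4) + 5508*(u F 1*u F 2*u F 3) + 1296*(u F 2*u F 2*u F 2) + 216*(u F 0*u F 0*u F 0*u F 4) + 1620*(u F 0*u F 0*u F 1*u F 3) + 972*(u F 0*u F 0*u F 2*u F 2) + 2592*(u F 0*u F 1*u F 1*u F 2) + 162*(u F 1*u F 1*u F 1*u F 1) + 81*(u F 0*u F 0*u F 0*u F 0*u F 2) + 324*(u F 0*u F 0*u F 0*u F 1*u F 1) := by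
  have h1 := congrArg (sh 1) (F11_eq h)
  have h2 := congrArg (sh 1) h1
  simp only [sh_add, sh_mul, sh_lit, zero_mul, zero_add] at h1 h2
  have k1 : 16 * sh 1 (sh 1 (sh 1 F)) = 16*(u F 7) + 72*(u F 0*u F 5) + 144*(u F 1*u F 4) + 288*(u F 2*u F 3) + 108*(u F 0*u F 0*u F 3) + 324*(u F 0*u F 1*u F 2) + 36*(u F 1*u F 1*u F 1) + 54*(u F 0*u F 0*u F 0*u F 1) := by
    linear_combination 2*h1 + (24*(u F 2) + 18*(u F 0*u F 0))*d1u0 h + (12*(u F 1))*d1u1 h + (24*(u F 0))*d1u2 h + (8)*d1u4 h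
  have k2 := congrArg (sh 1) k1
  simp only [sh_add, sh_mul, sh_lit, zero_mul, zero_add] at k2
  apply cancel_nat 2 (by norm_num)
  push_cast
  linear_combination 2*k2 + (72*(u F 5) + 216*(u F 0*u F 3) + 324*(u F 1*u F 2) + 162*(u F 0*u F 0*u F 1))*d1u0 h + (144*(u F 4) + 324*(u F 0*u F 2) + 108*(u F 1*u F 1) + 54*(u F 0*u F 0*u F 0))*d1u1 h + (288*(u F 3) + 324*(u F 0*u F 1))*d1u2 h + (288*(u F 2) + 108*(u F 0*u F 0))*d1u3 h + (144*(u F 1))*d1u4 h + (72*(u F 0))*d1u5 h + (16)*d1u7 h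
/-- The decomposition behind the key positivity. -/
theorem G_eq (h : Vir F E) : 12288 * sh 1 (sh 4 F) + (3584*8) * (sh 1 (u F 0) * u F 5) + (1024*8) * (sh 1 (u F 0) * sh 1 (u F 2))
    + (512*8) * (sh 1 (u F 2) * u F 3) + (4608*8) * (u F 0 * (u F 3 * sh 1 (u F 0))) + (3072*8) * (u F 0 * (u F 3 * u F 3))
    + (384*8) * (u F 0 * (sh 1 (u F 0) * sh 1 (u F 0))) = 12288 * sh 1 (sh 1 (sh 1 (sh 1 F))) + (18432*(u F 2*u F 6) + 4096*(u F 3*u F 5) + 27648*(u F 4*u F 4) + 13824*(u F 0*u F 0*u F 6) + 165888*(u F 0*u F 2*u F 4) + 78336*(u F 1*u F 1*u F 4) + 96768*(u F 2*u F 2*u F 2) + 59904*(u F 0*u F 0*u F 0*u F 4) + 245376*(u F 0*u F 0*u F 2*u F 2) + 57024*(u F 1*u F 1*u F 1*u F 1) + 88992*(u F 0*u F 0*u F 0*u F 0*u F 2) + 7560*(u F 0*u F 0*u F 0*u F 0*u F 0*u F 0)) := by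
  have h0 := d1u0 h
  have h2 := d1u2 h
  linear_combination 3*F14_eq h - 768*F1111_eq h + 14336*u F 5*h0 + 2048*mulE h0 h2 + 2048*u F 3*h2 + 18432*u F 0*u F 3*h0 + 768*u F 0*mulE h0 h0

end Alg
end WittenAsym

set_option autoImplicit false
namespace WittenAsym
open Alg

/-- weight -/
def wt (s : Multiset ℕ) : ℕ := 2 * s.sum + Multiset.card s
/-- integer `X` -/
def XM (s : Multiset ℕ) : ℕ := wt s / 3
/-- integral nonnegative genus -/
def IG (s : Multiset ℕ) : Prop := ∃ g : ℕ, s.sum + 3 = 3 * g + Multiset.card s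
/-- `C` on multisets -/
def Cm (C : List ℕ → ℚ) (s : Multiset ℕ) : ℚ := C s.toList
/-- normalisation -/
def fac (X : ℕ) : ℚ := 2 * 12 ^ X * ((X - 1).factorial : ℚ)
/-- rescaled numbers -/
def Nf (C : List ℕ → ℚ) : Alg := fun s => if s = 0 then 0 else fac (XM s) * Cm C s

theorem wt_cons (a : ℕ) (s) : wt (a ::ₘ s) = 2 * a + 1 + wt s := by simp [wt]; ring
theorem fac_pos (X : ℕ) : 0 < fac X := by unfold fac; positivity

theorem IG_coe (l : List ℕ) : IntegralG l ↔ IG (l : Multiset ℕ) := by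
  unfold IntegralG IG gQ
  apply exists_congr
  intro g
  simp only [Multiset.sum_coe, Multiset.coe_card]
  constructor
  · intro h
    have : (l.sum : ℚ) + 3 = 3 * g + l.length := by rw [h]; ring
    exact_mod_cast this
  · intro h
    have : (l.sum : ℚ) + 3 = 3 * g + l.length := by exact_mod_cast h
    linear_combination -(1/3:ℚ) * this

theorem IG_dvd {s : Multiset ℕ} (h : IG s) : wt s = 3 * XM s := by
  obtain ⟨g, hg⟩ := h
  unfold XM wt; omega

variable {C : List ℕ → ℚ}

theorem Cm_coe (hC : IsNormalizedWitten C) (l : List ℕ) : Cm C (l : Multiset ℕ) = C l := by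
  apply hC.symm
  exact Multiset.coe_eq_coe.1 (Multiset.coe_toList _)

theorem Cm_vanish (hC : IsNormalizedWitten C) {s : Multiset ℕ} (h : ¬ IG s) : Cm C s = 0 := by
  apply hC.vanish
  rwa [IG_coe, Multiset.coe_toList]

theorem N_vanish (hC : IsNormalizedWitten C) {s : Multiset ℕ} (h : ¬ IG s) : Nf C s = 0 := by
  unfold Nf; rw [Cm_vanish hC h]; simp

theorem N_cons (a : ℕ) (s) : Nf C (a ::ₘ s) = fac (XM (a ::ₘ s)) * Cm C (a ::ₘ s) := by
  unfold Nf; simp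

theorem select_coe (r : List ℕ) (I : Finset (Fin r.length)) :
    ((select r I : List ℕ) : Multiset ℕ) = I.val.map r.get := by
  unfold select
  rw [← Multiset.map_coe, ← Multiset.filter_coe]
  congr 1
  have : ((List.finRange r.length : List _) : Multiset (Fin r.length)) = (Finset.univ : Finset (Fin r.length)).val := rfl
  rw [this, ← Finset.filter_val]
  congr 1
  ext i; simp

theorem powerset_antidiag {ι : Type} [DecidableEq ι] (r : ι → ℕ) (f : Multiset ℕ → Multiset ℕ → ℚ) (T : Finset ι) :
    ∑ I ∈ T.powerset, f (I.val.map r) ((T \ I).val.map r)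
      = ((T.val.map r).antidiagonal.map fun p => f p.1 p.2).sum := by
  induction T using Finset.induction_on generalizing f with
  | empty => simp
  | insert a T ha ih =>
    rw [Finset.sum_powerset_insert ha, Finset.insert_val_of_notMem ha, Multiset.map_cons,
      Multiset.antidiagonal_cons]
    simp only [Multiset.map_add, Multiset.sum_add, Multiset.map_map, Function.comp_def, Prod.map, id]
    rw [← ih (fun p q => f p (r a ::ₘ q)), ← ih (fun p q => f (r a ::ₘ p) q)]
    congr 1
    · apply Finset.sum_congr rfl
      intro I hI
      rw [Finset.mem_powerset] at hI
      rw [Finset.insert_sdiff_of_notMem _ (fun h => ha (hI h)),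
        Finset.insert_val_of_notMem (by simp [ha]), Multiset.map_cons]
    · apply Finset.sum_congr rfl
      intro I hI
      rw [Finset.mem_powerset] at hI
      rw [Finset.insert_sdiff_insert, Finset.insert_val_of_notMem (fun h => ha (hI h)), Multiset.map_cons,
        Finset.sdiff_insert_of_notMem ha]

theorem sum_select (r : List ℕ) (f : Multiset ℕ → Multiset ℕ → ℚ) :
    ∑ I : Finset (Fin r.length), f (select r I : List ℕ) (select r Iᶜ : List ℕ)
      = ((r : Multiset ℕ).antidiagonal.map fun p => f p.1 p.2).sum := by
  have h := powerset_antidiag r.get f Finset.univ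
  have e : (Finset.univ : Finset (Fin r.length)).val.map r.get = (r : Multiset ℕ) := by
    rw [Fin.univ_val_map]; simp
  rw [e] at h
  rw [← h, Finset.powerset_univ]
  apply Finset.sum_congr rfl
  intro I _
  rw [select_coe, select_coe, Finset.compl_eq_univ_sdiff]

theorem fac_step (X : ℕ) (hX : 2 ≤ X) : fac X = 12 * (X - 1) * fac (X - 1) := by
  obtain ⟨k, rfl⟩ : ∃ k, X = k + 2 := ⟨X - 2, by omega⟩
  unfold fac
  simp only [Nat.add_sub_cancel, show k + 2 - 1 = k + 1 from rfl, Nat.factorial_succ, pow_succ]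
  push_cast; ring

theorem set_coe (r : List ℕ) (j : Fin r.length) (v : ℕ) :
    ((r.set j.val v : List ℕ) : Multiset ℕ) = v ::ₘ (r : Multiset ℕ).erase (r.get j) := by
  have h1 := List.set_perm_cons_eraseIdx j.isLt v
  have h2 := List.getElem_cons_eraseIdx_perm j.isLt
  have h3 : (r : Multiset ℕ) = r.get j ::ₘ (r.eraseIdx j.val : Multiset ℕ) := (Multiset.coe_eq_coe.2 h2).symm
  rw [Multiset.coe_eq_coe.2 h1, h3, Multiset.erase_cons_head]; rfl

theorem N_dvv_big (hC : IsNormalizedWitten C) (d : ℕ) (s : Multiset ℕ) (hg : IG (d ::ₘ s)) (hX : 2 ≤ XM (d ::ₘ s)) :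
    Nf C (d ::ₘ s) = (s.map fun j : ℕ => if 1 ≤ d + j then 4 * (2 * (j:ℚ) + 1) * Nf C ((d + j - 1) ::ₘ s.erase j) else 0).sum
      + ∑ a ∈ Finset.range (d - 1), (8 * Nf C (a ::ₘ (d - 2 - a) ::ₘ s) + (sh a (Nf C) * sh (d - 2 - a) (Nf C)) s) := by
  induction s using Quotient.inductionOn with
  | h r =>
  rw [Multiset.quot_mk_to_coe] at *
  have hX0 := IG_dvd hg
  set X := XM (d ::ₘ (r : Multiset ℕ)) with hXd
  have eX : XQ (d :: r) = X := by
    have : 2 * ((d :: r).sum : ℚ) + ((d::r).length : ℚ) = 3 * X := by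
      have h0 : 2 * (d :: r).sum + (d::r).length = 3 * X := by
        rw [← hX0]; simp [wt]
      exact_mod_cast h0
    rw [XQ, this]; ring
  have eXN : XN (d :: r) = X := by
    rw [hXd, XM, wt, XN]; simp
  have hd := hC.dvv d r ((IG_coe _).2 hg) (by rw [eX]; exact_mod_cast hX)
  have hX1 : ((X:ℚ) - 1) ≠ 0 := by
    have : (2:ℚ) ≤ X := by exact_mod_cast hX
    intro h; linarith
  rw [N_cons, ← hXd]
  rw [show (d ::ₘ (r : Multiset ℕ)) = ((d :: r : List ℕ) : Multiset ℕ) from rfl, Cm_coe hC, hd, mul_add]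
  rw [eX, eXN]
  congr 1
  · rw [Multiset.map_coe, Multiset.sum_coe, ← Fin.sum_univ_fun_getElem, Finset.mul_sum]
    apply Finset.sum_congr rfl
    intro j _
    change _ = if 1 ≤ d + r.get j then _ else _
    split_ifs with hj
    · rw [N_cons, ← Cm_coe hC, set_coe]
      have e : XM ((d + r.get j - 1) ::ₘ (r : Multiset ℕ).erase (r.get j)) = X - 1 := by
        have hm : r.get j ∈ (r : Multiset ℕ) := by simp
        have h1 := erase_lvl hm
        have h2 : wt ((d + r.get j - 1) ::ₘ (r : Multiset ℕ).erase (r.get j)) + 3 = wt (d ::ₘ (r : Multiset ℕ)) := by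
          rw [wt_cons, wt_cons, wt, wt]; omega
        rw [XM]; omega
      rw [show (r[j.val]) = r.get j from rfl, e, fac_step X hX]
      field_simp
      try ring
    · simp
  · rw [Finset.mul_sum]
    apply Finset.sum_congr rfl
    intro a ha
    rw [Finset.mem_range] at ha
    rw [mul_add]
    congr 1
    · rw [N_cons, ← Cm_coe hC]
      have e : XM (a ::ₘ (d - 2 - a) ::ₘ (r : Multiset ℕ)) = X - 1 := by
        have h2 : wt (a ::ₘ (d - 2 - a) ::ₘ (r : Multiset ℕ)) + 3 = wt (d ::ₘ (r : Multiset ℕ)) := by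
          simp only [wt_cons]; omega
        rw [XM]; omega
      rw [e, fac_step X hX]
      simp only [← Multiset.cons_coe]
      field_simp
      try ring
    · rw [mul_app]
      simp only [sh_app]
      rw [← sum_select r (fun p q => Nf C (a ::ₘ p) * Nf C ((d-2-a) ::ₘ q)), Finset.mul_sum]
      apply Finset.sum_congr rfl
      intro I _
      have hsp : ((select r I : List ℕ) : Multiset ℕ) + ((select r Iᶜ : List ℕ) : Multiset ℕ) = (r : Multiset ℕ) := by
        rw [select_coe, select_coe, ← Multiset.map_add]
        have : I.val + (Iᶜ).val = (Finset.univ : Finset (Fin r.length)).val := by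
          have := Finset.disjUnion_eq_union I Iᶜ disjoint_compl_right
          rw [Finset.union_compl] at this
          rw [← this]; rfl
        rw [this, Fin.univ_val_map]; simp
      set p := select r I
      set q := select r Iᶜ
      have hwt : wt (a ::ₘ (p : Multiset ℕ)) + wt ((d-2-a) ::ₘ (q : Multiset ℕ)) + 3 = wt (d ::ₘ (r : Multiset ℕ)) := by
        rw [← hsp]; simp only [wt_cons]; simp only [wt, Multiset.sum_add, Multiset.card_add]; omega
      have ewp : 2 * (a + p.sum) + (1 + p.length) = wt (a ::ₘ (p : Multiset ℕ)) := by simp [wt_cons, wt]; ring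
      rw [ewp]
      split_ifs with h3
      · have e1 : XN (a :: p) = XM (a ::ₘ (p : Multiset ℕ)) := by simp [XN, XM, wt]
        have e2 : XN ((d-2-a) :: q) = XM ((d-2-a) ::ₘ (q : Multiset ℕ)) := by simp [XN, XM, wt]
        rw [e1, e2, N_cons, N_cons, ← Cm_coe hC, ← Cm_coe hC]
        simp only [← Multiset.cons_coe]
        set Y := XM (a ::ₘ (p : Multiset ℕ)) with hY
        set Z := XM ((d-2-a) ::ₘ (q : Multiset ℕ)) with hZ
        have hYZ : X = Y + Z + 1 := by
          rw [hY, hZ, XM, XM]; omega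
        unfold fac
        have : ((X-1).factorial : ℚ) ≠ 0 := by positivity
        have h12 : (12:ℚ)^X = 12 * 12^Y * 12^Z := by rw [hYZ]; ring
        rw [h12]
        field_simp
        ring
      · have : ¬ IG (a ::ₘ (p : Multiset ℕ)) := fun h => h3 ⟨_, IG_dvd h⟩
        rw [N_vanish hC this]; simp

theorem N_dvv_not (hC : IsNormalizedWitten C) (d : ℕ) (s : Multiset ℕ) (hg : ¬ IG (d ::ₘ s)) :
    Nf C (d ::ₘ s) = (s.map fun j : ℕ => if 1 ≤ d + j then 4 * (2 * (j:ℚ) + 1) * Nf C ((d + j - 1) ::ₘ s.erase j) else 0).sum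
      + ∑ a ∈ Finset.range (d - 1), (8 * Nf C (a ::ₘ (d - 2 - a) ::ₘ s) + (sh a (Nf C) * sh (d - 2 - a) (Nf C)) s) := by
  rw [N_vanish hC hg]
  rw [Multiset.sum_eq_zero, Finset.sum_eq_zero, add_zero]
  · intro a ha
    rw [Finset.mem_range] at ha
    rw [N_vanish hC, mul_app, Multiset.sum_eq_zero]
    · norm_num
    · intro x hx
      obtain ⟨p, hp, rfl⟩ := Multiset.mem_map.1 hx
      have hp := Multiset.mem_antidiagonal.1 hp
      by_cases h1 : IG (a ::ₘ p.1)
      · have h2 : ¬ IG ((d-2-a) ::ₘ p.2) := by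
          rintro ⟨g2, h2⟩
          obtain ⟨g1, h1⟩ := h1
          apply hg
          refine ⟨g1 + g2, ?_⟩
          rw [← hp]
          simp only [Multiset.sum_cons, Multiset.card_cons, Multiset.sum_add, Multiset.card_add] at *
          omega
        simp only [sh_app]
        rw [N_vanish hC h2, mul_zero]
      · simp only [sh_app]
        rw [N_vanish hC h1, zero_mul]
    · rintro ⟨g, h1⟩
      apply hg
      refine ⟨g + 1, ?_⟩
      simp only [Multiset.sum_cons, Multiset.card_cons] at *
      omega
  · intro x hx
    obtain ⟨j, hj, rfl⟩ := Multiset.mem_map.1 hx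
    have h1 := erase_lvl hj
    split_ifs with hdj
    · rw [N_vanish hC, mul_zero]
      rintro ⟨g, h2⟩
      apply hg
      refine ⟨g, ?_⟩
      simp only [Multiset.sum_cons, Multiset.card_cons] at *
      omega
    · rfl

theorem small_X {d : ℕ} {s : Multiset ℕ} (hg : IG (d ::ₘ s)) (hX : ¬ 2 ≤ XM (d ::ₘ s)) :
    (d = 1 ∧ s = 0) ∨ (d = 0 ∧ s = {0, 0}) := by
  have h := IG_dvd hg
  rw [wt_cons] at h
  have h3 : 2 * d + 1 + wt s = 3 := by omega
  rcases d with _ | _ | d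
  · right
    refine ⟨rfl, ?_⟩
    obtain ⟨g, hg⟩ := hg
    simp only [Multiset.sum_cons, Multiset.card_cons] at hg
    have hs : s.sum = 0 := by
      by_cases h0 : s = 0
      · subst h0; rfl
      · have := Multiset.card_pos.2 h0
        unfold wt at h3; omega
    have hc : Multiset.card s = 2 := by unfold wt at h3; omega
    rw [Multiset.card_eq_two] at hc
    obtain ⟨x, y, rfl⟩ := hc
    simp at hs
    rw [hs.1, hs.2]
  · left
    refine ⟨rfl, ?_⟩
    have hc : Multiset.card s = 0 := by unfold wt at h3; omega
    exact Multiset.card_eq_zero.1 hc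
  · omega

/-- the extra term in the string equation -/
def E0 : Alg := fun s => if s = {0, 0} then 8 else 0

theorem N1_val (hC : IsNormalizedWitten C) : Nf C {1} = 4 := by
  have := hC.init1
  rw [show ({1} : Multiset ℕ) = 1 ::ₘ 0 from rfl, N_cons]
  rw [show Cm C (1 ::ₘ 0) = C [1] from Cm_coe hC [1], this]
  simp [fac, XM, wt]; norm_num
theorem N000_val (hC : IsNormalizedWitten C) : Nf C (0 ::ₘ {0, 0}) = 8 := by
  have := hC.init3
  rw [N_cons]
  rw [show Cm C (0 ::ₘ {0,0}) = C [0,0,0] from Cm_coe hC [0,0,0], this]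
  simp [fac, XM, wt]; norm_num

theorem N_string (hC : IsNormalizedWitten C) : sh 0 (Nf C) = Lm (Nf C) + E0 := by
  ext s
  have key : (s.map fun j : ℕ => if 1 ≤ 0 + j then 4 * (2 * (j:ℚ) + 1) * Nf C ((0 + j - 1) ::ₘ s.erase j) else 0).sum
      = Lm (Nf C) s := by
    rw [Lm, S_app]
    congr 1
    apply Multiset.map_congr rfl
    intro j _
    rw [dn]
    rcases j with _ | j
    · simp
    · simp
  rw [sh_app, add_app, ← key]
  by_cases hg : IG (0 ::ₘ s)
  · by_cases hX : 2 ≤ XM (0 ::ₘ s)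
    · rw [N_dvv_big hC 0 s hg hX]
      have : s ≠ {0, 0} := by
        rintro rfl; simp [XM, wt] at hX
      rw [E0, if_neg this]; simp
    · rcases small_X hg hX with h | ⟨_, h⟩
      · omega
      · rw [h, N000_val hC, E0, if_pos rfl]; simp
  · rw [N_dvv_not hC 0 s hg]
    have : s ≠ {0, 0} := by
      rintro rfl; exact hg ⟨0, by simp⟩
    rw [E0, if_neg this]; simp

theorem four_app (s) : (4 : Alg) s = if s = 0 then 4 else 0 := by
  have := natCast_app_mul 4 1 s
  push_cast at this
  rw [mul_one] at this
  rw [this, one_app]; split_ifs <;> norm_num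

theorem N_dil (hC : IsNormalizedWitten C) : sh 1 (Nf C) = Lp 0 (Nf C) + 4 := by
  ext s
  have key : (s.map fun j : ℕ => if 1 ≤ 1 + j then 4 * (2 * (j:ℚ) + 1) * Nf C ((1 + j - 1) ::ₘ s.erase j) else 0).sum
      = Lp 0 (Nf C) s := by
    rw [Lp, S_app]
    congr 1
    apply Multiset.map_congr rfl
    intro j _
    simp
  rw [sh_app, add_app, ← key, four_app]
  by_cases hs : s = 0
  · subst hs; simp; exact N1_val hC
  · rw [if_neg hs]
    by_cases hg : IG (1 ::ₘ s)
    · by_cases hX : 2 ≤ XM (1 ::ₘ s)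
      · rw [N_dvv_big hC 1 s hg hX]; simp
      · rcases small_X hg hX with h | h
        · exact absurd h.2 hs
        · omega
    · rw [N_dvv_not hC 1 s hg]; simp

theorem N_dvv (hC : IsNormalizedWitten C) (m : ℕ) : sh (m+2) (Nf C) = Lp (m+1) (Nf C)
      + 8 * (∑ p ∈ Finset.HasAntidiagonal.antidiagonal m, sh p.1 (sh p.2 (Nf C)))
      + ∑ p ∈ Finset.HasAntidiagonal.antidiagonal m, sh p.1 (Nf C) * sh p.2 (Nf C) := by
  ext s
  have key : (s.map fun j : ℕ => if 1 ≤ (m+2) + j then 4 * (2 * (j:ℚ) + 1) * Nf C (((m+2) + j - 1) ::ₘ s.erase j) else 0).sum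
      = Lp (m+1) (Nf C) s := by
    rw [Lp, S_app]
    congr 1
    apply Multiset.map_congr rfl
    intro j _
    rw [if_pos (by omega), sh_app]
    congr 3; omega
  have e : Nf C ((m+2) ::ₘ s) = (s.map fun j : ℕ => if 1 ≤ (m+2) + j then 4 * (2 * (j:ℚ) + 1) * Nf C (((m+2) + j - 1) ::ₘ s.erase j) else 0).sum
      + ∑ a ∈ Finset.range ((m+2) - 1), (8 * Nf C (a ::ₘ ((m+2) - 2 - a) ::ₘ s) + (sh a (Nf C) * sh ((m+2) - 2 - a) (Nf C)) s) := by
    by_cases hg : IG ((m+2) ::ₘ s)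
    · by_cases hX : 2 ≤ XM ((m+2) ::ₘ s)
      · exact N_dvv_big hC _ s hg hX
      · rcases small_X hg hX with h | h <;> omega
    · exact N_dvv_not hC _ s hg
  rw [sh_app, e, key, add_app, add_app, c8_app, sum_app, sum_app, add_assoc]
  congr 1
  rw [Finset.mul_sum, ← Finset.sum_add_distrib]
  rw [Finset.Nat.sum_antidiagonal_eq_sum_range_succ (fun a b => 8 * sh a (sh b (Nf C)) s + (sh a (Nf C) * sh b (Nf C)) s)]
  apply Finset.sum_congr rfl
  intro a _
  simp only [sh_app, Nat.add_sub_cancel]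
  rw [Multiset.cons_swap]

theorem T_app (s : Multiset ℕ) : T s = if s = {0} then 4 else 0 := by
  rw [T, S_app]
  by_cases h : s = {0}
  · subst h; simp [one_app]
  · rw [if_neg h]
    apply Multiset.sum_eq_zero
    intro x hx
    obtain ⟨j, hj, rfl⟩ := Multiset.mem_map.1 hx
    split_ifs with h0
    · subst h0
      rw [one_app, if_neg, mul_zero]
      intro he
      apply h
      rw [← Multiset.cons_erase hj, he]; rfl
    · simp

theorem N_vir (hC : IsNormalizedWitten C) : Vir (Nf C) E0 where
  hE := by
    ext s
    rw [show (2 * T) s = 2 * T s from natCast_app_mul 2 T s, T_app, sh_app, E0]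
    have : (0 ::ₘ s = {0, 0}) ↔ s = {0} := by
      rw [show ({0,0} : Multiset ℕ) = 0 ::ₘ {0} from rfl]; exact Multiset.cons_inj_right 0
    by_cases h : s = {0}
    · rw [if_pos (this.2 h), if_pos h]; norm_num
    · rw [if_neg (fun h' => h (this.1 h')), if_neg h]; norm_num
  hE1 := by
    intro k; ext s
    rw [sh_app, E0, if_neg]; rfl
    intro h
    have : k + 1 ∈ ({0, 0} : Multiset ℕ) := by rw [← h]; simp
    simp at this
  hE0 := by simp [E0]
  vm := N_string hC
  v0 := N_dil hC
  vs := N_dvv hC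

end WittenAsym

set_option autoImplicit false
namespace WittenAsym
open Alg

/-- search tree with natural number keys and values -/
inductive Tr where
  | l : Tr
  | n : Tr → ℕ → ℕ → Tr → Tr

/-- lookup -/
def Tr.find : Tr → ℕ → Option ℕ
  | .l, _ => none
  | .n a k v b, c => cond (Nat.beq c k) (some v) (cond (Nat.ble c k) (a.find c) (b.find c))

/-- all nodes -/
def Tr.all (f : ℕ → ℕ → Bool) : Tr → Bool
  | .l => true
  | .n a k v b => a.all f && (f k v && b.all f)

/-- addition of options -/
def oadd : Option ℕ → Option ℕ → Option ℕ
  | some a, some b => some (a + b)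
  | _, _ => none
/-- multiplication of options -/
def omul : Option ℕ → Option ℕ → Option ℕ
  | some a, some b => some (a * b)
  | _, _ => none

/-- value of a list without ones, from its code, weight and length -/
def base (t : Tr) (c w n : ℕ) : Option ℕ :=
  cond (Nat.beq n 0) (some 0) (cond (Nat.beq (w % 3) 0)
    (cond (Nat.ble n (w / 3 + 2)) (t.find c) (some 0)) (some 0))

/-- dilaton -/
def dil (o : Option ℕ) (w n : ℕ) : ℕ → Option ℕ
  | 0 => o
  | r + 1 => oadd (omul (some (4 * (w + 3 * r))) (dil o w n r)) (some (cond (Nat.beq (n + r) 0) 4 0))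

/-- evaluation -/
def evg (t : Tr) : List ℕ → ℕ → ℕ → ℕ → ℕ → Option ℕ
  | [], r, c, w, n => dil (base t c w n) w n r
  | x :: l, r, c, w, n => cond (Nat.beq x 1) (evg t l (r + 1) c w n) (evg t l r (c + 64 ^ x) (w + (2 * x + 1)) (n + 1))

/-- evaluation of a list -/
def evl (t : Tr) (l : List ℕ) : Option ℕ := evg t l 0 0 0 0

/-- string part -/
def strg (t : Tr) : List ℕ → List ℕ → Option ℕ
  | _, [] => some 0
  | pre, x :: f => oadd (cond (Nat.beq x 0) (some 0) (omul (some (4 * (2 * x + 1))) (evl t ((x - 1) :: (pre ++ f)))))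
      (strg t (x :: pre) f)

/-- linear part -/
def lind (t : Tr) (d : ℕ) : List ℕ → List ℕ → Option ℕ
  | _, [] => some 0
  | pre, x :: f => oadd (omul (some (4 * (2 * x + 1))) (evl t ((x + d) :: (pre ++ f))))
      (lind t d (x :: pre) f)

/-- splittings -/
def spl (t : Tr) : List ℕ → List ℕ → List ℕ → Option ℕ
  | [], p, q => omul (evl t p) (evl t q)
  | x :: f, p, q => oadd (spl t f p (x :: q)) (spl t f (x :: p) q)

/-- quadratic part -/
def quad (t : Tr) (f : List ℕ) : ℕ → ℕ → Option ℕ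
  | 0, b => oadd (omul (some 8) (evl t (0 :: b :: f))) (spl t f [0] [b])
  | a + 1, b => oadd (oadd (omul (some 8) (evl t ((a + 1) :: b :: f))) (spl t f [a + 1] [b])) (quad t f a (b + 1))

/-- right side of the recursion -/
def rhs (t : Tr) : List ℕ → Option ℕ
  | [] => none
  | 0 :: f => oadd (strg t [] f) (some (if f = [0, 0] then 8 else 0))
  | 1 :: _ => none
  | (m + 2) :: f => oadd (lind t (m + 1) [] f) (quad t f m 0)

/-- code of a list -/
def cdl : List ℕ → ℕ
  | [] => 0
  | x :: l => 64 ^ x + cdl l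

/-- weight of a list -/
def wtl : List ℕ → ℕ
  | [] => 0
  | x :: l => (2 * x + 1) + wtl l

/-- decode -/
def dec : ℕ → ℕ → ℕ → List ℕ
  | 0, _, _ => []
  | fuel + 1, i, c => cond (Nat.beq c 0) [] (cond (Nat.beq (c % 64) 0) (dec fuel (i + 1) (c / 64)) (i :: dec fuel i (c - 1)))

/-- check of a node -/
def ck (t : Tr) (k v : ℕ) : Bool :=
  let l := dec 100 0 k
  Nat.beq (cdl l) k && (Nat.ble (wtl l) 63 && (match rhs t l with
    | some v' => Nat.beq v' v
    | none => false))

/-- the table of values -/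
def tab : Tr :=
  (.n (.n (.n (.n (.n (.n (.n (.n (.n (.n (.n .l 4097 80 .l) 8194 76800 (.n .l 12288 3225600 .l)) 16385
  15482880000 (.n (.n .l 20482 130056192000000 .l) 24576 13005619200000000 .l)) 28673 218494402560000000000 (.n
  (.n (.n .l 32770 5034111034982400000000000 .l) 36864 799970584569053184000000000 .l) 40961
  28798941044485914624000000000000 (.n (.n .l 262146 2240 .l) 266240 64960 .l))) 270337 215040000 (.n (.n (.n
  (.n .l 274434 1362493440000 .l) 278528 119527833600000 (.n .l 282625 1655057940480000000 .l)) 286722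
  32333961048883200000000 (.n (.n .l 290816 4746257769273753600000000 .l) 294913 149978585206011985920000000000
  .l)) 299010 5989630253965379842867200000000000 (.n (.n (.n .l 524289 3637760 .l) 528386 16407552000 .l) 532480
  1234329600000 (.n (.n .l 536577 13803297177600000 .l) 540674 225194897571840000000 .l)))) 544768
  30317242849689600000000 (.n (.n (.n (.n (.n .l 548865 833329221225519513600000000 .l) 552962
  29398697146419762954240000000000 (.n .l 557056 5706212568100865939865600000000000 .l)) 786432 14626304000 (.n
  (.n .l 790529 128255877120000 .l) 794626 1713542352076800000 .l)) 798720 209759481888768000000 (.n (.n (.n .l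
  802817 4963077630732533760000000 .l) 806914 153379358779250206310400000000 .l) 811008
  27915191491984185360384000000000 (.n (.n .l 1048578 14364658237440000 .l) 1052672 1584136681881600000 .l)))
  1056769 31857303651876864000000 (.n (.n (.n (.n .l 1060866 854049056823611228160000000 .l) 1064960
  145093567945964204851200000000 .l) 1069057 5912297951664741493506048000000000 (.n (.n .l 1310721
  221779135463424000000 .l) 1314818 5098746421397422080000000 .l)) 1318912 804524225279872204800000000 (.n (.n
  (.n .l 1323009 29001961145457608491008000000000 .l) 1572864 4781430941551165440000000 .l) 1576961
  151225677810630446284800000000 (.n (.n .l 1581058 6033742678022520053956608000000000 .l) 1835010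
  29640232850883567471820800000000 .l))))) 1839104 5733118002640225554137088000000000 (.n (.n (.n (.n (.n (.n .l
  16777216 1680 .l) 16781313 3548160 (.n .l 16785410 16257024000 .l)) 16789504 1230888960000 (.n (.n .l 16793601
  13756229222400000 .l) 16797698 224656836526080000000 .l)) 16801792 30279578576486400000000 (.n (.n (.n .l
  16805889 832171275804318105600000000 .l) 16809986 29365761810580792934400000000000 .l) 16814080
  5702210986799898663321600000000000 (.n (.n .l 17039362 230307840 .l) 17043456 14463590400 .l))) 17047553
  127498420224000 (.n (.n (.n (.n .l 17051650 1708282879672320000 .l) 17055744 209382561703526400000 (.n .l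
  17059841 4954357831261224960000000 .l)) 17063938 153180501564865904640000000000 (.n (.n .l 17068032
  27891364423581919346688000000000 .l) 17301505 1336508006400 .l)) 17305602 14323218481152000 (.n (.n (.n .l
  17309696 1579046908723200000 .l) 17313793 31782816320480870400000 .l) 17317890 852764380936601075712000000 (.n
  (.n .l 17321984 144935658184079572992000000000 .l) 17326081 5906180865993211518124032000000000 .l)))) 17563648
  13117321573171200 (.n (.n (.n (.n (.n .l 17567745 221150432656097280000 .l) 17571842 5090445994487080550400000
  (.n .l 17575936 803331839182057242624000000 .l)) 17580033 28965942217739019799756800000000 (.n (.n .l 17825794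
  32752897334166159360000 .l) 17829888 4771862993814316646400000 .l)) 17833985 151002957416898018410496000000
  (.n (.n (.n .l 17838082 6027810199065909295337963520000000 .l) 18087937 840192333029846286336000000 .l)
  18092034 29609230838455865274531840000000 (.n (.n .l 18096128 5726964103840335633422745600000000 .l) 18350080
  28040623750530145053573120000000 .l))) 33554432 195793920 (.n (.n (.n (.n .l 33558529 1323321753600 .l)
  33562626 14261441789952000 .l) 33566720 1575687990804480000 (.n (.n .l 33570817 31714809625549209600000 .l)
  33574914 851464794009375866880000000 .l)) 33579008 144796050119311176499200000000 (.n (.n (.n .l 33583105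
  5900296065704982617260032000000000 .l) 33816578 133281585561600 .l) 33820672 13052309372928000 (.n (.n .l
  33824769 220461726160650240000 .l) 33828866 5081166758618018611200000 .l)))))) 33832960
  802306009360402219008000000 (.n (.n (.n (.n (.n (.n (.n .l 33837057 28931164961081682139545600000000 .l)
  34078721 1675376478152294400 (.n .l 34082818 32691681718557474816000 .l)) 34086912 4762840389720358256640000
  (.n (.n .l 34091009 150778460073671856960307200000 .l) 34095106 6021650224229383348307361792000000 .l))
  34340864 30465575969448001536000 (.n (.n (.n .l 34344961 838705325315818656890880000 .l) 34349058
  29576281922478987639835852800000 .l) 34353152 5721141598626559892605894656000000 (.n (.n .l 34603010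
  154428844413520622187970560000 .l) 34607104 28004397015904270692227481600000 .l))) 34865153
  5939540492264768340769112064000000 (.n (.n (.n (.n .l 50331648 119489126400000 .l) 50335745
  1667745925300224000 (.n .l 50339842 32615564910935408640000 .l)) 50343936 4755632192957605478400000 (.n (.n .l
  50348033 150564745684273657282560000000 .l) 50352130 6015408932934875890896076800000000 .l)) 50593794
  227637545548854067200 (.n (.n (.n .l 50597888 30386683933322379264000 .l) 50601985 837157371236543291719680000
  .l) 50606082 29541186176470890506197401600000 (.n (.n .l 50610176 5715832859664877377892122624000000 .l)
  50855937 4991936504966437404672000 .l)))) 50860034 154233894580042068960215040000 (.n (.n (.n (.n (.n .l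
  50864128 27970030946476653341677977600000 .l) 51118080 145457907230340227977445376000 (.n .l 51122177
  5932515840986206590894908375040000 .l)) 67108864 209761849882548633600 (.n (.n .l 67112961
  4979796614060162678784000 .l) 67117058 154014894704546527209062400000 .l)) 67121152
  27939775278238039556908646400000 (.n (.n (.n .l 67371010 858273161908851541278720000 .l) 67375104
  145232933876601420030935040000 .l) 67379201 5925387096255602094632651980800000 (.n (.n .l 67633153
  29078982938258672350484496384000 .l) 83886080 803953844369736880619520000 .l))) 83890177
  29036161937519308375798579200000 (.n (.n (.n (.n .l 84148226 6047229463137101657609569566720000 .l) 100663296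
  5726366099808374633153282703360000 .l) 1073741825 73920 (.n (.n .l 1073745922 227082240 .l) 1073750016
  14476492800 .l)) 1073754113 127120637952000 (.n (.n (.n .l 1073758210 1703596397690880000 .l) 1073762304
  209236482588672000000 .l) 1073766401 4947907876497653760000000 (.n (.n .l 1073770498
  152990329390614813081600000000 .l) 1073774592 27876643978140085911552000000000 .l))))) 1074003968 198302720
  (.n (.n (.n (.n (.n (.n .l 1074008065 1327295692800 .l) 1074012162 14266123812864000 (.n .l 1074016256
  1577456755015680000 .l)) 1074020353 31729397560403558400000 (.n (.n .l 1074024450 851511767059723714560000000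
  .l) 1074028544 144843816881165539737600000000 .l)) 1074032641 5901167863791256564924416000000000 (.n (.n (.n
  .l 1074266114 133134911078400 .l) 1074270208 13081826348236800 .l) 1074274305 220608408736235520000 (.n (.n .l
  1074278402 5081346832964832460800000 .l) 1074282496 802675755027372441600000000 .l))) 1074286593
  28936586295937475385753600000000 (.n (.n (.n (.n .l 1074528257 1676035562471424000 .l) 1074532354
  32686459255636623360000 .l) 1074536448 4766057306697970483200000 (.n (.n .l 1074540545
  150813221997825346240512000000 .l) 1074544642 6021665796325862121846865920000000 .l)) 1074790400
  30489915661622968320000 (.n (.n (.n .l 1074794497 838888926942266287718400000 .l) 1074798594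
  29575211264084268860571648000000 .l) 1074802688 5722772090558462286417100800000000 (.n (.n .l 1075052546
  154412912425230516879360000000 .l) 1075056640 28014074365622161401446400000000 .l)))) 1075314689
  5940151938447849497800212480000000 (.n (.n (.n (.n (.n .l 1090519041 15753830400 .l) 1090523138
  132475237171200 (.n .l 1090527232 13042086956236800 .l)) 1090531329 220021740860866560000 (.n (.n .l
  1090535426 5072360390415876096000000 .l) 1090539520 801766359849039298560000000 .l)) 1090543617
  28903556985710900045414400000000 (.n (.n (.n .l 1090781184 120005015961600 .l) 1090785281 1669636630197043200
  .l) 1090789378 32618508817117741056000 (.n (.n .l 1090793472 4758549900787093340160000 .l) 1090797569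
  150602160335194740385382400000 .l))) 1090801666 6015549438976987344698081280000000 (.n (.n (.n (.n .l
  1091043330 227553496578706636800 .l) 1091047424 30417284161798668288000 .l) 1091051521
  837425687802523617853440000 (.n (.n .l 1091055618 29541446642201434705310515200000 .l) 1091059712
  5717420616845555070847156224000000 .l)) 1091305473 4993174176065227063296000 (.n (.n (.n .l 1091309570
  154223858690808754093424640000 .l) 1091313664 27980395870826960610184396800000 .l) 1091567616
  145522028893663057862983680000 (.n (.n .l 1091571713 5933309074346471451444589363200000 .l) 1107296257
  13897882710835200 .l))))))) 1107300354 226949576593401446400 (.n (.n (.n (.n (.n (.n (.n (.n .l 1107304448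
  30357873086605295616000 .l) 1107308545 836013101437430928506880000 (.n .l 1107312642
  29506793014941067598679244800000 .l)) 1107316736 5712534319905100105871523840000000 (.n (.n .l 1107558400
  210113442335372083200 .l) 1107562497 4982205713066508681216000 .l)) 1107566594 154018363088244609657077760000
  (.n (.n (.n .l 1107570688 27949691677358758088304230400000 .l) 1107820546 858157266826944080510976000 .l)
  1107824640 145306483572006138289324032000 (.n (.n .l 1107828737 5926406392109611505974153052160000 .l)
  1108082689 29083478618527225813445640192000 .l))) 1124073473 31921773167052324864000 (.n (.n (.n (.n .l
  1124077570 856785200311033349013504000 .l) 1124081664 145115482899898830988247040000 (.n .l 1124085761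
  5919647176404054147025443225600000 .l)) 1124335616 804555839854013715578880000 (.n (.n .l 1124339713
  29042983861018742060363022336000 .l) 1124597762 6046898036301371526653776232448000 .l)) 1140850689
  151230010091246397790617600000 (.n (.n (.n .l 1140854786 6040504039987934592743384285184000 .l) 1141112832
  5728551630479872935689277407232000 .l) 2147483650 1386337075200 (.n (.n .l 2147487744 119824485580800 .l)
  2147491841 1665345429857894400 .l)))) 2147495938 32551449000230780928000 (.n (.n (.n (.n (.n .l 2147500032
  4754880666102965207040000 .l) 2147504129 150437434857245273751552000000 (.n .l 2147508226
  6009591513853490311232225280000000 .l)) 2147745793 13915527000883200 (.n (.n .l 2147749890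
  226954960295480524800 .l) 2147753984 30382696348048687104000 .l)) 2147758081 836271087737882951024640000 (.n
  (.n (.n .l 2147762178 29507541948925519313711923200000 .l) 2147766272 5714008952975369789924966400000000 .l)
  2148007936 210380325479409254400 (.n (.n .l 2148012033 4984047339109707939840000 .l) 2148016130
  154017439558760760984207360000 .l))) 2148020224 27959259751066829381330534400000 (.n (.n (.n (.n .l 2148270082
  858059303978955448516608000 .l) 2148274176 145372248216624636792668160000 .l) 2148278273
  5927311522026063412295683276800000 (.n (.n .l 2148532225 29087630342904308412721397760000 .l) 2164260866
  1723972650585292800 .l)) 2164264960 209838509580091392000 (.n (.n (.n .l 2164269057 4973939715332345167872000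
  .l) 2164273154 153812224415607747237642240000 .l) 2164277248 27931404870109719568790323200000 (.n (.n .l
  2164523009 31939152911014035456000 .l) 2164527106 856780276069471705104384000 .l))))) 2164531200
  145180597979265152342556672000 (.n (.n (.n (.n (.n (.n .l 2164535297 5920666043730183272411053424640000 .l)
  2164785152 805057724282235474935808000 (.n .l 2164789249 29048692784389923334948651008000 .l)) 2165047298
  6046591004663704534576873340928000 (.n (.n .l 2181038082 5108735048293615140864000 .l) 2181042176
  803747966457651117686784000 .l)) 2181046273 29010150908193276142974664704000 (.n (.n (.n .l 2181300225
  151270013116288392461549568000 .l) 2181304322 6040449536041682940483889790976000 .l) 2181562368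
  5730501110141998768591416066048000 (.n (.n .l 2197815298 29645402304588829391421702144000 .l) 2197819392
  5724204122965422568768033259520000 .l))) 3221225472 1581472786179686400 (.n (.n (.n (.n .l 3221229569
  31873771420086435840000 .l) 3221233666 855452376085208921800704000 (.n .l 3221237760
  145070747408524569892356096000 .l)) 3221241857 5915232123049420376626912296960000 (.n (.n .l 3221487618
  5108433784016272883712000 .l) 3221491712 804205796790096063627264000 .l)) 3221495809
  29016101597590379724319752192000 (.n (.n (.n .l 3221749761 151303144225500462254653440000 .l) 3221753858
  6040333210830452919832997265408000 .l) 3222011904 5732297638796996176634103988224000 (.n (.n .l 3238002688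
  4768365460374738173952000 .l) 3238006785 151067848203712526089715712000 .l)))) 3238010882
  6034120651599278321317183488000000 (.n (.n (.n (.n (.n .l 3238264834 29644454673172035176604106752000 .l)
  3238268928 5726053629697158406255757230080000 (.n .l 3254779904 27995832428355000497722097664000 .l))
  4294967297 839232321025953918615552000 (.n (.n .l 4294971394 29609177639546838698805952512000 .l) 4294975488
  5722056122897212367168801341440000 .l)) 4295229440 28006915676054588271976513536000 (.n (.n (.n .l 4311744513
  5935515471728445265390243676160000 .l) 68719476738 3843840 .l) 68719480832 197317120 (.n (.n .l 68719484929
  1321050931200 .l) 68719489026 14219526537216000 .l))) 68719493120 1575625563832320000 (.n (.n (.n (.n .l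
  68719497217 31678554537197568000000 .l) 68719501314 850313750514216468480000000 .l) 68719505408
  144747164706068968243200000000 (.n (.n .l 68719509505 5896218386633723171831808000000000 .l) 68719738881
  15836620800 .l)) 68719742978 132614325043200 (.n (.n (.n .l 68719747072 13054994310758400 .l) 68719751169
  220141226085580800000 .l) 68719755266 5072955124688407756800000 (.n (.n .l 68719759360
  802007016825547653120000000 .l) 68719763457 28908150653022368484556800000000 .l)))))) 68720001024
  120362008166400 (.n (.n (.n (.n (.n (.n (.n .l 68720005121 1671316589150208000 .l) 68720009218
  32624097505789870080000 (.n .l 68720013312 4760692383484477440000000 .l)) 68720017409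
  150635237837685412331520000000 (.n (.n .l 68720021506 6015755490441561271959552000000000 .l) 68720263170
  227544442737131520000 .l)) 68720267264 30440894374804193280000 (.n (.n (.n .l 68720271361
  837684321059768736153600000 .l) 68720275458 29542638189697994990813184000000 .l) 68720279552
  5718689277207929895612579840000000 (.n (.n .l 68720525313 4994855784382464000000000 .l) 68720529410
  154225583595217024450560000000 .l))) 68720533504 27988970380669950615355392000000 (.n (.n (.n (.n .l
  68720787456 145580279385853353000960000000 .l) 68720791553 5934215993147822354548654080000000 (.n .l
  68736253954 1389317529600 .l)) 68736258048 119669501952000 (.n (.n .l 68736262145 1665140565344256000 .l)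
  68736266242 32554127941372477440000 .l)) 68736270336 4754109928721036083200000 (.n (.n (.n .l 68736274433
  150433150120383165235200000000 .l) 68736278530 6009658165539400194824601600000000 .l) 68736516097
  13924039178649600 (.n (.n .l 68736520194 227030131838051942400 .l) 68736524288 30375777329501700096000 .l))))
  68736528385 836261874454694964756480000 (.n (.n (.n (.n (.n .l 68736532482 29508480095105137463053516800000
  .l) 68736536576 5713691172665389690273136640000000 (.n .l 68736778240 210374988510855168000 .l)) 68736782337
  4984494471269839798272000 (.n (.n .l 68736786434 154029239140279144100659200000 .l) 68736790528
  27957480276901558738747392000000 .l)) 68737040386 858157400979827054346240000 (.n (.n (.n .l 68737044480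
  145366460091652933335121920000 .l) 68737048577 5927426275750745635950900019200000 .l) 68737302529
  29089079090626328250443366400000 (.n (.n .l 68753031170 1725220721826201600 .l) 68753035264
  209749819268608819200 .l))) 68753039361 4973824327214784577536000 (.n (.n (.n (.n .l 68753043458
  153819685453809474286387200000 .l) 68753047552 27929286820577318498677555200000 .l) 68753293313
  31945893113741967360000 (.n (.n .l 68753297410 856896566687775823233024000 .l) 68753301504
  145167125562792477720576000000 .l)) 68753305601 5920667864619101911085639270400000 (.n (.n (.n .l 68753555456
  805034300790474289446912000 .l) 68753559553 29049804786705416585534767104000 .l) 68753817602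
  6046938184771766369516016107520000 (.n (.n .l 68769808386 5110088660970853367808000 .l) 68769812480
  803625661905720538300416000 .l))))) 68769816577 29010159437297514680974049280000 (.n (.n (.n (.n (.n (.n .l
  68770070529 151282126691140111542779904000 .l) 68770074626 6040821908475468017768180219904000 (.n .l
  68770332672 5730384323670524623871079874560000 .l)) 68786585602 29648586768268988747272421376000 (.n (.n .l
  68786589696 5723853816541379075042822848512000 .l) 69793218560 1235487052800 .l)) 69793222657
  13868466477465600 (.n (.n (.n .l 69793226754 226432786319592652800 .l) 69793230848 30348526595245867008000 .l)
  69793234945 835184243409748198686720000 (.n (.n .l 69793239042 29475121599249081081790464000000 .l)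
  69793243136 5710534206335838524685680640000000 .l))) 69793480706 1724582189275545600 (.n (.n (.n (.n .l
  69793484800 210015374417539891200 .l) 69793488897 4975881713908520583168000 .l) 69793492994
  153823665530047328944128000000 (.n (.n .l 69793497088 27938369065555414708597555200000 .l) 69793742849
  31957137386789142528000 .l)) 69793746946 856843862995237041340416000 (.n (.n (.n .l 69793751040
  145232028578472308307394560000 .l) 69793755137 5921632276134247927716721459200000 .l) 69794004992
  805478700531875970023424000 (.n (.n .l 69794009089 29054694873803637569869578240000 .l) 69794267138
  6046602083684589888306413568000000 .l)))) 69809995776 1580784658867814400 (.n (.n (.n (.n (.n .l 69809999873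
  31874419524426006528000 .l) 69810003970 855521255127857491869696000 (.n .l 69810008064
  145057139525116382926602240000 .l)) 69810012161 5915180622816890002781031628800000 (.n (.n .l 69810257922
  5109395940985713721344000 .l) 69810262016 804125718274828337676288000 .l)) 69810266113
  29016402726791682793798631424000 (.n (.n (.n .l 69810520065 151312784339995035263041536000 .l) 69810524162
  6040652095426160467558967279616000 .l) 69810782208 5732193012822523229705569566720000 (.n (.n .l 69826772992
  4767621259837182050304000 .l) 69826777089 151070682528490133806645248000 .l))) 69826781186
  6034378700614946394186077700096000 (.n (.n (.n (.n .l 69827035138 29646953839734527601407950848000 .l)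
  69827039232 5725798025057015661517565067264000 .l) 69843550208 27994078821566319304221130752000 (.n (.n .l
  70866960385 221345634861711360000 .l) 70866964482 5099860460395711954944000 .l)) 70866968576
  803393623540754376818688000 (.n (.n (.n .l 70866972673 28985358277693666601585344512000 .l) 70867222528
  4771347892522255908864000 .l) 70867226625 151108515019285791428837376000 (.n (.n .l 70867230722
  6034384150155905374536767373312000 .l) 70867484674 29645365362725591460404527104000 .l)))))))) 70867488768
  5727600571469183386978382512128000 (.n (.n (.n (.n (.n (.n (.n (.n (.n .l 70883737601
  839274198935959618191360000 .l) 70883741698 29611041825963926248577040384000 (.n .l 70883745792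
  5721755242661328823193803161600000 .l)) 70883999744 28005683628709576128507936768000 (.n (.n .l 70900514817
  5935671443839385605905580032000000 .l) 71940702210 154424274952896273369268224000 .l)) 71940706304
  27982336717130197484074696704000 (.n (.n (.n .l 71940964353 5936615282224148168659917864960000 .l)
  137438953473 128490653491200 .l) 137438957570 1719860325197414400 (.n (.n .l 137438961664
  209706979313870438400 .l) 137438965761 4968115067177410756608000 .l))) 137438969858
  153630627817478213232230400000 (.n (.n (.n (.n .l 137438973952 27919043794768597704769536000000 .l)
  137439215616 1583204986537574400 (.n .l 137439219713 31893055524671717376000 .l)) 137439223810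
  855611586601405158260736000 (.n (.n .l 137439227904 145103637870727671180165120000 .l) 137439232001
  5916115486765660894755028992000000 .l)) 137439477762 5109553397607686995968000 (.n (.n (.n .l 137439481856
  804522305970248195506176000 .l) 137439485953 29022495295907656657702748160000 .l) 137439739905
  151349658556815949304954880000 (.n (.n .l 137439744002 6040760560589994711844493721600000 .l) 137440002048
  5733817253437476365964568166400000 .l)))) 137455730689 221396984037605376000 (.n (.n (.n (.n (.n .l
  137455734786 5100712943456789987328000 .l) 137455738880 803290942995469411811328000 (.n .l 137455742977
  28985215658309369634414919680000 .l)) 137455992832 4771059661210248806400000 (.n (.n .l 137455996929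
  151114784581050661676777472000 .l) 137456001026 6034663298254142081673625337856000 .l)) 137456254978
  29647545215943694896234233856000 (.n (.n (.n .l 137456259072 5727417852271111233105517608960000 .l)
  137472507905 839348906630204847292416000 .l) 137472512002 29613271536667359006871781376000 (.n (.n .l
  137472516096 5721432753550671343699359694848000 .l) 137472770048 28004749522167493894638403584000 .l)))
  137489285121 5935897145836986548259945185280000 (.n (.n (.n (.n .l 138512695298 32761413323272617984000 .l)
  138512699392 4765287972924083404800000 .l) 138512703489 150920473518088949789097984000 (.n (.n .l 138512707586
  6028430604774138292049541070848000 .l) 138512957441 839574869157439897337856000 .l)) 138512961538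
  29612578871045225646888321024000 (.n (.n (.n .l 138512965632 5723204571005631826806888726528000 .l)
  138513219584 28015534992438869771019091968000 .l) 138529472514 154440563870736649876930560000 (.n (.n .l
  138529476608 27980596738426925927721074688000 .l) 138529734657 5936816044764918886461792583680000 .l)))))
  139586437120 145365184322620641628913664000 (.n (.n (.n (.n (.n (.n .l 139586441217
  5930657839361973283838251499520000 .l) 206158430208 30430466309606178816000 (.n .l 206158434305
  838327978662128289054720000 .l)) 206158438402 29579555315189199848293269504000 (.n (.n .l 206158442496
  5719108512449307121982902370304000 .l) 206158692354 154446862991100216078237696000 .l)) 206158696448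
  27989908183175923039954010112000 (.n (.n (.n .l 206158954497 5937858317078315374516402913280000 .l)
  206175207424 145357443905555932872966144000 .l) 206175211521 5930782370386268456395022008320000 (.n (.n .l
  207232172033 29072696286173281140521041920000 .l) 274877906946 6047120827524042477228376719360000 .l)))
  4398046511104 3203200 (.n (.n (.n (.n .l 4398046515201 15682867200 .l) 4398046519298 131957489664000 (.n .l
  4398046523392 13037222854656000 .l)) 4398046527489 219694873234636800000 (.n (.n .l 4398046531586
  5064319446810624000000000 .l) 4398046535680 801399762698895360000000000 .l)) 4398046539777
  28880103902376301166592000000000 (.n (.n (.n .l 4398046773250 1389317529600 .l) 4398046777344 119876146790400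
  .l) 4398046781441 1666206852710400000 (.n (.n .l 4398046785538 32556288289171046400000 .l) 4398046789632
  4755925335036395520000000 .l)))) 4398046793729 150459159993713374003200000000 (.n (.n (.n (.n (.n .l
  4398046797826 6009710994703034678771712000000000 .l) 4398047035393 13934784710246400 (.n .l 4398047039490
  227030062405386240000 .l)) 4398047043584 30393504679329792000000 (.n (.n .l 4398047047681
  836456565569633648640000000 .l) 4398047051778 29508801774111798224486400000000 .l)) 4398047055872
  5714807095498987033067520000000000 (.n (.n (.n .l 4398047297536 210551810366177280000 .l) 4398047301633
  4985897269406544691200000 .l) 4398047305730 154028640421847330979840000000 (.n (.n .l 4398047309824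
  27964729130986675655147520000000 .l) 4398047559682 858111841236480845414400000 .l))) 4398047563776
  145415927109603132702720000000 (.n (.n (.n (.n .l 4398047567873 5928182205712456769454735360000000 .l)
  4398047821825 29093046558495639758438400000000 .l) 4398063288320 1232258227200 (.n (.n .l 4398063292417
  13861647197798400 .l) 4398063296514 226427787167662080000 .l)) 4398063300608 30341459936909721600000 (.n (.n
  (.n .l 4398063304705 835121327797205729280000000 .l) 4398063308802 29474702667346374505267200000000 .l)
  4398063312896 5710176372895654864748544000000000 (.n (.n .l 4398063550466 1725220721826201600 .l)
  4398063554560 209925920346734592000 .l)))))) 4398063558657 4975446987656637972480000 (.n (.n (.n (.n (.n (.n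
  (.n .l 4398063562754 153824051641689180418867200000 .l) 4398063566848 27936056752473783329095680000000 (.n .l
  4398063812609 31958216023250829312000 .l)) 4398063816706 856896635276140310691840000 (.n (.n .l 4398063820800
  145215796956047899361280000000 .l) 4398063824897 5921484224401817514981457920000000 .l)) 4398064074752
  805397220957065488367616000 (.n (.n (.n .l 4398064078849 29054517921198348081876172800000 .l) 4398064336898
  6046800428717637711500515737600000 .l) 4398080065536 1579453039529164800 (.n (.n .l 4398080069633
  31869411445438414848000 .l) 4398080073730 855526770163700717322240000 .l))) 4398080077824
  145040748738835810929868800000 (.n (.n (.n (.n .l 4398080081921 5914979196041269565498327040000000 .l)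
  4398080327682 5110088660970853367808000 (.n .l 4398080331776 803987420935956662845440000 .l)) 4398080335873
  29015415310029288095770214400000 (.n (.n .l 4398080589825 151313953528750745648627712000 .l) 4398080593922
  6040822416440649053681032888320000 .l)) 4398080851968 5731890291835296495640793579520000 (.n (.n (.n .l
  4398096842752 4766189549144962498560000 .l) 4398096846849 151062578060553625880494080000 .l) 4398096850946
  6034435019226065841963820646400000 (.n (.n .l 4398097104898 29648586768268988747272421376000 .l) 4398097108992
  5725356120961675102289532026880000 .l)))) 4398113619968 27990726386339945870323089408000 (.n (.n (.n (.n (.n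
  .l 4399120252929 128348585164800 .l) 4399120257026 1719253409307033600 (.n .l 4399120261120
  209705942783361024000 .l)) 4399120265217 4967795178587019018240000 (.n (.n .l 4399120269314
  153623560227871479614668800000 .l) 4399120273408 27918847372490195337216000000000 .l)) 4399120515072
  1582565110795468800 (.n (.n (.n .l 4399120519169 31887401250742861824000 .l) 4399120523266
  855548219096475296071680000 .l) 4399120527360 145100858541649018277068800000 (.n (.n .l 4399120531457
  5915965554671625739173888000000000 .l) 4399120777218 5109284218271985303552000 .l))) 4399120781312
  804464168625877448392704000 (.n (.n (.n (.n .l 4399120785409 29021206873213108722283315200000 .l)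
  4399121039361 151341189918597145354567680000 .l) 4399121043458 6040612027598259740628064665600000 (.n (.n .l
  4399121301504 5733619269837565175463621427200000 .l) 4399137030145 221315357259988992000 .l)) 4399137034242
  5100053949000361967616000 (.n (.n (.n .l 4399137038336 803274699458209124450304000 .l) 4399137042433
  28984218977663781858548121600000 .l) 4399137292288 4770374014281169502208000 (.n (.n .l 4399137296385
  151103847961017966579941376000 .l) 4399137300482 6034461568399665433217303838720000 .l))))) 4399137554434
  29646679338551238285563265024000 (.n (.n (.n (.n (.n (.n .l 4399137558528 5727231694108506967322142965760000
  .l) 4399153807361 839236544780853477113856000 (.n .l 4399153811458 29611723000778133678506115072000 .l))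
  4399153815552 5721340665006525196496346808320000 (.n (.n .l 4399154069504 28003152819099648261699403776000 .l)
  4399170584577 5935577194755698788811019386880000 .l)) 4400193994754 32756489530581712896000 (.n (.n (.n .l
  4400193998848 4765056239616890241024000 .l) 4400194002945 150912968894993167980429312000 .l) 4400194007042
  6028250168366354094781901045760000 (.n (.n .l 4400194256897 839495361517351197474816000 .l) 4400194260994
  29611395952249001559126441984000 .l))) 4400194265088 5723090959309812649292810158080000 (.n (.n (.n (.n .l
  4400194519040 28014237404506703783905984512000 .l) 4400210771970 154431100891497326186594304000 .l)
  4400210776064 27979816298377765491824394240000 (.n (.n .l 4400211034113 5936565868720162384731722219520000 .l)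
  4401267736576 145358461840483244920799232000 .l)) 4401267740673 5930452447881132554461170892800000 (.n (.n (.n
  .l 4466765987842 14383565638041600 .l) 4466765991936 1579456139201740800 .l) 4466765996033
  31826656198552190976000 (.n (.n .l 4466766000130 854309755335618141880320000 .l) 4466766004224
  144985607961635313627955200000 .l)))) 4466766008321 5910646363919004041478144000000000 (.n (.n (.n (.n (.n .l
  4466766249985 221510456851267584000 .l) 4466766254082 5100824685810043846656000 (.n .l 4466766258176
  803609248194947985702912000 .l)) 4466766262273 28990039819840636248391680000000 (.n (.n .l 4466766512128
  4773698074337115635712000 .l) 4466766516225 151145218555450314782146560000 .l)) 4466766520322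
  6034689983578475100457716940800000 (.n (.n (.n .l 4466766774274 29646919747833834958435123200000 .l)
  4466766778368 5728820661771274620939062476800000 .l) 4466782765058 32766594066421383168000 (.n (.n .l
  4466782769152 4764205229520220323840000 .l) 4466782773249 150913133028949047241605120000 .l))) 4466782777346
  6028453052344834763874788966400000 (.n (.n (.n (.n .l 4466783027201 839573905517938074451968000 .l)
  4466783031298 29613548821507335685712904192000 .l) 4466783035392 5722806142223524550113618821120000 (.n (.n .l
  4466783289344 28013543646738416430282178560000 .l) 4466799542274 154450555923708213008007168000 .l))
  4466799546368 27977796611014786195491127296000 (.n (.n (.n .l 4466799804417 5936802365596811339740741632000000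
  .l) 4467839729664 30425357237086715904000 .l) 4467839733761 838252347514123544690688000 (.n (.n .l
  4467839737858 29578297549000429322731782144000 .l) 4467839741952 5719032202508545995374654914560000 .l)))))))
  4467839991810 154440568521533390636187648000 (.n (.n (.n (.n (.n (.n (.n (.n .l 4467839995904
  27988849084573495348414119936000 .l) 4467840253953 5937643913773286845467863285760000 (.n .l 4467856506880
  145347704617617137432788992000 .l)) 4467856510977 5930543055482205594124560629760000 (.n (.n .l 4468913471489
  29071149081412675327701811200000 .l) 4535485464577 4990065131233389182976000 .l)) 4535485468674
  154244541702140733645914112000 (.n (.n (.n .l 4535485472768 27965426020457692629924052992000 .l) 4535485726720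
  145412260517596289005780992000 .l) 4535485730817 5931649804746584042052381573120000 (.n (.n .l 4535502241793
  29072449293199004669596139520000 .l) 4536559206402 6046949050538071307974481018880000 .l))) 4604204941312
  5729010532262854444185362104320000 (.n (.n (.n (.n .l 8796093022208 13070931793920000 .l) 8796093026305
  220904973009616896000 (.n .l 8796093030402 5091611388361656238080000 .l)) 8796093034496
  802838701522058414653440000 (.n (.n .l 8796093038593 28959150257313878806364160000000 .l) 8796093284354
  32766594066421383168000 .l)) 8796093288448 4766719389916127035392000 (.n (.n (.n .l 8796093292545
  150944947726247767572480000000 .l) 8796093296642 6028546783392039238820167680000000 .l) 8796093546497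
  839780054755756990267392000 (.n (.n .l 8796093550594 29613551496444637922879078400000 .l) 8796093554688
  5724159130020696214103654400000000 .l)))) 8796093808640 28022054858644462420937932800000 (.n (.n (.n (.n (.n
  .l 8796109799424 30414635692822757376000 .l) 8796109803521 838200188941014015148032000 (.n .l 8796109807618
  29578635441994106210667724800000 .l)) 8796109811712 5718636016771172016869867520000000 (.n (.n .l
  8796110061570 154450555923708213008007168000 .l) 8796110065664 27986285812586457172530954240000 .l))
  8796110323713 5937651218024652220449360445440000 (.n (.n (.n .l 8796126576640 145327176166246788391501824000
  .l) 8796126580737 5930404528306386927304530984960000 .l) 8797166764033 4989286838934607233024000 (.n (.n .l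
  8797166768130 154235093793919722332356608000 .l) 8797166772224 27964879350351063218525306880000 .l)))
  8797167026176 145402503540153626136674304000 (.n (.n (.n (.n .l 8797167030273
  5931420701306643251884594298880000 .l) 8797183541249 29070610432874445722081034240000 .l) 8798240505858
  6046751607862472262867348357120000 (.n (.n .l 8864812498946 858250731372606278074368000 .l) 8864812503040
  145256655649659749708857344000 .l)) 8864812507137 5925595964062565280718226718720000 (.n (.n (.n .l
  8864812761089 29077587804390016231648788480000 .l) 8864829276162 6047158818651392322239106908160000 .l)
  8865886240768 5728808249750062571947378606080000 (.n (.n .l 13194139533312 804558228044685138984960000 .l)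
  13194139537409 29042607637899621447940177920000 .l))))) 13194139795458 6047158818651392322239106908160000 (.n
  (.n (.n (.n (.n (.n .l 13194156310528 5728379109614670305289169797120000 .l) 281474976710657 217817600 (.n .l
  281474976714754 1380092313600 .l)) 281474976718848 119691642470400 (.n (.n .l 281474976722945
  1662132997324800000 .l) 281474976727042 32491375831705190400000 .l)) 281474976731136 4751908159377899520000000
  (.n (.n (.n .l 281474976735233 150293652356583338803200000000 .l) 281474976739330
  6003740440706548626358272000000000 .l) 281474976972800 1237639603200 (.n (.n .l 281474976976897
  13879212009062400 .l) 281474976980994 226462007552901120000 .l))) 281474976985088 30358064262964838400000 (.n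
  (.n (.n (.n .l 281474976989185 835324993246857265152000000 .l) 281474976993282
  29475295024000273691443200000000 .l) 281474976997376 5711254816459906552430592000000000 (.n (.n .l
  281474977234946 1724801232804249600 .l) 281474977239040 210133879446306816000 .l)) 281474977243137
  4977181062531184066560000 (.n (.n (.n .l 281474977247234 153827231190873430346956800000 .l) 281474977251328
  27943191326031467098669056000000 .l) 281474977497089 31968768978389827584000 (.n (.n .l 281474977501186
  856866782784840762654720000 .l) 281474977505280 145267968322225274093568000000 .l)))) 281474977509377
  5922316647365772338396135424000000 (.n (.n (.n (.n (.n .l 281474977759232 805765588928180344848384000 .l)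
  281474977763329 29059051615683692963718758400000 (.n .l 281474978021378 6046594392173420518494437376000000
  .l)) 281474993487873 128348585164800 (.n (.n .l 281474993491970 1719476585732505600 .l) 281474993496064
  209648809618440192000 .l)) 281474993500161 4967475304279918510080000 (.n (.n (.n .l 281474993504258
  153622818136618955911987200000 .l) 281474993508352 27916906252644070698516480000000 .l) 281474993750016
  1582118757944524800 (.n (.n .l 281474993754113 31886742433934868480000 .l) 281474993758210
  855571494719365306122240000 .l))) 281474993762304 145088184688817971868467200000 (.n (.n (.n (.n .l
  281474993766401 5915834638799628109388709888000000 .l) 281474994012162 5109691949103442821120000 .l)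
  281474994016256 804388647337509632606208000 (.n (.n .l 281474994020353 29020857656015242803334348800000 .l)
  281474994274305 151343218602845754762461184000 .l)) 281474994278402 6040743079346308710029391298560000 (.n (.n
  (.n .l 281474994536448 5733422975074298801153145569280000 .l) 281475010265089 221315357259988992000 .l)
  281475010269186 5100353662441891037184000 (.n (.n .l 281475010273280 803176411446334539694080000 .l)
  281475010277377 28983425455456142146456780800000 .l)))))) 281475010527232 4769774587398111363072000 (.n (.n
  (.n (.n (.n (.n (.n .l 281475010531329 151102509366100767912493056000 .l) 281475010535426
  6034553176999514950021184225280000 (.n .l 281475010789378 29647801103861588050103500800000 .l))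
  281475010793472 5726957043979173254524871639040000 (.n (.n .l 281475027042305 839236544780853477113856000 .l)
  281475027046402 29612577880867602012032729088000 .l)) 281475027050496 5720998765009269908129206763520000 (.n
  (.n (.n .l 281475027304448 28001443058920711594646175744000 .l) 281475043819521
  5935577194755698788811019386880000 .l) 281476050452482 14375041538457600 (.n (.n .l 281476050456576
  1579694813990092800 .l) 281476050460673 31825340350347608064000 .l))) 281476050464770
  854264171211487319162880000 (.n (.n (.n (.n .l 281476050468864 144986527751314032348364800000 .l)
  281476050472961 5910566829270901814754017280000000 (.n .l 281476050714625 221459107675373568000 .l))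
  281476050718722 5100271712058457718784000 (.n (.n .l 281476050722816 803613646244089329352704000 .l)
  281476050726913 28989388663613081667816652800000 .l)) 281476050976768 4773387348130884747264000 (.n (.n (.n .l
  281476050980865 151137609628798865519935488000 .l) 281476050984962 6034502411354669937052813885440000 .l)
  281476051238914 29645861741808923797333475328000 (.n (.n .l 281476051243008 5728728775161648088655729786880000
  .l) 281476067229698 32759847889432215552000 .l)))) 281476067233792 4764347802655163154432000 (.n (.n (.n (.n
  (.n .l 281476067237889 150908950165426852463640576000 .l) 281476067241986 6028286708316995701247909560320000
  (.n .l 281476067491841 839499197823692845350912000 .l)) 281476067495938 29612173736891660786548604928000 (.n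
  (.n .l 281476067500032 5722786749930849218787048161280000 .l) 281476067753984 28012768624908780540448997376000
  .l)) 281476084006914 154438435258761474302017536000 (.n (.n (.n .l 281476084011008
  27977837011231814518359195648000 .l) 281476084269057 5936576663599210397386376478720000 .l) 281477124194304
  30425582273315733504000 (.n (.n .l 281477124198401 838214247620347982512128000 .l) 281477124202498
  29577212082283603913556885504000 .l))) 281477124206592 5719028583239234751375165358080000 (.n (.n (.n (.n .l
  281477124456450 154431612925034595329507328000 .l) 281477124460544 27988610036386265504768065536000 .l)
  281477124718593 5937453944536059413132130385920000 (.n (.n .l 281477140971520 145346522203097937878188032000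
  .l) 281477140975617 5930397771847889370683560427520000 .l)) 281478197936129 29070116335961788454535168000000
  (.n (.n (.n .l 281543696187392 13078319346892800 .l) 281543696191489 220935114225745920000 .l) 281543696195586
  5091716577659921104896000 (.n (.n .l 281543696199680 802859357432220601024512000 .l) 281543696203777
  28959495531483507663568896000000 .l))))) 281543696449538 32764767863326507008000 (.n (.n (.n (.n (.n (.n .l
  281543696453632 4767093268653042302976000 .l) 281543696457729 150948267255399729258823680000 (.n .l
  281543696461826 6028560831920786607258678067200000 .l)) 281543696711681 839784834202300239052800000 (.n (.n .l
  281543696715778 29613358931898828111306817536000 .l) 281543696719872 5724253296627903703329212989440000 .l))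
  281543696973824 28022577098706325146257326080000 (.n (.n (.n .l 281543712964608 30419976007115735040000 .l)
  281543712968705 838237724159154082283520000 .l) 281543712972802 29578807689711031186297454592000 (.n (.n .l
  281543712976896 5718708721767049465494943825920000 .l) 281543713226754 154447894169790939930820608000 .l)))
  281543713230848 27987106079902642693428215808000 (.n (.n (.n (.n .l 281543713488897
  5937675652501444601459779829760000 .l) 281543729741824 145335737841864226665136128000 .l) 281543729745921
  5930498565198808720569029099520000 (.n (.n .l 281544769929217 4989533514647407165440000 .l) 281544769933314
  154235592979436563825950720000 .l)) 281544769937408 27965420541864067249729437696000 (.n (.n (.n .l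
  281544770191360 145408039115400587759321088000 .l) 281544770195457 5931480772534131908439158292480000 .l)
  281544786706433 29071124941755505247696977920000 (.n (.n .l 281545843671042 6046743181880559383716885954560000
  .l) 281612415664130 858235914447200809648128000 .l)))) 281612415668224 145262164138321989687312384000 (.n (.n
  (.n (.n (.n .l 281612415672321 5925666126327298973605256232960000 .l) 281612415926273
  29077810379071224490607247360000 (.n .l 281612432441346 6047124719526668944954884096000000 .l))
  281613489405952 5728925307717330725136142172160000 (.n (.n .l 285873023221761 1673522522800128000 .l)
  285873023225858 32695744478391042048000 .l)) 285873023229952 4761378011815521288192000 (.n (.n (.n .l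
  285873023234049 150759283508533662842880000000 .l) 285873023238146 6022454544077431279913533440000000 .l)
  285873023483904 30441473649880989696000 (.n (.n .l 285873023488001 838458496751942460506112000 .l)
  285873023492098 29579313595561760225702707200000 .l))) 285873023496192 5719980631104935137262960640000000 (.n
  (.n (.n (.n .l 285873023746050 154445809593638267469692928000 .l) 285873023750144
  27995339743454881858789048320000 .l) 285873024008193 5938462894760413029537499054080000 (.n (.n .l
  285873039998977 4989286838934607233024000 .l) 285873040003074 154240385959428406848258048000 .l))
  285873040007168 27962889547591066117723914240000 (.n (.n (.n .l 285873040261120 145391919209136257104871424000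
  .l) 285873040265217 5931391907910046474833179443200000 .l) 285873056776193 29070610432874445722081034240000
  (.n (.n .l 285874096963586 858172136839520440025088000 .l) 285874096967680 145256805705257490510249984000
  .l))))))))) 285874096971777 5925476436246100770142059233280000 (.n (.n (.n (.n (.n (.n (.n (.n (.n (.n .l
  285874097225729 29076287592603686889754460160000 .l) 285874113740802 6046922218321000963766055075840000 (.n .l
  285875170705408 5728751856295123228800665518080000 .l)) 285941742698496 804613516169627268808704000 (.n (.n .l
  285941742702593 29043144987360230035685376000000 .l) 285941742960642 6047119607904272732454974914560000 .l))
  285941759475712 5728525042499485661862140313600000 (.n (.n (.n .l 290271069732865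
  151263581447393861708021760000 .l) 290271069736962 6040926870618394291700980776960000 .l) 290271069995008
  5730038367342247116670312120320000 (.n (.n .l 562949953421314 227599063100817408000 .l) 562949953425408
  30397170277726027776000 .l))) 562949953429505 837225752139921308516352000 (.n (.n (.n (.n .l 562949953433602
  29545300680271728278608281600000 .l) 562949953437696 5716127963839597862650380288000000 (.n .l 562949953683457
  4991161184160143376384000 .l)) 562949953687554 154242978196960053011939328000 (.n (.n .l 562949953691648
  27971235188914850728834498560000 .l) 562949953945600 145451497110305689602883584000 .l)) 562949953949697
  5932289124592669421685115453440000 (.n (.n (.n .l 562949970198530 858224812724871745241088000 .l)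
  562949970202624 145244151371400907654692864000 .l) 562949970206721 5925392527805678589036535480320000 (.n (.n
  .l 562949970460673 29076391146812761206297722880000 .l) 562949986975746 6047103181441443425056456704000000
  .l)))) 562951027163136 804603069706376407154688000 (.n (.n (.n (.n (.n .l 562951027167233
  29042239287199613711957360640000 .l) 562951027425282 6046919023095452094018512486400000 (.n .l 562951043940352
  5728463521435623531666273730560000 .l)) 563018672898049 151266797823800881730027520000 (.n (.n .l
  563018672902146 6040928664858766583718299566080000 .l) 563018673160192 5730150233909008923345593303040000 .l))
  567347999932418 29647854946273618096092610560000 (.n (.n (.n .l 567347999936512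
  5725375411545723127043582853120000 .l) 844424930131968 28001116416362323804359229440000 .l) 18014398509481986
  16554137600 (.n (.n .l 18014398509486080 1233283251200 .l) 18014398509490177 13832372512358400 .l)))
  18014398509494274 225915189885665280000 (.n (.n (.n (.n .l 18014398509498368 30327375024724377600000 .l)
  18014398509502465 834252070498420654080000000 .l) 18014398509506562 29442162301866219877171200000000 (.n (.n
  .l 18014398509510656 5707910957206796494700544000000000 .l) 18014398509744129 128592540876800 .l))
  18014398509748226 1719886431328665600 (.n (.n (.n .l 18014398509752320 209798696007892992000 .l)
  18014398509756417 4969040118185805742080000 .l) 18014398509760514 153627656649134159639347200000 (.n (.n .l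
  18014398509764608 27923259855754324586004480000000 .l) 18014398510006272 1584341682392268800 .l)))))
  18014398510010369 31901563855876915200000 (.n (.n (.n (.n (.n (.n .l 18014398510014466
  855597765831447061463040000 .l) 18014398510018560 145134030390796255179571200000 (.n .l 18014398510022657
  5916643799503264155873312768000000 .l)) 18014398510268418 5109357806251287773184000 (.n (.n .l
  18014398510272512 804758854320106481123328000 .l) 18014398510276609 29025887896420772930283110400000 .l))
  18014398510530561 151371176442393632094289920000 (.n (.n (.n .l 18014398510534658
  6040652684729878780676407296000000 .l) 18014398510792704 5734897393629258476653903872000000 .l)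
  18014398526259202 14383823944089600 (.n (.n .l 18014398526263296 1578816573426892800 .l) 18014398526267393
  31822214094979596288000 .l))) 18014398526271490 854269491308971834736640000 (.n (.n (.n (.n .l
  18014398526275584 144972317676234670394572800000 .l) 18014398526279681 5910390729391810729759211520000000 (.n
  .l 18014398526521345 221484190225858560000 .l)) 18014398526525442 5100745186300520300544000 (.n (.n .l
  18014398526529536 803507714251182235975680000 .l) 18014398526533633 28988635339266169968053452800000 .l))
  18014398526783488 4772945210074191101952000 (.n (.n (.n .l 18014398526787585 151138383857090052715708416000
  .l) 18014398526791682 6034623513149663401611236474880000 .l) 18014398527045634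
  29647071209738012545460994048000 (.n (.n .l 18014398527049728 5728475612116641141303017472000000 .l)
  18014398543036418 32766828848020979712000 .l)))) 18014398543040512 4763341765583871934464000 (.n (.n (.n (.n
  (.n .l 18014398543044609 150903619360730165406597120000 .l) 18014398543048706
  6028331774077442546314562764800000 (.n .l 18014398543298561 839528493203946637099008000 .l)) 18014398543302658
  29613358267168794681821626368000 (.n (.n .l 18014398543306752 5722431250819207857509939281920000 .l)
  18014398543560704 28011344950917155633472995328000 .l)) 18014398559813634 154451054669371101067345920000 (.n
  (.n (.n .l 18014398559817728 27975325713856579271544274944000 .l) 18014398560075777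
  5936644047165011109211432550400000 .l) 18014399583223808 13076709239193600 (.n (.n .l 18014399583227905
  220908837268094976000 .l) 18014399583232002 5091338189469747511296000 .l))) 18014399583236096
  802855979538588792520704000 (.n (.n (.n (.n .l 18014399583240193 28958884192209870568135065600000 .l)
  18014399583485954 32761643996772827136000 .l) 18014399583490048 4766938525195139284992000 (.n (.n .l
  18014399583494145 150942770857994629599461376000 .l) 18014399583498242 6028402971028280194241994424320000 .l))
  18014399583748097 839735585112139449237504000 (.n (.n (.n .l 18014399583752194
  29612390495952077373831118848000 .l) 18014399583756288 5724182641539418132699183841280000 .l)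
  18014399584010240 28021847563211270204984131584000 (.n (.n .l 18014399600001024 30418283461902336000000 .l)
  18014399600005121 838192301995643067432960000 .l)))))) 18014399600009218 29577763789701004816224878592000 (.n
  (.n (.n (.n (.n (.n (.n .l 18014399600013312 5718675426391251268935792721920000 .l) 18014399600263170
  154441058255489334339698688000 (.n .l 18014399600267264 27986614874677050990152122368000 .l))
  18014399600525313 5937506538590942751774883184640000 (.n (.n .l 18014399616778240
  145331773586763860743815168000 .l) 18014399616782337 5930340225813228287890450022400000 .l)) 18014400656965633
  4989153197419401314304000 (.n (.n (.n .l 18014400656969730 154228760138092225021083648000 .l)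
  18014400656973824 27965163430625215801982976000000 .l) 18014400657227776 145404051853259546604601344000 (.n
  (.n .l 18014400657231873 5931332606910959366912952238080000 .l) 18014400673742849
  29070077629788006701963673600000 .l))) 18014401730707458 6046579088665112807203877683200000 (.n (.n (.n (.n .l
  18014467228958721 1673941150801920000 .l) 18014467228962818 32697532857214697472000 (.n .l 18014467228966912
  4761455334081964277760000 .l)) 18014467228971009 150761291868401582808760320000 (.n (.n .l 18014467228975106
  6022477081486308163916818022400000 .l) 18014467229220864 30444886305351598080000 .l)) 18014467229224961
  838488686354770443632640000 (.n (.n (.n .l 18014467229229058 29579527110095691675642888192000 .l)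
  18014467229233152 5720023618028436838298859601920000 .l) 18014467229483010 154445264261073214371790848000 (.n
  (.n .l 18014467229487104 27995907291021517194251993088000 .l) 18014467229745153
  5938508145234474206091899043840000 .l)))) 18014467245735937 4989684823552374865920000 (.n (.n (.n (.n (.n .l
  18014467245740034 154243000455776865280327680000 .l) 18014467245744128 27963179188871530040845664256000 (.n .l
  18014467245998080 145397690131253984659243008000 .l)) 18014467246002177 5931472845425000257416698265600000 (.n
  (.n .l 18014467262513153 29071401991943688880694231040000 .l) 18014468302700546 858186645615316307017728000
  .l)) 18014468302704640 145259542161164817760518144000 (.n (.n (.n .l 18014468302708737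
  5925533627682273454880540590080000 .l) 18014468302962689 29076787215427731315448872960000 .l)
  18014468319477762 6046955559723315385433786941440000 (.n (.n .l 18014469376442368
  5728833100745845230510412922880000 .l) 18014535948435456 804653164206641404182528000 .l))) 18014535948439553
  29043668250417521318386728960000 (.n (.n (.n (.n .l 18014535948697602 6047122170225587715007661998080000 .l)
  18014535965212672 5728635135011500666667862589440000 .l) 18018796555993090 227624180780924928000 (.n (.n .l
  18018796555997184 30395261334037856256000 .l) 18018796556001281 837218479667293697605632000 .l))
  18018796556005378 29545342639159425278725324800000 (.n (.n (.n .l 18018796556009472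
  5716098319836828178694799360000000 .l) 18018796556255233 4991312493065111076864000 .l) 18018796556259330
  154245094341816850367643648000 (.n (.n .l 18018796556263424 27970983690375985612707594240000 .l)
  18018796556517376 145451731149213156721557504000 .l))))) 18018796556521473 5932309992237895769045493350400000
  (.n (.n (.n (.n (.n (.n .l 18018796572770306 858254138922516640432128000 .l) 18018796572774400
  145241378852131306349789184000 (.n .l 18018796572778497 5925379559387116742221611663360000 .l))
  18018796573032449 29076668197000944839294976000000 (.n (.n .l 18018796589547522
  6047170622599147236149050736640000 .l) 18018797629734912 804587446911232411435008000 .l)) 18018797629739009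
  29042225241643672504966840320000 (.n (.n (.n .l 18018797629997058 6046960797397608485616321822720000 .l)
  18018797646512128 5728427700829720370895598387200000 .l) 18018865275469825 151268364320674242075033600000 (.n
  (.n .l 18018865275473922 6040965345621288821641697034240000 .l) 18018865275731968
  5730143254641663339496734720000000 .l))) 18023194602504194 29648235908482842538813685760000 (.n (.n (.n (.n .l
  18023194602508288 5725334576388729414587693137920000 .l) 18295873486192640 210119727087542272000 .l)
  18295873486196737 4982207525833874079744000 (.n (.n .l 18295873486200834 154040448353613624700305408000 .l)
  18295873486204928 27949177430398708809455370240000 .l)) 18295873486454786 858239310247946924064768000 (.n (.n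
  (.n .l 18295873486458880 145298636061748284226535424000 .l) 18295873486462977
  5926311258308486346580080721920000 .l) 18295873486716929 29081755117987630983571046400000 (.n (.n .l
  18295873502969856 804503900984185640189952000 .l) 18295873502973953 29041934207937404350381424640000 .l))))
  18295873503232002 6047136506623636137969922867200000 (.n (.n (.n (.n (.n .l 18295873519747072
  5728133679285996907457937408000000 .l) 18295874559934465 151259951330952579089694720000 (.n .l
  18295874559938562 6040764820519044067567714959360000 .l)) 18295874560196608 5730047269928888756219318108160000
  (.n (.n .l 18295942205669378 29648042877624249585248501760000 .l) 18295942205673472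
  5725445898977547974985174220800000 .l)) 18300271532703744 28000912712523212536298864640000 (.n (.n (.n .l
  18577348462903297 5936208976546693514067947028480000 .l) 36028797018963969 31938198517306425344000 .l)
  36028797018968066 856942723300744907194368000 (.n (.n .l 36028797018972160 145161703011542635961647104000 .l)
  36028797018976257 5920537788113574905315390914560000 .l))) 36028797019226112 804914580732264551284736000 (.n
  (.n (.n (.n .l 36028797019230209 29047612856345085393984552960000 .l) 36028797019488258
  6047093097889444691565934018560000 .l) 36028797035741185 151261517855957741155123200000 (.n (.n .l
  36028797035745282 6040932291001786261477093539840000 .l) 36028797036003328 5729778712608563721249730068480000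
  .l)) 36028798092705794 29647019387966932632459018240000 (.n (.n (.n .l 36028798092709888
  5725375050816085743459662561280000 .l) 36028865738440704 28001583908659084035788636160000 .l)
  36033195065475073 5936233766823073347664745594880000 (.n (.n .l 1152921504606846976 14484870400 .l)
  1152921504606851073 127930375372800 .l))))))) 1152921504606855170 1714578512648601600 (.n (.n (.n (.n (.n (.n
  (.n (.n .l 1152921504606859264 209545950083678208000 .l) 1152921504606863361 4961468847040820674560000 (.n .l
  1152921504606867458 153429850552153122275328000000 .l)) 1152921504606871552 27904936436378389174026240000000
  (.n (.n .l 1152921504607109122 14383823944089600 .l) 1152921504607113216 1580596474301644800 .l))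
  1152921504607117313 31835926451318685696000 (.n (.n (.n .l 1152921504607121410 854304769229093559336960000 .l)
  1152921504607125504 145014097560012657052876800000 .l) 1152921504607129601 5911162721254201177512345600000000
  (.n (.n .l 1152921504607371265 221598103881842688000 .l) 1152921504607375362 5100745784347214217216000 .l)))
  1152921504607379456 803842662433914630438912000 (.n (.n (.n (.n .l 1152921504607383553
  28993548770473872238785331200000 .l) 1152921504607633408 4775707730145462190080000 (.n .l 1152921504607637505
  151168905380626526329896960000 .l)) 1152921504607641602 6034609873342361916415357747200000 (.n (.n .l
  1152921504607895554 29646096223791236044868812800000 .l) 1152921504607899648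
  5729918292470396975590460620800000 .l)) 1152921504623624192 13065584858726400 (.n (.n (.n .l
  1152921504623628289 220879468903661568000 .l) 1152921504623632386 5091425077110849404928000 .l)
  1152921504623636480 802754137996211238469632000 (.n (.n .l 1152921504623640577
  28957841784109609801010380800000 .l) 1152921504623886338 32766828848020979712000 .l)))) 1152921504623890432
  4766093976469276459008000 (.n (.n (.n (.n (.n .l 1152921504623894529 150938251230487686999441408000 .l)
  1152921504623898626 6028441348365704906574617640960000 (.n .l 1152921504624148481 839754138613748173111296000
  .l)) 1152921504624152578 29613361805614923271165181952000 (.n (.n .l 1152921504624156672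
  5723854952324949196609117224960000 .l) 1152921504624410624 28020443274452112542867128320000 .l))
  1152921504640401408 30409088493983367168000 (.n (.n (.n .l 1152921504640405505 838155830716061253107712000 .l)
  1152921504640409602 29578180096052088380489465856000 .l) 1152921504640413696
  5718312378501164756734480220160000 (.n (.n .l 1152921504640663554 154451054669371101067345920000 .l)
  1152921504640667648 27984398504682617262726709248000 .l))) 1152921504640925697
  5937551207899819743010860564480000 (.n (.n (.n (.n .l 1152921504657178624 145314285909619914508861440000 .l)
  1152921504657182721 5930249256362615794898231623680000 .l) 1152921505680588801 1673329309876224000 (.n (.n .l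
  1152921505680592898 32692628340354318336000 .l) 1152921505680596992 4761460033020273623040000 .l))
  1152921505680601089 150756601485919111184646144000 (.n (.n (.n .l 1152921505680605186
  6022312709470169506763967037440000 .l) 1152921505680850944 30441308259618127872000 .l) 1152921505680855041
  838428733775616084541440000 (.n (.n .l 1152921505680859138 29578347531003178036198637568000 .l)
  1152921505680863232 5719980447363191289579307008000000 .l))))) 1152921505681113090
  154438980339859134087168000000 (.n (.n (.n (.n (.n (.n .l 1152921505681117184 27995195375683287549336354816000
  .l) 1152921505681375233 5938331110943035803249074503680000 (.n .l 1152921505697366017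
  4989022801881316982784000 .l)) 1152921505697370114 154233560949384116906754048000 (.n (.n .l
  1152921505697374208 27962979684679399332611358720000 .l) 1152921505697628160 145390996313662985059958784000
  .l)) 1152921505697632257 5931281074218994838452222033920000 (.n (.n (.n .l 1152921505714143233
  29069849295895175465187409920000 .l) 1152921506754330626 858122875148785604886528000 .l) 1152921506754334720
  145257223939949902266630144000 (.n (.n .l 1152921506754338817 5925391420283120518044089057280000 .l)
  1152921506754592769 29075550301594741863528529920000 .l))) 1152921506771107842
  6046753069798378710988467732480000 (.n (.n (.n (.n .l 1152921507828072448 5728735364281396292845326827520000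
  .l) 1152921573326323714 227624180780924928000 .l) 1152921573326327808 30396788488988393472000 (.n (.n .l
  1152921573326331905 837234129951226802995200000 .l) 1152921573326336002 29545420397686776209885626368000 .l))
  1152921573326340096 5716131478652702478168427069440000 (.n (.n (.n .l 1152921573326585857
  4991428556841351905280000 .l) 1152921573326589954 154245099399754046546903040000 .l) 1152921573326594048
  27971330607104534660782227456000 (.n (.n .l 1152921573326848000 145454791909816742222757888000 .l)
  1152921573326852097 5932347286912888628021852897280000 .l)))) 1152921573343100930 858254138922516640432128000
  (.n (.n (.n (.n (.n .l 1152921573343105024 145244420211758400226197504000 .l) 1152921573343109121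
  5925427044550605050252183470080000 (.n .l 1152921573343363073 29076954054018447860847083520000 .l))
  1152921573359878146 6047170622599147236149050736640000 (.n (.n .l 1152921574400065536
  804612040214555862761472000 .l) 1152921574400069633 29042535020505010325642280960000 .l)) 1152921574400327682
  6046955700729808002396444426240000 (.n (.n (.n .l 1152921574416842752 5728503432399735448861566566400000 .l)
  1152921642045800449 151270517975671687678525440000 .l) 1152921642045804546 6040970564194172145296820142080000
  (.n (.n .l 1152921642046062592 5730213794771329496616146042880000 .l) 1152925902653358080
  210093213980762112000 .l))) 1152925902653362177 4982077717663078416384000 (.n (.n (.n (.n .l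
  1152925902653366274 154039962351822165736685568000 .l) 1152925902653370368 27948983487095576008914370560000
  .l) 1152925902653620226 858254138922516640432128000 (.n (.n .l 1152925902653624320
  145296169706503166622695424000 .l) 1152925902653628417 5926288587402475319026274795520000 .l))
  1152925902653882369 29081818434687087028847247360000 (.n (.n (.n .l 1152925902670135296
  804473205169679842148352000 .l) 1152925902670139393 29041706684329495177105244160000 .l) 1152925902670397442
  6047170622599147236149050736640000 (.n (.n .l 1152925902686912512 5728063476709864604569656360960000 .l)
  1152925903727099905 151258888980882787380756480000 .l)))))) 1152925903727104002
  6040768249325456801290487070720000 (.n (.n (.n (.n (.n (.n (.n .l 1152925903727362048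
  5730005949679799245735817379840000 .l) 1152925971372834818 29648235908482842538813685760000 (.n .l
  1152925971372838912 5725399500396046834619740323840000 .l)) 1152930300699869184
  28000515310764225920017367040000 (.n (.n .l 1153202979583557633 31936395626045374464000 .l)
  1153202979583561730 856928271324396323340288000 .l)) 1153202979583565824 145162003474188637657104384000 (.n
  (.n (.n .l 1153202979583569921 5920528061298643814410270801920000 .l) 1153202979583819776
  804899537407582342742016000 .l) 1153202979583823873 29047399401173649493642444800000 (.n (.n .l
  1153202979584081922 6047085449935407292225557626880000 .l) 1153202979600334849 151258888980882787380756480000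
  .l))) 1153202979600338946 6040899040129988922788429168640000 (.n (.n (.n (.n .l 1153202979600596992
  5729744368070735002739933184000000 .l) 1153202980657299458 29646831477658888830179082240000 (.n .l
  1153202980657303552 5725369484193104987144973189120000 .l)) 1153203048303034368
  28001390261695278870492610560000 (.n (.n .l 1153207377630068737 5936195124685633947839842222080000 .l)
  1170935903116328962 5109974743033188188160000 .l)) 1170935903116333056 803965523017951425331200000 (.n (.n (.n
  .l 1170935903116337153 29014447082737168145102929920000 .l) 1170935903116591105 151296224268989120265584640000
  .l) 1170935903116595202 6040983853931743464494255308800000 (.n (.n .l 1170935903116853248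
  5731337136558977861302867722240000 .l) 1170935903133106178 29648307136131150427528888320000 .l))))
  1170935903133110272 5725021373332518625685777940480000 (.n (.n (.n (.n (.n .l 1170935904190070784
  28000818960447906488443207680000 .l) 1170935971835805697 5936281294159495390562730639360000 (.n .l
  2305843009213693952 4769213846349221068800000 .l)) 2305843009213698049 151090766390749222246809600000 (.n (.n
  .l 2305843009213702146 6034804195780798275232789954560000 .l) 2305843009213956098
  29648307136131150427528888320000 .l)) 2305843009213960192 5726523718639710431947228446720000 (.n (.n (.n .l
  2305843009230471168 27998658951725492996438753280000 .l) 2305843010287435777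
  5936078579231169981901764034560000 .l) 73786976294838206465 1332608076800 (.n (.n .l 73786976294838210562
  14328202041753600 .l) 73786976294838214656 1578149110598860800 .l))) 73786976294838218753
  31777168363641372672000 (.n (.n (.n (.n .l 73786976294838222850 853034195105999833006080000 .l)
  73786976294838226944 144905939209235277545472000000 .l) 73786976294838231041
  5905886991527592598658088960000000 (.n (.n .l 73786976294838468608 13091541746483200 .l) 73786976294838472705
  221022750924079104000 .l)) 73786976294838476802 5091756993025973157888000 (.n (.n (.n .l 73786976294838480896
  803054017746035263143936000 .l) 73786976294838484993 28962641128922660009410560000000 .l) 73786976294838730754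
  32764299608877957120000 (.n (.n .l 73786976294838734848 4768867766872886476800000 .l) 73786976294838738945
  150971341331083917860536320000 .l))))) 73786976294838743042 6028504242237351940248620236800000 (.n (.n (.n (.n
  (.n (.n .l 73786976294838992897 839950003590704985538560000 .l) 73786976294838996994
  29612951979755227470574387200000 (.n .l 73786976294839001088 5725266280771831365121553203200000 .l))
  73786976294839255040 28029169077295356617687040000000 (.n (.n .l 73786976294854983681 1673329309876224000 .l)
  73786976294854987778 32695319550476943360000 .l)) 73786976294854991872 4760641905142995615744000 (.n (.n (.n
  .l 73786976294854995969 150750595738350099219087360000 .l) 73786976294855000066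
  6022305675320357386036917043200000 .l) 73786976294855245824 30435925839372877824000 (.n (.n .l
  73786976294855249921 838417947405444603445248000 .l) 73786976294855254018 29578913303116892169868148736000
  .l))) 73786976294855258112 5719641639968274716653529333760000 (.n (.n (.n (.n .l 73786976294855507970
  154446985936435109198561280000 .l) 73786976294855512064 27993428100452290590607933440000 .l)
  73786976294855770113 5938378828470219601791575654400000 (.n (.n .l 73786976294871760897
  4989022801881316982784000 .l) 73786976294871764994 154239545253390871796121600000 .l)) 73786976294871769088
  27960729803392043782691094528000 (.n (.n (.n .l 73786976294872023040 145379027705649475281223680000 .l)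
  73786976294872027137 5931247386548036921689878036480000 .l) 73786976294888538113
  29069849295895175465187409920000 (.n (.n .l 73786976295911948290 227572786143166464000 .l)
  73786976295911952384 30396994067539427328000 .l)))) 73786976295911956481 837199809845603006939136000 (.n (.n
  (.n (.n (.n .l 73786976295911960578 29544391495524475069569957888000 .l) 73786976295911964672
  5716112261035550155194645872640000 (.n .l 73786976295912210433 4990896930708378353664000 .l))
  73786976295912214530 154236841556053277792010240000 (.n (.n .l 73786976295912218624
  27971065137081219795740786688000 .l) 73786976295912472576 145449189999557287776092160000 .l))
  73786976295912476673 5932173348257611534147371663360000 (.n (.n (.n .l 73786976295928725506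
  858179390561360730390528000 .l) 73786976295928729600 145243213284754706581684224000 .l) 73786976295928733697
  5925292465301594724232656322560000 (.n (.n .l 73786976295928987649 29075629691862765682116526080000 .l)
  73786976295945502722 6046944842055862992377877626880000 .l))) 73786976296985690112 804593888450813777412096000
  (.n (.n (.n (.n .l 73786976296985694209 29041605369956734786401730560000 .l) 73786976296985952258
  6046770990989428205490127503360000 .l) 73786976297002467328 5728420238784603547513462456320000 (.n (.n .l
  73786976363557683200 210130332330254336000 .l) 73786976363557687297 4982323589610114908160000 .l))
  73786976363557691394 154041144589664194419228672000 (.n (.n (.n .l 73786976363557695488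
  27949264896646911398755958784000 .l) 73786976363557945346 858243128135323267104768000 .l) 73786976363557949440
  145300317886952211851771904000 (.n (.n .l 73786976363557953537 5926343661459747124357260902400000 .l)
  73786976363558207489 29082016537349443112549744640000 .l)))))))) 73786976363574460416
  804520797426558383947776000 (.n (.n (.n (.n (.n (.n (.n (.n (.n .l 73786976363574464513
  29042220064954907371933532160000 .l) 73786976363574722562 6047147274109878377133920747520000 (.n .l
  73786976363591237632 5728187751519847368691789332480000 .l)) 73786976364631425025
  151262104985950024693186560000 (.n (.n .l 73786976364631429122 6040780867128275178038891642880000 .l)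
  73786976364631687168 5730096155792056042805998387200000 .l)) 73786976432277159938
  29648146572300597834515742720000 (.n (.n (.n .l 73786976432277164032 5725484063688109876914904104960000 .l)
  73786980692884717569 31936395626045374464000 .l) 73786980692884721666 856932119754871677124608000 (.n (.n .l
  73786980692884725760 145160648826661313125023744000 .l) 73786980692884729857
  5920513049094746003945753149440000 .l))) 73786980692884979712 804891840546631635173376000 (.n (.n (.n (.n .l
  73786980692884983809 29047375479329814694519111680000 .l) 73786980692885241858
  6047101315074648216300001689600000 (.n .l 73786980692901494785 151258888980882787380756480000 .l))
  73786980692901498882 6040909869798071231154487296000000 (.n (.n .l 73786980692901756928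
  5729722708734570386007816929280000 .l) 73786980693958459394 29646935200557060565374074880000 .l))
  73786980693958463488 5725342729411841226791096156160000 (.n (.n (.n .l 73786980761604194304
  28001230967461043026652037120000 .l) 73786985090931228673 5936195124685633947839842222080000 .l)
  73787257769814917122 5109823300167259914240000 (.n (.n .l 73787257769814921216 803973398046979695575040000 .l)
  73787257769814925313 29014436905776577765095505920000 .l)))) 73787257769815179265
  151294657743983958200156160000 (.n (.n (.n (.n (.n .l 73787257769815183362 6040957996601045729553678336000000
  .l) 73787257769815441408 5731322466799826504782090076160000 (.n .l 73787257769831694338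
  29648029915724668476126658560000 .l)) 73787257769831698432 5725035452605031841519705784320000 (.n (.n .l
  73787257770888658944 28000863346534595674389872640000 .l) 73787257838534393857
  5936256503883115556965932072960000 .l)) 73804990693347688448 4769350866085060935680000 (.n (.n (.n .l
  73804990693347692545 151091825279267792738058240000 .l) 73804990693347696642
  6034811554595616027725015285760000 .l) 73804990693347950594 29648217729109278084311285760000 (.n (.n .l
  73804990693347954688 5726543351353617353698883665920000 .l) 73804990693364465664
  27998897063526277630383882240000 .l))) 73804990694421430273 5936092429492992883927296245760000 (.n (.n (.n (.n
  .l 74939897799445053441 839393146615273456926720000 .l) 74939897799445057538 29613879159222407481639567360000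
  .l) 74939897799445061632 5722139390820002678476174786560000 (.n (.n .l 74939897799445315584
  28008183398228258479920906240000 .l) 74939897799461830657 5936078579231169981901764034560000 .l))
  147573952589676412930 154448338977210316074516480000 (.n (.n (.n .l 147573952589676417024
  27982605510049268852431257600000 .l) 147573952589676675073 5937018699555379088173521960960000 .l)
  4722366482869645213698 133260807680000 (.n (.n .l 4722366482869645217792 13059559152640000 .l)
  4722366482869645221889 220500794992558080000 .l))))) 4722366482869645225986 5082843705099839078400000 (.n (.n
  (.n (.n (.n (.n .l 4722366482869645230080 802358321475324425011200000 .l) 4722366482869645234177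
  28933043707479367404748800000000 (.n .l 4722366482869645475841 1674821830922240000 .l)) 4722366482869645479938
  32697826985834250240000 (.n (.n .l 4722366482869645484032 4762999754070986588160000 .l) 4722366482869645488129
  150782472296948155023360000000 .l)) 4722366482869645492226 6022408111182811949432832000000000 (.n (.n (.n .l
  4722366482869645737984 30460128560655073280000 .l) 4722366482869645742081 838650364024507725250560000 .l)
  4722366482869645746178 29579235202713944089165824000000 (.n (.n .l 4722366482869645750272
  5720958446527567914137026560000000 .l) 4722366482869646000130 154441630937129147474903040000 .l)))
  4722366482869646004224 28002084401666799856150118400000 (.n (.n (.n (.n .l 4722366482869646262273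
  5939150360716217245657517260800000 .l) 4722366482869661990914 227626516900823040000 (.n .l
  4722366482869661995008 30389041915406254080000 .l)) 4722366482869661999105 837159803212990104207360000 (.n (.n
  .l 4722366482869662003202 29544554451225436628189184000000 .l) 4722366482869662007296
  5715762126763515136966656000000000 .l)) 4722366482869662253057 4991050385752245534720000 (.n (.n (.n .l
  4722366482869662257154 154243611631518006368010240000 .l) 4722366482869662261248
  27968934130212202920227635200000 .l) 4722366482869662515200 145439566141704218235371520000 (.n (.n .l
  4722366482869662519297 5932166093781261415438771814400000 .l) 4722366482869678768130
  858257907962293376778240000 .l)))) 4722366482869678772224 145227130556546486863134720000 (.n (.n (.n (.n (.n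
  .l 4722366482869678776321 5925180600388760007634373836800000 .l) 4722366482869679030273
  29075911188350952873236889600000 (.n .l 4722366482869695545346 6047183337931420456828325068800000 .l))
  4722366482870718955520 210113914598748160000 (.n (.n .l 4722366482870718959617 4981945325076212613120000 .l)
  4722366482870718963714 154033684910444014039203840000 .l)) 4722366482870718967808
  27949116008095027929966182400000 (.n (.n (.n .l 4722366482870719217666 858190379146070592061440000 .l)
  4722366482870719221760 145297042267394431537643520000 .l) 4722366482870719225857
  5926196148277708924312249958400000 (.n (.n .l 4722366482870719479809 29080894277164802546073600000000 .l)
  4722366482870735732736 804491236053233919590400000 .l))) 4722366482870735736833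
  29041177044381357726026956800000 (.n (.n (.n (.n .l 4722366482870735994882 6046968212694329402621480140800000
  .l) 4722366482870752509952 5728080481087545756858345062400000 .l) 4722366482871792697345
  151254617617765962665164800000 (.n (.n .l 4722366482871792701442 6040601848553454255164778086400000 .l)
  4722366482871792959488 5729988399059843529910832332800000 .l)) 4722366482938364690433 31938956792160337920000
  (.n (.n (.n .l 4722366482938364694530 856943061056514801008640000 .l) 4722366482938364698624
  145162732837284394429317120000 .l) 4722366482938364702721 5920555204371148816059570585600000 (.n (.n .l
  4722366482938364952576 804927963233517079756800000 .l) 4722366482938364956673 29047775173684356156280012800000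
  .l)))))) 4722366482938365214722 6047083565873837988402482380800000 (.n (.n (.n (.n (.n (.n (.n .l
  4722366482938381467649 151263030693830617084723200000 .l) 4722366482938381471746
  6040933156920267730178172518400000 (.n .l 4722366482938381729792 5729822814150428023874440396800000 .l))
  4722366482939438432258 29647023965247379679635046400000 (.n (.n .l 4722366482939438436352
  5725408406490296545319269171200000 .l) 4722366483007084167168 28001853565634688566309683200000 .l))
  4722366487267691724802 5109976970134157721600000 (.n (.n (.n .l 4722366487267691728896
  803954342971084367462400000 .l) 4722366487267691732993 29014300122295002423990681600000 .l)
  4722366487267691986945 151295583451864550591692800000 (.n (.n .l 4722366487267691991042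
  6040979502233462780972551372800000 .l) 4722366487267692249088 5731310698984881100908763545600000 .l)))
  4722366487267708502018 29648311743985239584459980800000 (.n (.n (.n (.n .l 4722366487267708506112
  5724989805809292820882233753600000 .l) 4722366487268765466624 28000611096669253056017203200000 (.n .l
  4722366487336411201537 5936266087710986775556679270400000 .l)) 4722366764344621924352
  4769330132835558850560000 (.n (.n .l 4722366764344621928449 151091184373059184282828800000 .l)
  4722366764344621932546 6034796394878812476633042124800000 .l)) 4722366764344622186498
  29648118611570842420169932800000 (.n (.n (.n .l 4722366764344622190592 5726538543330971347729357209600000 .l)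
  4722366764344638701568 27998848493981860041798451200000 .l) 4722366764345695666177
  5936077222962170617087288934400000 (.n (.n .l 4722384497268154695681 839404176704008566210560000 .l)
  4722384497268154699778 29613967576413708117658828800000 .l)))) 4722384497268154703872
  5722140170161952346357733785600000 (.n (.n (.n (.n (.n .l 4722384497268154957824
  28008328377714592756347699200000 .l) 4722384497268171472897 5936102013492974465443587686400000 (.n .l
  4723519404374252060674 154449265504664065254359040000 .l)) 4723519404374252064768
  27982512857303893934447001600000 (.n (.n .l 4723519404374252322817 5937028283555360669689813401600000 .l)
  4796153459164483420160 145364213296429421840465920000 .l)) 4796153459164483424257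
  5930850312935174107079639040000000 (.n (.n (.n .l 9444732965739290427393 29072842659285884368093184000000 .l)
  302231454903657293676544 119934726912000 .l) 302231454903657293680641 1669491398615040000 (.n (.n .l
  302231454903657293684738 32629000443883683840000 .l) 302231454903657293688832 4758097462086700892160000 .l)))
  302231454903657293692929 150603528609780297891840000000 (.n (.n (.n (.n .l 302231454903657293697026
  6016356469715553399236198400000000 .l) 302231454903657293938690 227626516900823040000 .l)
  302231454903657293942784 30410534218468884480000 (.n (.n .l 302231454903657293946881
  837392435901340015656960000 .l) 302231454903657293950978 29545244116878721252589568000000 .l))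
  302231454903657293955072 5716988268361593894721290240000000 (.n (.n (.n .l 302231454903657294200833
  4992683800785005445120000 .l) 302231454903657294204930 154243633295759493499453440000 .l)
  302231454903657294209024 27977094645581230908427468800000 (.n (.n .l 302231454903657294462976
  145495912426674304104529920000 .l) 302231454903657294467073 5933005369327267108533515059200000 .l)))))
  302231454903657310453760 210039288546447360000 (.n (.n (.n (.n (.n (.n .l 302231454903657310457857
  4981708909742523678720000 .l) 302231454903657310461954 154036470312920930939043840000 (.n .l
  302231454903657310466048 27946949361114116632294195200000 .l)) 302231454903657310715906
  858257907962293376778240000 (.n (.n .l 302231454903657310720000 145283302839830977676574720000 .l)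
  302231454903657310724097 5926110641224939402348304793600000 .l)) 302231454903657310978049
  29081190949694865267071385600000 (.n (.n (.n .l 302231454903657327230976 804376982970152976384000000 .l)
  302231454903657327235073 29040685043267401688914329600000 .l) 302231454903657327493122
  6047183337931420456828325068800000 (.n (.n .l 302231454903657344008192 5727716234748413327710774886400000 .l)
  302231454903658367418369 31934031472708485120000 .l))) 302231454903658367422466 856879465331752477655040000
  (.n (.n (.n (.n .l 302231454903658367426560 145161777719336291134341120000 .l) 302231454903658367430657
  5920433980090038222124901990400000 .l) 302231454903658367680512 804886866368010819993600000 (.n (.n .l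
  302231454903658367684609 29046668384897416727573299200000 .l) 302231454903658367942658
  6046922413274628083471194521600000 .l)) 302231454903658384195585 151253567933684383796428800000 (.n (.n (.n .l
  302231454903658384199682 6040731025418607344694067200000000 .l) 302231454903658384457728
  5729691156633683016923322777600000 .l) 302231454903659441160194 29645812680882949741923532800000 (.n (.n .l
  302231454903659441164288 5725342774022847297092163993600000 .l) 302231454903726013153282
  5109976970134157721600000 .l)))) 302231454903726013157376 803978930165788016640000000 (.n (.n (.n (.n (.n .l
  302231454903726013161473 29014635885025875457159987200000 .l) 302231454903726013415425
  151297747124998471719321600000 (.n .l 302231454903726013419522 6040979628513294778914727526400000 .l))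
  302231454903726013677568 5731386842969810053232276275200000 (.n (.n .l 302231454903726029930498
  29648311743985239584459980800000 .l) 302231454903726029934592 5725065524140707063631183872000000 .l))
  302231454903727086895104 28001141589982178990673100800000 (.n (.n (.n .l 302231454903794732630017
  5936318910446692980191448268800000 .l) 302231454908055340187648 4769147192398775746560000 .l)
  302231454908055340191745 151090139417284279192780800000 (.n (.n .l 302231454908055340195842
  6034794837034156053421149388800000 .l) 302231454908055340449794 29648311743985239584459980800000 .l)))
  302231454908055340453888 5726502945498735510377044377600000 (.n (.n (.n (.n .l 302231454908055356964864
  27998504027384061916820275200000 .l) 302231454908056413929473 5936068671044108793830336102400000 .l)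
  302231455185132270387201 839389663429357106626560000 (.n (.n .l 302231455185132270391298
  29613780181011408471510220800000 .l) 302231455185132270395392 5722145347569498409443891609600000 .l))
  302231455185132270649344 28008187773109769415897907200000 (.n (.n (.n .l 302231455185132287164417
  5936068671044108793830336102400000 .l) 302231472918055803158530 154449265504664065254359040000 .l)
  302231472918055803162624 27982565801729822459009433600000 (.n (.n .l 302231472918055803420673
  5937033577997953522146056601600000 .l) 302232607825161900523520 145363248163665099778129920000 .l)))))))
  302232607825161900527617 5930841788882599614625087488000000 (.n (.n (.n (.n (.n (.n (.n (.n .l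
  302305241879952131883009 29072753867071566738358272000000 .l) 306953821386526938890242
  6047142393910032185589891072000000 (.n .l 604462909807314587353088 5728865432678486870551363584000000 .l))
  19342813113834066795298817 13912428321792000 (.n (.n .l 19342813113834066795302914 227050830211645440000 .l)
  19342813113834066795307008 30371387523604807680000 .l)) 19342813113834066795311105 836215492822998303375360000
  (.n (.n (.n .l 19342813113834066795315202 29511512415385690124058624000000 .l) 19342813113834066795319296
  5713314612176398103189913600000000 .l) 19342813113834066795560960 210263166703349760000 (.n (.n .l
  19342813113834066795565057 4983578740108972523520000 .l) 19342813113834066795569154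
  154041205497131689668771840000 .l))) 19342813113834066795573248 27954462520061853816795955200000 (.n (.n (.n
  (.n .l 19342813113834066795823106 858231730337163092951040000 .l) 19342813113834066795827200
  145338438850231000702648320000 (.n .l 19342813113834066795831297 5926992090380660684514498969600000 .l))
  19342813113834066796085249 29085954704913623335147929600000 (.n (.n .l 19342813113834066812076033
  31934031472708485120000 .l) 19342813113834066812080130 856921246368906231152640000 .l))
  19342813113834066812084224 145147070794258169903185920000 (.n (.n (.n .l 19342813113834066812088321
  5920301032161318384035482828800000 .l) 19342813113834066812338176 804803304293703312998400000 .l)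
  19342813113834066812342273 29046456805725270119861452800000 (.n (.n .l 19342813113834066812600322
  6047114100662109937757847552000000 .l) 19342813113834066828853249 151253567933684383796428800000 .l))))
  19342813113834066828857346 6040878055896586078322373427200000 (.n (.n (.n (.n (.n .l
  19342813113834066829115392 5729397095677725549666710323200000 .l) 19342813113834067869040642
  5109445035633357619200000 (.n .l 19342813113834067869044736 803968291475772014592000000 .l))
  19342813113834067869048833 29013809029015927752386150400000 (.n (.n .l 19342813113834067869302785
  151289334048933817299763200000 .l) 19342813113834067869306882 6040795327660364061170309529600000 .l))
  19342813113834067869564928 5731258438270836722964942028800000 (.n (.n (.n .l 19342813113834067885817858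
  29646986895151118830220083200000 .l) 19342813113834067885821952 5725003597568722909578815078400000 .l)
  19342813113834068942782464 28000614540767834236413542400000 (.n (.n .l 19342813113834135514775552
  4769476485184985333760000 .l) 19342813113834135514779649 151093348046193105410457600000 .l)))
  19342813113834135514783746 6034812745166592845706952704000000 (.n (.n (.n (.n .l 19342813113834135515037698
  29648197782337788170521804800000 .l) 19342813113834135515041792 5726582306177173151715164160000000 .l)
  19342813113834135531552768 27999219662273106329783500800000 (.n (.n .l 19342813113834136588517377
  5936130045697876821722057932800000 .l) 19342813113838464841809921 839389663429357106626560000 .l))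
  19342813113838464841814018 29613859843522248294845644800000 (.n (.n (.n .l 19342813113838464841818112
  5722113482565162480109722009600000 .l) 19342813113838464842072064 28008028448088089769227059200000 .l)
  19342813113838464858587137 5936068671044108793830336102400000 (.n (.n .l 19342813114115541772009474
  154447698071001707619287040000 .l) 19342813114115541772013568 27982609689872368472791449600000 .l)))))
  19342813114115541772271617 5937008787467149673789757849600000 (.n (.n (.n (.n (.n (.n .l
  19342813131848465304780800 145364489048647799572561920000 .l) 19342813131848465304784897
  5930855607377766959535882240000000 (.n .l 19342814266755571402145793 29072753867071566738358272000000 .l))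
  19342886900810361633505282 6047132804350885881578520576000000 (.n (.n .l 19347535480316936440512512
  5728874311899918633524854784000000 .l) 1237940039285380274899124226 1725141111902208000 .l))
  1237940039285380274899128320 209892168614768640000 (.n (.n (.n .l 1237940039285380274899132417
  4975030944148063518720000 .l) 1237940039285380274899136514 153839033027064269887242240000 .l)
  1237940039285380274899140608 27933878470034837311429017600000 (.n (.n .l 1237940039285380274899386369
  31949613392428892160000 .l) 1237940039285380274899390466 856947423994036514979840000 .l)))
  1237940039285380274899394560 145197212165364862125342720000 (.n (.n (.n (.n .l 1237940039285380274899398657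
  5921173833793648529686659072000000 .l) 1237940039285380274899648512 805202575404619022991360000 .l)
  1237940039285380274899652609 29051739570145704848916480000000 (.n (.n .l 1237940039285380274899910658
  6047004507301528500867327590400000 .l) 1237940039285380274915901442 5110005984743292272640000 .l))
  1237940039285380274915905536 803858345450224822517760000 (.n (.n (.n .l 1237940039285380274915909633
  29013116503682766826635264000000 .l) 1237940039285380274916163585 151290936119591790669987840000 .l)
  1237940039285380274916167682 6040947725237528816742354124800000 (.n (.n .l 1237940039285380274916425728
  5731006863275502084052903526400000 .l) 1237940039285380274932678658 29648389824387472518996295680000 .l))))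
  1237940039285380274932682752 5724640047617348409348430233600000 (.n (.n (.n (.n (.n .l
  1237940039285380275972866048 4769256112320368148480000 .l) 1237940039285380275972870145
  151086535880202058979082240000 (.n .l 1237940039285380275972874242 6034634041319968594627185868800000 .l))
  1237940039285380275973128194 29647101615975489786064404480000 (.n (.n .l 1237940039285380275973132288
  5726496058232103902984011776000000 .l) 1237940039285380275989643264 27998575468315257373773004800000 .l))
  1237940039285380277046607873 5935950844266954094207303680000000 (.n (.n (.n .l 1237940039285380343618600961
  839416402003597325107200000 .l) 1237940039285380343618605058 29613974070711402508194938880000 .l)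
  1237940039285380343618609152 5722168568306269208614797312000000 (.n (.n .l 1237940039285380343618863104
  28008626322608101054454169600000 .l) 1237940039285380343635378177 5936139710088150206289700454400000 .l)))
  1237940039285384672945635330 154449302385456120728125440000 (.n (.n (.n (.n .l 1237940039285384672945639424
  27982333747786209418071244800000 .l) 1237940039285384672945897473 5937018451857423058357400371200000 .l)
  1237940039285661749875834880 145364110252179396477419520000 (.n (.n .l 1237940039285661749875838977
  5930840479762004813528275353600000 .l) 1237940039303394673408606209 29072869021197961279281561600000 .l))
  1237940040438301779505971202 6047142477297503023016076902400000 (.n (.n (.n .l 1237940113072356569737330688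
  5728873281910232549019929804800000 .l) 79228162514264337593543950336 1581379352577024000 .l)
  79228162514264337593543954433 31880607747952803840000 (.n (.n .l 79228162514264337593543958530
  855639076974769880432640000 .l) 79228162514264337593543962624 145072140814864841567109120000 .l))))))
  79228162514264337593543966721 5915580040960922491579426406400000 (.n (.n (.n (.n (.n (.n (.n .l
  79228162514264337593544212482 5110005984743292272640000 .l) 79228162514264337593544216576
  804229319794928273326080000 (.n .l 79228162514264337593544220673 29018503051167860932372070400000 .l))
  79228162514264337593544474625 151323581861925694341120000000 (.n (.n .l 79228162514264337593544478722
  6040948348474427918539712102400000 .l) 79228162514264337593544736768 5732545486789646540349426892800000 .l))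
  79228162514264337593560727552 4768428044586655088640000 (.n (.n (.n .l 79228162514264337593560731649
  151083475341858255509913600000 .l) 79228162514264337593560735746 6034718578953639616997385830400000 .l)
  79228162514264337593560989698 29648389824387472518996295680000 (.n (.n .l 79228162514264337593560993792
  5726174812998307949756547072000000 .l) 79228162514264337593577504768 27996415284706049179716157440000 .l)))
  79228162514264337594617692161 839352640788101419499520000 (.n (.n (.n (.n .l 79228162514264337594617696258
  29612765158065600137873326080000 .l) 79228162514264337594617700352 5722124251711050934381235404800000 (.n .l
  79228162514264337594617954304 28007861698111874154406871040000 .l)) 79228162514264337594634469377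
  5935937255476707606804194918400000 (.n (.n .l 79228162514264337662263427074 154449302385456120728125440000 .l)
  79228162514264337662263431168 27982811191767842759261552640000 .l)) 79228162514264337662263689217
  5937066196255586392476431155200000 (.n (.n (.n .l 79228162514264341991590461440 145362038012675779545169920000
  .l) 79228162514264341991590465537 5930826952182525202194549964800000 .l) 79228162514264619068520660993
  29072681138149633344090931200000 (.n (.n .l 79228162514282351992053432322 6047142477297503023016076902400000
  .l) 79228162515417259098150797312 5728862175934486942184216985600000 .l)))) 5070602400912917605986812821505
  221393109360783360000 (.n (.n (.n (.n (.n .l 5070602400912917605986812825602 5100897239672448614400000 .l)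
  5070602400912917605986812829696 803391315248410656768000000 (.n .l 5070602400912917605986812833793
  28986725918763912912489676800000 .l)) 5070602400912917605986813083648 4771464292943602974720000 (.n (.n .l
  5070602400912917605986813087745 151119181622535962650214400000 .l) 5070602400912917605986813091842
  6034814067749966285235447398400000 .l)) 5070602400912917605986813345794 29647975631531611116168806400000 (.n
  (.n (.n .l 5070602400912917605986813349888 5727676884410268775044926668800000 .l)
  5070602400912917605986829598721 839352640788101419499520000 .l) 5070602400912917605986829602818
  29613646593108615536993894400000 (.n (.n .l 5070602400912917605986829606912 5721771677693844774733008076800000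
  .l) 5070602400912917605986829860864 28006098828025843356165734400000 .l))) 5070602400912917605986846375937
  5935937255476707606804194918400000 (.n (.n (.n (.n .l 5070602400912917605987886563330
  154440885905010661187911680000 .l) 5070602400912917605987886567424 27982440866628242539492147200000 .l)
  5070602400912917605987886825473 5936877330434390280394034380800000 (.n (.n .l 5070602400912917606055532298240
  145366596939583736796119040000 .l) 5070602400912917606055532302337 5930888224160168147647306137600000 .l))
  5070602400912917610384859332609 29072681138149633344090931200000 (.n (.n (.n .l
  5070602400912917887461789532162 6047117676735123735570913689600000 .l) 5070602400912935620385322303488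
  5728879628182087181497479987200000 .l) 324518553658426726783156020576258 32766180185395937280000 (.n (.n .l
  324518553658426726783156020580352 4765138775533294878720000 .l) 324518553658426726783156020584449
  150923647228348518786662400000 .l))))) 324518553658426726783156020588546 6028675852047634047470823014400000
  (.n (.n (.n (.n (.n (.n .l 324518553658426726783156020838401 839600601070585496862720000 .l)
  324518553658426726783156020842498 29614063166383188786964070400000 (.n .l 324518553658426726783156020846592
  5723183742073712499774770380800000 .l)) 324518553658426726783156021100544 28015356673132668868598169600000 (.n
  (.n .l 324518553658426726783156037353474 154449812475180087972986880000 .l) 324518553658426726783156037357568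
  27980262783506902403933798400000 .l)) 324518553658426726783156037615617 5936902824718794163292209152000000 (.n
  (.n (.n .l 324518553658426726783157094318080 145362505594922749519626240000 .l)
  324518553658426726783157094322177 5930724832219786959773289676800000 .l) 324518553658426726783224740052993
  29073106637994376020846182400000 (.n (.n .l 324518553658426726787554067087362
  6047143206725808296176228761600000 .l) 324518553658426727064630997286912 5728871590962797597603214131200000
  .l))) 20769187434139310514121985316880384 30425738743581941760000 (.n (.n (.n (.n .l
  20769187434139310514121985316884481 838289953863169659371520000 .l) 20769187434139310514121985316888578
  29579776635437190478194278400000 .l) 20769187434139310514121985316892672 5719064325474916225906429132800000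
  (.n (.n .l 20769187434139310514121985317142530 154449812475180087972986880000 .l)
  20769187434139310514121985317146624 27989070332740736831874662400000 .l)) 20769187434139310514121985317404673
  5937783579642177606086295552000000 (.n (.n (.n .l 20769187434139310514121985333657600
  145348743799244883225968640000 .l) 20769187434139310514121985333661697 5930666702394843652548879974400000 .l)
  20769187434139310514121986390622209 29071895599974723787004313600000 (.n (.n .l
  20769187434139310514122054036357122 6047143206725808296176228761600000 .l) 20769187434139310514126383363391488
  5728836605420007644181115699200000 .l)))) 1329227995784915872903807060280344577 4989821153947438448640000 (.n
  (.n (.n (.n (.n .l 1329227995784915872903807060280348674 154245351510823217324359680000 .l)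
  1329227995784915872903807060280352768 27965352860875339836633907200000 (.n .l
  1329227995784915872903807060280606720 145408378247182303831818240000 .l))
  1329227995784915872903807060280610817 5931605587143170402567376076800000 (.n (.n .l
  1329227995784915872903807060297121793 29071895599974723787004313600000 .l)
  1329227995784915872903807061354086402 6046954284794742547696897228800000 .l))
  1329227995784915872903807128999821312 5728927567831261523078571622400000 (.n (.n (.n .l
  85070591730234615865843651857942052866 858249238478959413166080000 .l) 85070591730234615865843651857942056960
  145258683612563880678359040000 .l) 85070591730234615865843651857942061057 5925627382215049055510829465600000
  (.n (.n .l 85070591730234615865843651857942315009 29077484199667144918066790400000 .l)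
  85070591730234615865843651857958830082 6047155474383669708415146393600000 .l)))
  85070591730234615865843651859015794688 5728825110170233802342426214400000 (.n (.n (.n (.n .l
  5444517870735015415413993718908291383296 804608661074024449843200000 .l)
  5444517870735015415413993718908291387393 29043154230127986541540147200000 .l)
  5444517870735015415413993718908291645442 6047155474383669708415146393600000 (.n (.n .l
  5444517870735015415413993718908308160512 5728504697121201657494844211200000 .l)
  348449143727040986586495598010130648530945 151266428281916596570521600000 .l))
  348449143727040986586495598010130648535042 6040976079866621200640350617600000 (.n (.n (.n .l
  348449143727040986586495598010130648793088 5730106762366362381732754227200000 .l)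
  22300745198530623141535718272648361505980418 29648219943255652927822233600000 .l)
  22300745198530623141535718272648361505984512 5725400695708702754283893555200000 (.n (.n .l
  1427247692705959881058285969449495136382746624 28001096613074783320720998400000 .l)
  91343852333181432387730302044767688728495783937 5936232481971854063992851660800000 .l))))))))))

set_option maxRecDepth 100000 in
theorem tab_ck : tab.all (ck tab) = true := by decide +kernel

end WittenAsym

set_option autoImplicit false
namespace WittenAsym
open Alg
variable {C : List ℕ → ℚ}

/-- code of a multiset -/
def cd (s : Multiset ℕ) : ℕ := (s.map fun x => 64 ^ x).sum

theorem cd_coe (l : List ℕ) : cd (l : Multiset ℕ) = cdl l := by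
  induction l with
  | nil => simp [cd, cdl]
  | cons x l ih => rw [← Multiset.cons_coe, cd, Multiset.map_cons, Multiset.sum_cons, ← cd, ih, cdl]

theorem wt_coe (l : List ℕ) : wt (l : Multiset ℕ) = wtl l := by
  induction l with
  | nil => simp [wt, wtl]
  | cons x l ih => rw [← Multiset.cons_coe, wt_cons, ih, wtl]

theorem wt_zero : wt 0 = 0 := by simp [wt]
theorem wt_add (s t : Multiset ℕ) : wt (s + t) = wt s + wt t := by simp [wt]; ring
theorem card_le_wt (s : Multiset ℕ) : Multiset.card s ≤ wt s := by unfold wt; omega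
theorem mem_le_wt {s : Multiset ℕ} {x} (h : x ∈ s) : 2 * x + 1 ≤ wt s := by
  obtain ⟨t, rfl⟩ := Multiset.exists_cons_of_mem h
  rw [wt_cons]; omega

theorem dig_inj (M : ℕ) : ∀ f g : ℕ → ℕ, (∀ i, f i < 64) → (∀ i, g i < 64) →
    ∑ i ∈ Finset.range M, f i * 64 ^ i = ∑ i ∈ Finset.range M, g i * 64 ^ i → ∀ i < M, f i = g i := by
  induction M with
  | zero => intro f g _ _ _ i hi; omega
  | succ M ih =>
    intro f g hf hg h i hi
    rw [Finset.sum_range_succ', Finset.sum_range_succ'] at h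
    have e : ∀ f : ℕ → ℕ, ∑ k ∈ Finset.range M, f (k+1) * 64 ^ (k+1) = 64 * ∑ k ∈ Finset.range M, f (k+1) * 64 ^ k := by
      intro f; rw [Finset.mul_sum]; apply Finset.sum_congr rfl; intro k _; rw [pow_succ]; ring
    rw [e f, e g] at h
    have h0 := hf 0
    have h1 := hg 0
    rcases i with _ | i
    · omega
    · exact ih (fun k => f (k+1)) (fun k => g (k+1)) (fun k => hf _) (fun k => hg _) (by omega) i (by omega)

theorem cd_eq (s : Multiset ℕ) (hs : wt s ≤ 63) : cd s = ∑ i ∈ Finset.range 64, s.count i * 64 ^ i := by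
  unfold cd
  rw [Finset.sum_multiset_map_count]
  simp only [smul_eq_mul]
  apply Finset.sum_subset
  · intro x hx
    rw [Multiset.mem_toFinset] at hx
    have := mem_le_wt hx
    rw [Finset.mem_range]; omega
  · intro x _ hx
    rw [Multiset.mem_toFinset] at hx
    rw [Multiset.count_eq_zero_of_notMem hx, zero_mul]

theorem cd_inj {s t : Multiset ℕ} (hs : wt s ≤ 63) (ht : wt t ≤ 63) (h : cd s = cd t) : s = t := by
  rw [cd_eq s hs, cd_eq t ht] at h
  have c1 : ∀ {s : Multiset ℕ}, wt s ≤ 63 → ∀ i, s.count i < 64 := by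
    intro s hs i
    have := Multiset.count_le_card i s
    have := card_le_wt s
    omega
  have key := dig_inj 64 _ _ (c1 hs) (c1 ht) h
  ext i
  by_cases hi : i < 64
  · exact key i hi
  · rw [Multiset.count_eq_zero_of_notMem, Multiset.count_eq_zero_of_notMem]
    · intro hm; have := mem_le_wt hm; omega
    · intro hm; have := mem_le_wt hm; omega

theorem find_all {f : ℕ → ℕ → Bool} {c v : ℕ} : ∀ {t : Tr}, t.all f = true → t.find c = some v → f c v = true
  | .l, _, h => by simp [Tr.find] at h
  | .n a k v' b, ha, h => by
    simp only [Tr.all, Bool.and_eq_true] at ha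
    simp only [Tr.find] at h
    cases h1 : Nat.beq c k with
    | true =>
      rw [h1] at h
      have := Nat.eq_of_beq_eq_true h1
      simp only [cond_true, Option.some.injEq] at h
      subst h; subst this; exact ha.2.1
    | false =>
      rw [h1] at h
      cases h2 : Nat.ble c k with
      | true => rw [h2] at h; exact find_all ha.1 h
      | false => rw [h2] at h; exact find_all ha.2.2 h

theorem oadd_some {a b : Option ℕ} {v} (h : oadd a b = some v) : ∃ x y, a = some x ∧ b = some y ∧ v = x + y := by
  cases a <;> cases b <;> simp [oadd] at h ⊢; exact h.symm
theorem omul_some {a b : Option ℕ} {v} (h : omul a b = some v) : ∃ x y, a = some x ∧ b = some y ∧ v = x * y := by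
  cases a <;> cases b <;> simp [omul] at h ⊢; exact h.symm

theorem N_zero : Nf C 0 = 0 := by simp [Nf]

theorem Lp0_app (φ : Alg) (s : Multiset ℕ) : Lp 0 φ s = 4 * (wt s : ℚ) * φ s := by
  rw [Lp, S_app]
  have : ∀ j ∈ s, 4 * (2 * (j:ℚ) + 1) * sh (j + 0) φ (s.erase j) = (4 * (2 * (j:ℚ) + 1)) * φ s := by
    intro j hj; rw [sh_app, add_zero, Multiset.cons_erase hj]
  rw [Multiset.map_congr rfl this, Multiset.sum_map_mul_right, Multiset.sum_map_mul_left]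
  congr 2
  induction s using Multiset.induction_on with
  | empty => simp [wt]
  | cons a s ih => rw [Multiset.map_cons, Multiset.sum_cons, ih (by
      intro j hj; rw [sh_app, add_zero, Multiset.cons_erase hj]), wt_cons]; push_cast; ring

theorem N_one (hC : IsNormalizedWitten C) (s : Multiset ℕ) :
    Nf C (1 ::ₘ s) = 4 * (wt s : ℚ) * Nf C s + if s = 0 then 4 else 0 := by
  show sh 1 (Nf C) s = _
  rw [N_dil hC, add_app, Lp0_app, four_app]

theorem IG_iff {s : Multiset ℕ} (h0 : wt s % 3 = 0) (h1 : Multiset.card s ≤ wt s / 3 + 2) : IG s := by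
  unfold wt at *
  exact ⟨(s.sum + 3 - Multiset.card s) / 3, by omega⟩

theorem IG_iff' {s : Multiset ℕ} : IG s ↔ wt s % 3 = 0 ∧ Multiset.card s ≤ wt s / 3 + 2 := by
  constructor
  · rintro ⟨g, hg⟩
    unfold wt; omega
  · rintro ⟨a, b⟩; exact IG_iff a b

section
variable {t : Tr} {W : ℕ} 
  
theorem base_sound (hC : IsNormalizedWitten C) (IH : ∀ s v, wt s < W → t.find (cd s) = some v → Nf C s = v)
    (s : Multiset ℕ) (v : ℕ) (hW : wt s < W) (h : base t (cd s) (wt s) (Multiset.card s) = some v) : Nf C s = v := by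
  unfold base at h
  cases h1 : Nat.beq (Multiset.card s) 0 with
  | true =>
    rw [h1] at h
    have := Nat.eq_of_beq_eq_true h1
    rw [Multiset.card_eq_zero] at this
    simp only [cond_true, Option.some.injEq] at h
    rw [this, N_zero, ← h]; simp
  | false =>
    rw [h1] at h
    cases h2 : Nat.beq (wt s % 3) 0 with
    | true =>
      rw [h2] at h
      cases h3 : Nat.ble (Multiset.card s) (wt s / 3 + 2) with
      | true => rw [h3] at h; exact IH s v hW h
      | false =>
        rw [h3] at h
        simp only [cond_true, cond_false, Option.some.injEq] at h
        rw [N_vanish hC, ← h]; · simp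
        rw [IG_iff']
        intro hh
        have := Nat.ble_eq_true_of_le hh.2
        rw [h3] at this; exact absurd this (by simp)
    | false =>
      rw [h2] at h
      simp only [cond_false, Option.some.injEq] at h
      rw [N_vanish hC, ← h]; · simp
      rw [IG_iff']
      intro hh
      rw [hh.1] at h2; exact absurd h2 (by decide)

theorem dil_sound (hC : IsNormalizedWitten C) (s : Multiset ℕ) (o : Option ℕ) (ho : ∀ v, o = some v → Nf C s = v) :
    ∀ r v, dil o (wt s) (Multiset.card s) r = some v → Nf C (Multiset.replicate r 1 + s) = v := by
  intro r
  induction r with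
  | zero => intro v h; simpa using ho v h
  | succ r ih =>
    intro v h
    simp only [dil] at h
    obtain ⟨x, y, hx, hy, rfl⟩ := oadd_some h
    obtain ⟨x1, x2, hx1, hx2, rfl⟩ := omul_some hx
    have := ih x2 hx2
    rw [Multiset.replicate_succ, Multiset.cons_add, N_one hC, this, wt_add]
    simp only [Option.some.injEq] at hx1 hy
    rw [← hx1, ← hy]
    have e : wt (Multiset.replicate r 1) = 3 * r := by simp [wt]; ring
    rw [e]
    have e2 : (Multiset.replicate r 1 + s = 0) ↔ (Multiset.card s + r = 0) := by
      rw [← Multiset.card_eq_zero]; simp; tauto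
    by_cases hz : Multiset.card s + r = 0
    · rw [if_pos (e2.2 hz), hz]; push_cast; simp; try ring_nf
      try tauto
    · rw [if_neg (fun hh => hz (e2.1 hh))]
      have : Nat.beq (Multiset.card s + r) 0 = false := by
        cases hb : Nat.beq (Multiset.card s + r) 0 with
        | true => exact absurd (Nat.eq_of_beq_eq_true hb) hz
        | false => rfl
      rw [this]; push_cast; simp; try ring_nf
      try tauto

theorem evg_sound (hC : IsNormalizedWitten C) (IH : ∀ s v, wt s < W → t.find (cd s) = some v → Nf C s = v)
    (l : List ℕ) : ∀ (r : ℕ) (s : Multiset ℕ) (v : ℕ), wt s + wtl l < W →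
    evg t l r (cd s) (wt s) (Multiset.card s) = some v → Nf C (Multiset.replicate r 1 + s + (l : Multiset ℕ)) = v := by
  induction l with
  | nil =>
    intro r s v hW h
    simp only [wtl] at hW
    simp only [evg] at h
    simpa using dil_sound hC s _ (fun v hv => base_sound hC IH s v (by omega) hv) r v h
  | cons x l ih =>
    intro r s v hW h
    simp only [wtl] at hW
    simp only [evg] at h
    cases hx : Nat.beq x 1 with
    | true =>
      rw [hx] at h
      have := Nat.eq_of_beq_eq_true hx
      subst this
      have := ih (r+1) s v (by omega) h
      rw [← this, Multiset.replicate_succ, ← Multiset.cons_coe]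
      congr 1
      simp only [Multiset.cons_add, Multiset.add_cons]
    | false =>
      rw [hx] at h
      simp only [cond_false] at h
      have e1 : cd s + 64 ^ x = cd (x ::ₘ s) := by simp [cd]; ring
      have e2 : wt s + (2 * x + 1) = wt (x ::ₘ s) := by rw [wt_cons]; ring
      have e3 : Multiset.card s + 1 = Multiset.card (x ::ₘ s) := by simp
      rw [e1, e2, e3] at h
      have := ih r (x ::ₘ s) v (by rw [← e2]; omega) h
      rw [← this, ← Multiset.cons_coe]
      congr 1
      simp only [Multiset.cons_add, Multiset.add_cons]

theorem evl_sound (hC : IsNormalizedWitten C) (IH : ∀ s v, wt s < W → t.find (cd s) = some v → Nf C s = v)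
    (l : List ℕ) (v : ℕ) (hW : wtl l < W) (h : evl t l = some v) : Nf C (l : Multiset ℕ) = v := by
  have := evg_sound hC IH l 0 0 v (by simpa [wt_zero] using hW) (by simpa [evl, cd, wt_zero] using h)
  simpa using this

theorem wtl_append (a b : List ℕ) : wtl (a ++ b) = wtl a + wtl b := by
  rw [← wt_coe, ← wt_coe, ← wt_coe, ← Multiset.coe_add, wt_add]

/-- sum over the entries of `f` with `pre` set aside -/
theorem S_split (φ : ℕ → Multiset ℕ → ℚ) (f pre : List ℕ) :
    (((pre ++ f : List ℕ) : Multiset ℕ).map fun j => φ j (((pre ++ f : List ℕ) : Multiset ℕ).erase j)).sum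
     = (((pre : List ℕ) : Multiset ℕ).map fun j => φ j (((pre ++ f : List ℕ) : Multiset ℕ).erase j)).sum
     + (((f : List ℕ) : Multiset ℕ).map fun j => φ j (((pre ++ f : List ℕ) : Multiset ℕ).erase j)).sum := by
  rw [← Multiset.sum_add, ← Multiset.map_add, Multiset.coe_add]

theorem strg_sound (hC : IsNormalizedWitten C) (IH : ∀ s v, wt s < W → t.find (cd s) = some v → Nf C s = v)
    (f : List ℕ) : ∀ (pre : List ℕ) (v : ℕ), wtl pre + wtl f ≤ W → strg t pre f = some v →
    ((f : Multiset ℕ).map fun j : ℕ => 4 * (2 * (j:ℚ) + 1) * dn (Nf C) j (((pre ++ f : List ℕ) : Multiset ℕ).erase j)).sum = v := by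
  induction f with
  | nil => intro pre v _ h; simp only [strg, Option.some.injEq] at h; rw [← h]; simp
  | cons x f ih =>
    intro pre v hW h
    simp only [strg] at h
    simp only [wtl] at hW
    obtain ⟨y, z, hy, hz, rfl⟩ := oadd_some h
    have h2 := ih (x :: pre) z (by simp only [wtl]; omega) hz
    have hp : ((pre ++ x :: f : List ℕ) : Multiset ℕ) = ((x :: pre ++ f : List ℕ) : Multiset ℕ) :=
      Multiset.coe_eq_coe.2 List.perm_middle
    rw [← Multiset.cons_coe, Multiset.map_cons, Multiset.sum_cons, hp, h2]
    push_cast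
    congr 1
    rw [List.cons_append, ← Multiset.cons_coe, Multiset.erase_cons_head]
    cases hx : Nat.beq x 0 with
    | true =>
      rw [hx] at hy
      have := Nat.eq_of_beq_eq_true hx
      subst this
      simp only [cond_true, Option.some.injEq] at hy
      rw [← hy]; simp [dn]
    | false =>
      rw [hx] at hy
      have hx0 : x ≠ 0 := by rintro rfl; simp at hx
      simp only [cond_false] at hy
      obtain ⟨a, b, ha, hb, rfl⟩ := omul_some hy
      simp only [Option.some.injEq] at ha
      have := evl_sound hC IH _ b (by simp only [wtl, wtl_append]; omega) hb
      rw [← ha, dn, if_neg hx0, sh_app, Multiset.cons_coe, this]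
      push_cast; ring

theorem lind_sound (hC : IsNormalizedWitten C) (IH : ∀ s v, wt s < W → t.find (cd s) = some v → Nf C s = v)
    (d : ℕ) (f : List ℕ) : ∀ (pre : List ℕ) (v : ℕ), wtl pre + wtl f + 2 * d < W → lind t d pre f = some v →
    ((f : Multiset ℕ).map fun j : ℕ => 4 * (2 * (j:ℚ) + 1) * sh (j + d) (Nf C) (((pre ++ f : List ℕ) : Multiset ℕ).erase j)).sum = v := by
  induction f with
  | nil => intro pre v _ h; simp only [lind, Option.some.injEq] at h; rw [← h]; simp
  | cons x f ih =>
    intro pre v hW h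
    simp only [lind] at h
    simp only [wtl] at hW
    obtain ⟨y, z, hy, hz, rfl⟩ := oadd_some h
    have h2 := ih (x :: pre) z (by simp only [wtl]; omega) hz
    have hp : ((pre ++ x :: f : List ℕ) : Multiset ℕ) = ((x :: pre ++ f : List ℕ) : Multiset ℕ) :=
      Multiset.coe_eq_coe.2 List.perm_middle
    rw [← Multiset.cons_coe, Multiset.map_cons, Multiset.sum_cons, hp, h2]
    push_cast
    congr 1
    rw [List.cons_append, ← Multiset.cons_coe, Multiset.erase_cons_head]
    obtain ⟨a, b, ha, hb, rfl⟩ := omul_some hy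
    simp only [Option.some.injEq] at ha
    have := evl_sound hC IH _ b (by simp only [wtl, wtl_append]; omega) hb
    rw [← ha, sh_app, Multiset.cons_coe, this]
    push_cast; ring

theorem spl_sound (hC : IsNormalizedWitten C) (IH : ∀ s v, wt s < W → t.find (cd s) = some v → Nf C s = v)
    (f : List ℕ) : ∀ (p q : List ℕ) (v : ℕ), wtl p + wtl q + wtl f < W → spl t f p q = some v →
    ((f : Multiset ℕ).antidiagonal.map fun x => Nf C ((p : Multiset ℕ) + x.1) * Nf C ((q : Multiset ℕ) + x.2)).sum = v := by
  induction f with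
  | nil =>
    intro p q v hW h
    simp only [spl] at h
    simp only [wtl] at hW
    obtain ⟨y, z, hy, hz, rfl⟩ := omul_some h
    have := evl_sound hC IH _ y (by omega) hy
    have := evl_sound hC IH _ z (by omega) hz
    simp [*]
  | cons x f ih =>
    intro p q v hW h
    simp only [spl] at h
    simp only [wtl] at hW
    obtain ⟨y, z, hy, hz, rfl⟩ := oadd_some h
    have h1 := ih p (x :: q) y (by simp only [wtl]; omega) hy
    have h2 := ih (x :: p) q z (by simp only [wtl]; omega) hz
    rw [← Multiset.cons_coe, Multiset.antidiagonal_cons]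
    simp only [Multiset.map_add, Multiset.sum_add, Multiset.map_map, Function.comp_def, Prod.map, id]
    push_cast
    rw [← h1, ← h2]
    simp only [← Multiset.cons_coe, Multiset.cons_add, Multiset.add_cons]

theorem quad_sound (hC : IsNormalizedWitten C) (IH : ∀ s v, wt s < W → t.find (cd s) = some v → Nf C s = v)
    (f : List ℕ) (a : ℕ) : ∀ (b : ℕ) (v : ℕ), 2 * a + 2 * b + 2 + wtl f < W → quad t f a b = some v →
    ∑ i ∈ Finset.range (a + 1), (8 * Nf C ((a - i) ::ₘ (b + i) ::ₘ (f : Multiset ℕ)) + (sh (a - i) (Nf C) * sh (b + i) (Nf C)) f) = v := by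
  have one : ∀ (a b u v : ℕ), 2 * a + 2 * b + 2 + wtl f < W → evl t (a :: b :: f) = some u → spl t f [a] [b] = some v →
      8 * Nf C (a ::ₘ b ::ₘ (f : Multiset ℕ)) + (sh a (Nf C) * sh b (Nf C)) f = 8 * (u : ℚ) + v := by
    intro a b u v hW hu hv
    have h1 := evl_sound hC IH _ u (by simp only [wtl]; omega) hu
    have h2 := spl_sound hC IH f _ _ v (by simp only [wtl]; omega) hv
    rw [Multiset.cons_coe, Multiset.cons_coe, h1, mul_app, ← h2]
    rfl
  induction a with
  | zero =>
    intro b v hW h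
    simp only [quad] at h
    obtain ⟨y, z, hy, hz, rfl⟩ := oadd_some h
    obtain ⟨y1, y2, hy1, hy2, rfl⟩ := omul_some hy
    simp only [Option.some.injEq] at hy1
    have := one 0 b y2 z hW hy2 hz
    simp only [zero_add, Finset.sum_range_one, Nat.sub_zero, add_zero]
    rw [this, ← hy1]; push_cast; ring
  | succ a ih =>
    intro b v hW h
    simp only [quad] at h
    obtain ⟨y', z', hy', hz', rfl⟩ := oadd_some h
    obtain ⟨y, z, hy, hz, rfl⟩ := oadd_some hy'
    obtain ⟨y1, y2, hy1, hy2, rfl⟩ := omul_some hy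
    simp only [Option.some.injEq] at hy1
    have h1 := one (a+1) b y2 z hW hy2 hz
    have h2 := ih (b+1) z' (by omega) hz'
    rw [Finset.sum_range_succ']
    push_cast
    rw [← h2]
    simp only [Nat.sub_zero, add_zero]
    rw [h1, ← hy1, add_comm]
    congr 1
    · apply Finset.sum_congr rfl
      intro i _
      rw [show b + (i + 1) = b + 1 + i by ring]

theorem rhs_sound (hC : IsNormalizedWitten C) (l : List ℕ) (IH : ∀ s v, wt s < wtl l → t.find (cd s) = some v → Nf C s = v)
    (v : ℕ) (h : rhs t l = some v) : Nf C (l : Multiset ℕ) = v := by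
  match l, h with
  | 0 :: f, h =>
    simp only [rhs] at h
    obtain ⟨y, z, hy, hz, rfl⟩ := oadd_some h
    have h1 := strg_sound hC IH f [] y (by simp only [wtl]; omega) hy
    simp only [Option.some.injEq] at hz
    show sh 0 (Nf C) (f : Multiset ℕ) = _
    rw [N_string hC, add_app, Lm, S_app]
    simp only [List.nil_append] at h1
    rw [h1, ← hz, E0]
    push_cast
    congr 1
    have e : ((f : Multiset ℕ) = {0, 0}) ↔ f = [0, 0] := by
      constructor
      · intro hh
        have : (f : Multiset ℕ) = (([0, 0] : List ℕ) : Multiset ℕ) := hh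
        have := Multiset.coe_eq_coe.1 this
        exact List.perm_replicate (n := 2).1 this
      · rintro rfl; rfl
    simp only [e]
  | (m + 2) :: f, h =>
    simp only [rhs] at h
    obtain ⟨y, z, hy, hz, rfl⟩ := oadd_some h
    have h1 := lind_sound hC IH (m+1) f [] y (by simp only [wtl]; omega) hy
    have h2 := quad_sound hC IH f m 0 z (by simp only [wtl]; omega) hz
    simp only [List.nil_append] at h1
    show sh (m+2) (Nf C) (f : Multiset ℕ) = _
    rw [N_dvv hC m, add_app, add_app, add_assoc, c8_app, Lp, S_app, h1]
    push_cast
    congr 1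
    rw [← h2, sum_app, sum_app, Finset.mul_sum, ← Finset.sum_add_distrib]
    rw [Finset.Nat.sum_antidiagonal_eq_sum_range_succ (fun a b => 8 * sh a (sh b (Nf C)) (f : Multiset ℕ) + (sh a (Nf C) * sh b (Nf C)) f)]
    rw [← Finset.sum_range_reflect]
    apply Finset.sum_congr rfl
    intro i hi
    rw [Finset.mem_range] at hi
    have e1 : m + 1 - 1 - i = m - i := by omega
    have e2 : m - (m - i) = i := by omega
    simp only [e1, e2, Nat.succ_eq_add_one, sh_app, zero_add]
    rw [Multiset.cons_swap]

theorem tab_sound' (hC : IsNormalizedWitten C) (hck : t.all (ck t) = true) : ∀ (w : ℕ) (s : Multiset ℕ) (v : ℕ), wt s = w → w ≤ 63 →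
    t.find (cd s) = some v → Nf C s = v := by
  intro w
  induction w using Nat.strong_induction_on with
  | _ w ih =>
    intro s v hs hw hf
    have h := find_all hck hf
    unfold ck at h
    simp only [Bool.and_eq_true] at h
    obtain ⟨h1, h2, h3⟩ := h
    set l := dec 100 0 (cd s)
    have h1 := Nat.eq_of_beq_eq_true h1
    have h2 := Nat.le_of_ble_eq_true h2
    have hl : (l : Multiset ℕ) = s := cd_inj (by rwa [wt_coe]) (by omega) (by rw [cd_coe, h1])
    cases hr : rhs t l with
    | none => rw [hr] at h3; simp at h3
    | some v' =>
      rw [hr] at h3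
      have h3 := Nat.eq_of_beq_eq_true h3
      subst h3
      have hwl : wtl l = w := by rw [← wt_coe, hl, hs]
      rw [← hl]
      exact rhs_sound hC l (fun s v h1 h2 => ih (wt s) (by omega) s v rfl (by omega) h2) v' hr
end

/-- evaluation through the table is correct -/
theorem tab_ev (hC : IsNormalizedWitten C) (l : List ℕ) (v : ℕ) (hl : wtl l ≤ 63) (h : evl tab l = some v) :
    Nf C (l : Multiset ℕ) = v :=
  evl_sound (W := 64) hC (fun s v h1 h2 => tab_sound' hC tab_ck (wt s) s v rfl (by omega) h2) l v (by omega) h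

end WittenAsym

set_option autoImplicit false
namespace WittenAsym
open Alg
variable {C : List ℕ → ℚ}

/-- run `test` on all multisets of weight `w` with entries at least `d` -/
def ch (test : List ℕ → Bool) : ℕ → ℕ → ℕ → List ℕ → Bool
  | 0, _, _, _ => false
  | k + 1, w, d, acc => cond (Nat.beq w 0) (test acc)
      (cond (Nat.ble (2 * d + 1) w) (ch test k (w - (2 * d + 1)) d (d :: acc) && ch test k w (d + 1) acc) true)

theorem ch_sound (test : List ℕ → Bool) : ∀ (k w d : ℕ) (acc : List ℕ), ch test k w d acc = true →
    ∀ s : Multiset ℕ, (∀ x ∈ s, d ≤ x) → wt s = w → ∃ l : List ℕ, (l : Multiset ℕ) = s + acc ∧ test l = true := by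
  intro k
  induction k with
  | zero => intro w d acc h; simp [ch] at h
  | succ k ih =>
    intro w d acc h s hs hw
    simp only [ch] at h
    cases h1 : Nat.beq w 0 with
    | true =>
      rw [h1] at h
      have := Nat.eq_of_beq_eq_true h1
      have h0 := card_le_wt s
      have : s = 0 := by rw [← Multiset.card_eq_zero]; omega
      exact ⟨acc, by rw [this, zero_add], h⟩
    | false =>
      have hw0 : w ≠ 0 := by rintro rfl; simp at h1
      rw [h1] at h
      cases h2 : Nat.ble (2 * d + 1) w with
      | false =>
        exfalso
        have hs0 : s ≠ 0 := by rintro rfl; exact hw0 (by rw [← hw, wt_zero])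
        obtain ⟨x, hx⟩ := Multiset.exists_mem_of_ne_zero hs0
        have := mem_le_wt hx
        have := hs x hx
        have : Nat.ble (2 * d + 1) w = true := Nat.ble_eq_true_of_le (by omega)
        rw [h2] at this; simp at this
      | true =>
        rw [h2] at h
        simp only [cond_true, cond_false, Bool.and_eq_true] at h
        by_cases hd : d ∈ s
        · obtain ⟨t, rfl⟩ := Multiset.exists_cons_of_mem hd
          rw [wt_cons] at hw
          obtain ⟨l, hl, ht⟩ := ih _ _ _ h.1 t (fun x hx => hs x (Multiset.mem_cons_of_mem hx)) (by omega)
          refine ⟨l, ?_, ht⟩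
          rw [hl, ← Multiset.cons_coe, Multiset.cons_add, Multiset.add_cons]
        · refine ih _ _ _ h.2 s (fun x hx => ?_) hw
          have := hs x hx
          have : x ≠ d := by rintro rfl; exact hd hx
          omega

/-- integer version of `fac` -/
def facN (X : ℕ) : ℕ := 2 * 12 ^ X * (X - 1).factorial
theorem facN_cast (X : ℕ) : (facN X : ℚ) = fac X := by unfold facN fac; push_cast; ring

/-- the number of zeros to add -/
def pad (w : ℕ) : ℕ := (3 - w % 3) % 3

/-- the tabulated inequalities, `X` is the level, `p` the number of zeros, `v` the value -/
def tst1 (X p v : ℕ) : Bool :=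
  Nat.ble (3 * v) (facN X) &&
  (cond (Nat.beq p 0 && Nat.ble 15 X) (Nat.ble (6 * X * v) (facN X * (2 * X - 3))) true &&
  (cond (Nat.beq p 0 && Nat.ble X 14) (Nat.ble (10 * v) (3 * facN X)) true &&
  (cond (Nat.beq p 1 && Nat.ble X 15) (Nat.ble (1000 * v) (315 * facN X)) true &&
  cond (Nat.ble 10 X && Nat.ble X 12) (Nat.ble (289 * facN X) (1000 * v)) true)))

/-- the tabulated inequalities -/
def tst (w : ℕ) (l : List ℕ) : Bool :=
  match evl tab (List.replicate (pad w) 0 ++ l) with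
  | none => false
  | some v => tst1 ((w + pad w) / 3) (pad w) v

/-- comparison with an added leg of index four -/
def tst4 (X : ℕ) (l : List ℕ) : Bool :=
  match evl tab l, evl tab (4 :: l) with
  | some v, some v' => Nat.ble (1728 * X * (X + 1) * (X + 2) * v) v'
  | _, _ => false

/-- all weights up to `w` -/
def tstall : ℕ → Bool
  | 0 => ch (tst 0) 200 0 2 []
  | w + 1 => ch (tst (w + 1)) 200 (w + 1) 2 [] && tstall w

/-- all levels up to `X` -/
def tstall4 : ℕ → Bool
  | 0 => ch (tst4 0) 200 0 2 []
  | X + 1 => ch (tst4 (X + 1)) 200 (3 * (X + 1)) 2 [] && tstall4 X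

theorem tstall_ok : tstall 54 = true := by decide +kernel
theorem tstall4_ok : tstall4 15 = true := by decide +kernel

theorem tstall4_sound : ∀ w, tstall4 w = true → ∀ w' ≤ w, ch (tst4 w') 200 (3 * w') 2 [] = true := by
  intro w
  induction w with
  | zero => intro h w' hw'; obtain rfl : w' = 0 := by omega
            exact h
  | succ w ih =>
    intro h w' hw'
    simp only [tstall4, Bool.and_eq_true] at h
    rcases Nat.lt_or_ge w w' with h1 | h1
    · obtain rfl : w' = w + 1 := by omega
      exact h.1
    · exact ih h.2 w' h1

theorem tab_four (hC : IsNormalizedWitten C) (s : Multiset ℕ) (hs : ∀ x ∈ s, 2 ≤ x) (X : ℕ) (hX : X ≤ 15) (hw : wt s = 3 * X) :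
    1728 * (X : ℚ) * (X + 1) * (X + 2) * Nf C s ≤ Nf C (4 ::ₘ s) := by
  obtain ⟨l, hl, ht⟩ := ch_sound _ _ _ _ _ (tstall4_sound 15 tstall4_ok X hX) s hs hw
  have hl : (l : Multiset ℕ) = s := by simpa using hl
  have ew : wtl l = 3 * X := by rw [← wt_coe, hl, hw]
  unfold tst4 at ht
  cases hv : evl tab l with
  | none => rw [hv] at ht; simp at ht
  | some v =>
    cases hv' : evl tab (4 :: l) with
    | none => rw [hv, hv'] at ht; simp at ht
    | some v' =>
      rw [hv, hv'] at ht
      have h1 := tab_ev hC _ v (by omega) hv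
      have h2 := tab_ev hC _ v' (by simp only [wtl]; omega) hv'
      rw [← Multiset.cons_coe, hl] at h2
      rw [hl] at h1
      rw [h1, h2]
      have := Nat.le_of_ble_eq_true ht
      exact_mod_cast this

theorem tstall_sound : ∀ w, tstall w = true → ∀ w' ≤ w, ch (tst w') 200 w' 2 [] = true := by
  intro w
  induction w with
  | zero => intro h w' hw'; obtain rfl : w' = 0 := by omega
            exact h
  | succ w ih =>
    intro h w' hw'
    simp only [tstall, Bool.and_eq_true] at h
    rcases Nat.lt_or_ge w w' with h1 | h1
    · obtain rfl : w' = w + 1 := by omega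
      exact h.1
    · exact ih h.2 w' h1

theorem tab_bound (hC : IsNormalizedWitten C) (s : Multiset ℕ) (hs : ∀ x ∈ s, 2 ≤ x) (p X : ℕ) (hp : p ≤ 2)
    (hX : X ≤ 18) (hw : wt s + p = 3 * X) :
    3 * Nf C (Multiset.replicate p 0 + s) ≤ fac X ∧
    (p = 0 → 15 ≤ X → Nf C s * (6 * X) ≤ fac X * (2 * X - 3)) ∧
    (p = 0 → X ≤ 14 → 10 * Nf C s ≤ 3 * fac X) ∧
    (p = 1 → X ≤ 15 → 1000 * Nf C (Multiset.replicate p 0 + s) ≤ 315 * fac X) ∧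
    (10 ≤ X → X ≤ 12 → 289 * fac X ≤ 1000 * Nf C (Multiset.replicate p 0 + s)) := by
  obtain ⟨l, hl, ht⟩ := ch_sound _ _ _ _ _ (tstall_sound 54 tstall_ok (wt s) (by omega)) s hs rfl
  have hl : (l : Multiset ℕ) = s := by simpa using hl
  unfold tst at ht
  have hpad : pad (wt s) = p := by unfold pad; omega
  have hX3 : (wt s + p) / 3 = X := by omega
  rw [hpad, hX3] at ht
  have e : ((List.replicate p 0 ++ l : List ℕ) : Multiset ℕ) = Multiset.replicate p 0 + s := by
    rw [← Multiset.coe_add, hl, Multiset.coe_replicate]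
  have ew : wtl (List.replicate p 0 ++ l) ≤ 63 := by
    rw [← wt_coe, e, wt_add]
    have : wt (Multiset.replicate p 0) = p := by simp [wt]
    omega
  cases hv : evl tab (List.replicate p 0 ++ l) with
  | none => rw [hv] at ht; simp at ht
  | some v =>
    rw [hv] at ht
    have h1 := tab_ev hC _ v ew hv
    rw [e] at h1
    simp only [tst1, Bool.and_eq_true] at ht
    obtain ⟨t1, t2, t3, t5, t4⟩ := ht
    rw [h1]
    refine ⟨?_, ?_, ?_, ?_, ?_⟩
    · rw [← facN_cast]
      have := Nat.le_of_ble_eq_true t1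
      exact_mod_cast this
    · intro h2 h3
      subst h2
      rw [Nat.ble_eq_true_of_le h3] at t2
      have h5 := Nat.le_of_ble_eq_true t2
      rw [Multiset.replicate_zero, zero_add] at h1
      rw [h1, ← facN_cast]
      have h6 : ((6 * X * v : ℕ) : ℚ) ≤ ((facN X * (2 * X - 3) : ℕ) : ℚ) := by exact_mod_cast h5
      rw [Nat.cast_mul, Nat.cast_mul, Nat.cast_mul, Nat.cast_sub (by omega)] at h6
      push_cast at h6 ⊢
      linarith
    · intro h2 h3
      subst h2
      rw [Nat.ble_eq_true_of_le h3] at t3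
      have h5 := Nat.le_of_ble_eq_true t3
      rw [Multiset.replicate_zero, zero_add] at h1
      rw [h1, ← facN_cast]
      exact_mod_cast h5
    · intro h2 h3
      subst h2
      rw [Nat.ble_eq_true_of_le h3] at t5
      have h5 := Nat.le_of_ble_eq_true t5
      rw [← facN_cast]
      exact_mod_cast h5
    · intro h2 h3
      rw [Nat.ble_eq_true_of_le h2, Nat.ble_eq_true_of_le h3] at t4
      have h5 := Nat.le_of_ble_eq_true t4
      rw [← facN_cast]
      exact_mod_cast h5

end WittenAsym

set_option autoImplicit false
namespace WittenAsym
open Alg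
variable {C : List ℕ → ℚ}

/-! ### Nonnegativity -/

theorem E0_nonneg (s : Multiset ℕ) : 0 ≤ E0 s := by unfold E0; split_ifs <;> norm_num

theorem mul_nonneg_of {φ ψ : Alg} {s : Multiset ℕ}
    (h : ∀ p ∈ s.antidiagonal, 0 ≤ φ p.1 * ψ p.2) : 0 ≤ (φ * ψ) s := by
  rw [mul_app]
  apply Multiset.sum_nonneg
  intro x hx
  obtain ⟨p, hp, rfl⟩ := Multiset.mem_map.1 hx
  exact h p hp

theorem wt_erase {s : Multiset ℕ} {j : ℕ} (h : j ∈ s) : wt (s.erase j) + (2 * j + 1) = wt s := by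
  conv_rhs => rw [← Multiset.cons_erase h, wt_cons]
  ring

theorem N_str (hC : IsNormalizedWitten C) (t : Multiset ℕ) : Nf C (0 ::ₘ t) =
    (t.map fun j : ℕ => 4 * (2 * (j:ℚ) + 1) * dn (Nf C) j (t.erase j)).sum + E0 t := by
  show sh 0 (Nf C) t = _
  rw [N_string hC, add_app, Lm, S_app]

theorem N_big (hC : IsNormalizedWitten C) (m : ℕ) (f : Multiset ℕ) : Nf C ((m+2) ::ₘ f) =
    (f.map fun j : ℕ => 4 * (2 * (j:ℚ) + 1) * Nf C ((j + (m+1)) ::ₘ f.erase j)).sum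
    + 8 * (∑ p ∈ Finset.HasAntidiagonal.antidiagonal m, Nf C (p.2 ::ₘ p.1 ::ₘ f))
    + ∑ p ∈ Finset.HasAntidiagonal.antidiagonal m, (sh p.1 (Nf C) * sh p.2 (Nf C)) f := by
  show sh (m+2) (Nf C) f = _
  rw [N_dvv hC m, add_app, add_app, c8_app, Lp, S_app, sum_app, sum_app]
  rfl

theorem N_nonneg (hC : IsNormalizedWitten C) : ∀ s : Multiset ℕ, 0 ≤ Nf C s := by
  suffices H : ∀ w s, wt s = w → 0 ≤ Nf C s from fun s => H _ s rfl
  intro w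
  induction w using Nat.strong_induction_on with
  | _ w ih =>
    intro s hs
    rcases Multiset.empty_or_exists_mem s with rfl | ⟨a, ha⟩
    · rw [N_zero]
    obtain ⟨t, rfl⟩ := Multiset.exists_cons_of_mem ha
    rw [wt_cons] at hs
    rcases a with _ | _ | m
    · rw [N_str hC]
      refine add_nonneg (Multiset.sum_nonneg ?_) (E0_nonneg _)
      intro x hx
      obtain ⟨j, hj, rfl⟩ := Multiset.mem_map.1 hx
      refine mul_nonneg (by positivity) ?_
      unfold dn
      split_ifs with h0
      · simp
      · have := wt_erase hj
        exact ih (wt ((j - 1) ::ₘ t.erase j)) (by rw [wt_cons]; omega) _ rfl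
    · rw [zero_add, N_one hC]
      have := ih (wt t) (by omega) t rfl
      split_ifs <;> positivity
    · rw [N_big hC]
      refine add_nonneg (add_nonneg (Multiset.sum_nonneg ?_) (mul_nonneg (by norm_num) (Finset.sum_nonneg ?_))) (Finset.sum_nonneg ?_)
      · intro x hx
        obtain ⟨j, hj, rfl⟩ := Multiset.mem_map.1 hx
        refine mul_nonneg (by positivity) ?_
        have := wt_erase hj
        exact ih (w - 3) (by omega) _ (by rw [wt_cons]; omega)
      · intro p hp
        rw [Finset.HasAntidiagonal.mem_antidiagonal] at hp
        exact ih (w - 3) (by omega) _ (by rw [wt_cons, wt_cons]; omega)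
      · intro p hp
        rw [Finset.HasAntidiagonal.mem_antidiagonal] at hp
        apply mul_nonneg_of
        intro q hq
        rw [Multiset.mem_antidiagonal] at hq
        have hw : wt q.1 + wt q.2 = wt t := by rw [← wt_add, hq]
        exact mul_nonneg (ih (wt (p.1 ::ₘ q.1)) (by rw [wt_cons]; omega) _ rfl)
          (ih (wt (p.2 ::ₘ q.2)) (by rw [wt_cons]; omega) _ rfl)

/-! ### Counting splittings -/

theorem choose_rec (g : ℕ → ℚ) (n : ℕ) : ∑ k ∈ Finset.range (n + 2), ((n + 1).choose k : ℚ) * g k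
    = ∑ k ∈ Finset.range (n + 1), (n.choose k : ℚ) * g k + ∑ k ∈ Finset.range (n + 1), (n.choose k : ℚ) * g (k + 1) := by
  rw [Finset.sum_range_succ']
  have : ∀ k, (((n + 1).choose (k + 1) : ℕ) : ℚ) * g (k + 1) = (n.choose k : ℚ) * g (k + 1) + (n.choose (k + 1) : ℚ) * g (k + 1) := by
    intro k; rw [Nat.choose_succ_succ]; push_cast; ring
  simp only [this]
  rw [Finset.sum_add_distrib]
  have h2 : ∑ k ∈ Finset.range (n + 1), (n.choose k : ℚ) * g k = ∑ k ∈ Finset.range (n + 2), (n.choose k : ℚ) * g k := by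
    rw [Finset.sum_range_succ _ (n+1), Nat.choose_succ_self]; simp
  rw [h2, Finset.sum_range_succ' _ (n + 1)]
  simp; ring

theorem sum_antidiag_card (g : ℕ → ℚ) (s : Multiset ℕ) :
    (s.antidiagonal.map fun p => g (Multiset.card p.1)).sum
      = ∑ k ∈ Finset.range (Multiset.card s + 1), ((Multiset.card s).choose k : ℚ) * g k := by
  induction s using Multiset.induction_on generalizing g with
  | empty => simp
  | cons a s ih =>
    rw [Multiset.antidiagonal_cons, Multiset.card_cons, choose_rec, ← ih, ← ih (fun k => g (k+1))]
    simp [Multiset.map_map]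

theorem split_le (φ ψ : Alg) (s : Multiset ℕ) (B : ℕ → ℚ)
    (h : ∀ I J, I + J = s → φ I * ψ J * ((Multiset.card s).choose (Multiset.card I) : ℚ) ≤ B (Multiset.card I)) :
    (φ * ψ) s ≤ ∑ k ∈ Finset.range (Multiset.card s + 1), B k := by
  have h1 : (φ * ψ) s ≤ (s.antidiagonal.map fun p => B (Multiset.card p.1) / ((Multiset.card s).choose (Multiset.card p.1) : ℚ)).sum := by
    rw [mul_app]
    apply Multiset.sum_map_le_sum_map
    intro p hp
    rw [Multiset.mem_antidiagonal] at hp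
    have hc : Multiset.card p.1 ≤ Multiset.card s := by rw [← hp]; simp
    have := Nat.choose_pos hc
    rw [le_div_iff₀ (by exact_mod_cast this)]
    exact h p.1 p.2 hp
  refine h1.trans (le_of_eq ?_)
  rw [sum_antidiag_card (fun k => B k / ((Multiset.card s).choose k : ℚ))]
  apply Finset.sum_congr rfl
  intro k hk
  rw [Finset.mem_range] at hk
  have := Nat.choose_pos (show k ≤ Multiset.card s by omega)
  have : ((Multiset.card s).choose k : ℚ) ≠ 0 := by exact_mod_cast this.ne'
  field_simp

/-- normalisation of a product -/
def GG (Y : ℕ) : ℚ := 4 * 12 ^ Y * ((Y - 2).factorial : ℚ)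
theorem GG_pos (Y : ℕ) : 0 < GG Y := by unfold GG; positivity

theorem fac_mul (i j : ℕ) : fac (i + 1) * fac (j + 1) * ((i + j).choose i : ℚ) = GG (i + j + 2) := by
  unfold fac GG
  have := Nat.add_choose_mul_factorial_mul_factorial j i
  rw [add_comm j i, mul_right_comm] at this
  have h : (((i + j).choose i : ℕ) : ℚ) * (i.factorial : ℚ) * (j.factorial : ℚ) = ((i + j).factorial : ℚ) := by
    exact_mod_cast this
  simp only [Nat.add_sub_cancel]
  rw [← h]; ring

theorem GG_fac (Y : ℕ) (hY : 2 ≤ Y) : GG Y * (Y - 1) = 2 * fac Y := by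
  obtain ⟨k, rfl⟩ : ∃ k, Y = k + 2 := ⟨Y - 2, by omega⟩
  unfold fac GG
  simp only [Nat.add_sub_cancel, show k + 2 - 1 = k + 1 from rfl, Nat.factorial_succ]
  push_cast; ring

theorem choose_vand (k p l q : ℕ) : (k + l).choose k * (p + q).choose p ≤ (k + p + (l + q)).choose (k + p) := by
  rw [show k + p + (l + q) = (k + l) + (p + q) by ring, Nat.add_choose_eq (k + l) (p + q) (k + p)]
  exact Finset.single_le_sum (f := fun ij : ℕ × ℕ => (k + l).choose ij.1 * (p + q).choose ij.2) (fun _ _ => Nat.zero_le _)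
    (show (k, p) ∈ Finset.HasAntidiagonal.antidiagonal (k + p) by simp)

theorem choose_ge (p q : ℕ) : p + q + 2 ≤ (p + q + 2).choose (p + 1) := by
  induction q with
  | zero => simp
  | succ q ih =>
    rw [show p + (q + 1) + 2 = (p + q + 2) + 1 by ring, Nat.choose_succ_succ]
    have := Nat.choose_pos (show p ≤ p + q + 2 by omega)
    have e : p.succ = p + 1 := rfl
    rw [e]
    omega

end WittenAsym

set_option autoImplicit false
namespace WittenAsym
open Alg
variable {C : List ℕ → ℚ}

/-! ### The upper bound `C ≤ 1/3` -/

theorem sum_str (B : ℚ) (t : Multiset ℕ) :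
    (t.map fun j : ℕ => 4 * (2 * (j:ℚ) + 1) * (if j = 0 then 0 else B)).sum
      = 4 * ((wt t : ℚ) - (t.count 0 : ℚ)) * B := by
  induction t using Multiset.induction_on with
  | empty => simp [wt_zero]
  | cons a t ih =>
    rw [Multiset.map_cons, Multiset.sum_cons, ih, wt_cons]
    rcases Nat.eq_zero_or_pos a with rfl | ha
    · rw [Multiset.count_cons_self, if_pos rfl]; push_cast; ring
    · rw [Multiset.count_cons_of_ne (by omega), if_neg (by omega)]; push_cast; ring

theorem sum_lin (B : ℚ) (t : Multiset ℕ) :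
    (t.map fun j : ℕ => 4 * (2 * (j:ℚ) + 1) * B).sum = 4 * (wt t : ℚ) * B := by
  induction t using Multiset.induction_on with
  | empty => simp [wt_zero]
  | cons a t ih =>
    rw [Multiset.map_cons, Multiset.sum_cons, ih, wt_cons]; push_cast; ring

theorem str_le (hC : IsNormalizedWitten C) (t : Multiset ℕ) (B : ℚ) (hE : t ≠ {0, 0})
    (h : ∀ j ∈ t, j ≠ 0 → Nf C ((j-1) ::ₘ t.erase j) ≤ B) :
    Nf C (0 ::ₘ t) ≤ 4 * ((wt t : ℚ) - (t.count 0 : ℚ)) * B := by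
  rw [N_str hC, ← sum_str, E0, if_neg hE, add_zero]
  apply Multiset.sum_map_le_sum_map
  intro j hj
  refine mul_le_mul_of_nonneg_left ?_ (by positivity)
  unfold dn
  split_ifs with h0
  · simp
  · exact h j hj h0

theorem str_ge (hC : IsNormalizedWitten C) (t : Multiset ℕ) (B : ℚ)
    (h : ∀ j ∈ t, j ≠ 0 → B ≤ Nf C ((j-1) ::ₘ t.erase j)) :
    4 * ((wt t : ℚ) - (t.count 0 : ℚ)) * B ≤ Nf C (0 ::ₘ t) := by
  rw [N_str hC, ← sum_str]
  refine le_trans ?_ (le_add_of_nonneg_right (E0_nonneg _))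
  apply Multiset.sum_map_le_sum_map
  intro j hj
  refine mul_le_mul_of_nonneg_left ?_ (by positivity)
  unfold dn
  split_ifs with h0
  · simp
  · exact h j hj h0

/-- bound for arguments without zeros -/
def hh (X : ℕ) : ℚ := if X < 15 then 3/10 else 1/3 - 1/(2*X)
/-- bound for arguments with one zero -/
def h1 (X : ℕ) : ℚ := if X < 16 then 315/1000 else 1/3 - 5/(18*X)

theorem hh_big {X : ℕ} (h : 15 ≤ X) : hh X = 1/3 - 1/(2*X) := by
  unfold hh; rw [if_neg (by omega)]
theorem h1_big {X : ℕ} (h : 16 ≤ X) : h1 X = 1/3 - 5/(18*X) := by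
  unfold h1; rw [if_neg (by omega)]

theorem hh_mono (X : ℕ) : hh X ≤ hh (X+1) := by
  rcases Nat.lt_or_ge X 14 with h | h
  · unfold hh; rw [if_pos (by omega), if_pos (by omega)]
  rcases Nat.lt_or_ge X 15 with h' | h'
  · obtain rfl : X = 14 := by omega
    norm_num [hh]
  · rw [hh_big h', hh_big (by omega)]
    have : (0:ℚ) < X := by exact_mod_cast (by omega : 0 < X)
    push_cast
    gcongr; linarith
theorem h1_mono (X : ℕ) : h1 X ≤ h1 (X+1) := by
  rcases Nat.lt_or_ge X 15 with h | h
  · unfold h1; rw [if_pos (by omega), if_pos (by omega)]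
  rcases Nat.lt_or_ge X 16 with h' | h'
  · obtain rfl : X = 15 := by omega
    norm_num [h1]
  · rw [h1_big h', h1_big (by omega)]
    have : (0:ℚ) < X := by exact_mod_cast (by omega : 0 < X)
    push_cast
    gcongr; linarith
theorem hh_le (X : ℕ) : hh X ≤ 1/3 := by
  unfold hh; split_ifs
  · norm_num
  · have : (0:ℚ) ≤ 1/(2*X) := by positivity
    linarith
theorem h1_le (X : ℕ) : h1 X ≤ 1/3 := by
  unfold h1; split_ifs
  · norm_num
  · have : (0:ℚ) ≤ 5/(18*X) := by positivity
    linarith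

/-- special splittings -/
def spc (m a k : ℕ) : ℚ := if (a = 1 ∧ k = 0) ∨ (m = 0 ∧ k = 1) then 1 else 0
theorem spc_nonneg (m a k : ℕ) : 0 ≤ spc m a k := by unfold spc; split_ifs <;> norm_num

theorem spc_sum (m n : ℕ) : ∑ p ∈ Finset.HasAntidiagonal.antidiagonal m, ∑ k ∈ Finset.range (n+1), spc m p.1 k ≤ 1 := by
  rcases Nat.eq_zero_or_pos m with rfl | hm
  · rw [Finset.Nat.antidiagonal_zero, Finset.sum_singleton]
    have : ∀ k, spc 0 0 k = if k = 1 then 1 else 0 := by intro k; unfold spc; simp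
    simp only [this]
    rw [Finset.sum_ite_eq' (Finset.range (n+1)) 1 (fun _ => (1:ℚ))]
    split_ifs <;> norm_num
  · rw [Finset.Nat.sum_antidiagonal_eq_sum_range_succ (f := fun a _ => ∑ k ∈ Finset.range (n+1), spc m a k)]
    have : ∀ a, ∑ k ∈ Finset.range (n+1), spc m a k = if a = 1 then 1 else 0 := by
      intro a
      have : ∀ k, spc m a k = if k = 0 then (if a = 1 then 1 else 0) else 0 := by
        intro k; unfold spc
        by_cases h1 : a = 1 <;> by_cases h2 : k = 0 <;> simp [h1, h2] <;> omega
      simp only [this]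
      rw [Finset.sum_ite_eq' (Finset.range (n+1)) 0 (fun _ => (if a = 1 then 1 else 0 : ℚ))]
      simp
    simp only [this]
    rw [Finset.sum_ite_eq' (Finset.range (m+1)) 1 (fun _ => (1:ℚ))]
    split_ifs <;> norm_num

theorem wt_ge_card (c : ℕ) (s : Multiset ℕ) (h : ∀ x ∈ s, c ≤ x) : (2 * c + 1) * Multiset.card s ≤ wt s := by
  induction s using Multiset.induction_on with
  | empty => simp
  | cons a s ih =>
    rw [wt_cons, Multiset.card_cons, mul_add]
    have := ih (fun x hx => h x (Multiset.mem_cons_of_mem hx))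
    have := h a (Multiset.mem_cons_self _ _)
    omega

/-- the quadratic terms in the recursion are small -/
theorem quad_le (hC : IsNormalizedWitten C) (m : ℕ) (f : Multiset ℕ) (X : ℕ) (hX : 19 ≤ X)
    (hw : 2 * m + 5 + wt f = 3 * X) (hf : ∀ x ∈ f, m + 2 ≤ x)
    (ih : ∀ Y, Y < X → ∀ s, wt s = 3 * Y → Nf C s ≤ fac Y / 3) :
    ∑ p ∈ Finset.HasAntidiagonal.antidiagonal m, (sh p.1 (Nf C) * sh p.2 (Nf C)) f ≤ GG (X-1) / 9 * 7 := by
  set n := Multiset.card f with hn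
  have hfn := wt_ge_card (m+2) f hf
  rw [← hn] at hfn
  have hD0 : 3 * (m + 1) * (n + 1) + 15 * n + 45 ≤ 15 * X := by
    rcases Nat.lt_or_ge ((n+1)*(m+1)) 5 with h | h
    · have : n + 1 ≤ (n+1)*(m+1) := Nat.le_mul_of_pos_right _ (by omega)
      nlinarith
    · nlinarith
  have hD1 : n + 4 ≤ X := by nlinarith [Nat.zero_le (m*n)]
  obtain ⟨D, hD⟩ : ∃ D, X = n + 4 + D := ⟨X - n - 4, by omega⟩
  have key : ∀ p ∈ Finset.HasAntidiagonal.antidiagonal m, (sh p.1 (Nf C) * sh p.2 (Nf C)) f ≤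
      ∑ k ∈ Finset.range (n+1), GG (X-1) / 9 * (1 / ((D:ℚ)+1) + spc m p.1 k + spc m p.2 (n-k)) := by
    intro p hp
    rw [Finset.HasAntidiagonal.mem_antidiagonal] at hp
    obtain ⟨a, b⟩ := p
    simp only at hp ⊢
    apply split_le
    intro I J hIJ
    rw [sh_app, sh_app, ← hn]
    have hG := GG_pos (X-1)
    have hB : 0 ≤ GG (X-1) / 9 * (1 / ((D:ℚ)+1) + spc m a (Multiset.card I) + spc m b (n-Multiset.card I)) := by
      have := spc_nonneg m a (Multiset.card I)
      have := spc_nonneg m b (n-Multiset.card I)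
      positivity
    by_cases hI : IG (a ::ₘ I)
    swap
    · rw [N_vanish hC hI]; simpa using hB
    by_cases hJ : IG (b ::ₘ J)
    swap
    · rw [N_vanish hC hJ]; simpa using hB
    have hI' := IG_dvd hI
    have hJ' := IG_dvd hJ
    rw [wt_cons] at hI' hJ'
    have hwf : wt I + wt J = wt f := by rw [← hIJ, wt_add]
    have hcf : Multiset.card I + Multiset.card J = n := by rw [hn, ← hIJ]; simp
    have hI2 := wt_ge_card (m+2) I (fun x hx => hf x (by rw [← hIJ]; exact Multiset.mem_add.2 (Or.inl hx)))
    have hJ2 := wt_ge_card (m+2) J (fun x hx => hf x (by rw [← hIJ]; exact Multiset.mem_add.2 (Or.inr hx)))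
    obtain ⟨i, hi⟩ : ∃ i, XM (a ::ₘ I) = i + 1 := ⟨XM (a ::ₘ I) - 1, by omega⟩
    obtain ⟨j, hj⟩ : ∃ j, XM (b ::ₘ J) = j + 1 := ⟨XM (b ::ₘ J) - 1, by omega⟩
    rw [hi] at hI'; rw [hj] at hJ'
    have hij : i + j + 2 = X - 1 := by omega
    have b1 := ih (i+1) (by omega) (a ::ₘ I) (by rw [wt_cons]; omega)
    have b2 := ih (j+1) (by omega) (b ::ₘ J) (by rw [wt_cons]; omega)
    set k := Multiset.card I with hk
    set l := Multiset.card J with hl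
    have hIk : 5 * k ≤ wt I := by nlinarith
    have hJl : 5 * l ≤ wt J := by nlinarith
    have hik : k ≤ i := by omega
    have hjl : l ≤ j := by omega
    obtain ⟨p, rfl⟩ := Nat.exists_eq_add_of_le hik
    obtain ⟨q, rfl⟩ := Nat.exists_eq_add_of_le hjl
    have hpq : p + q = D + 1 := by omega
    have hv := choose_vand k p l q
    have hf2 := fac_mul (k+p) (l+q)
    rw [hij] at hf2
    have hprod : Nf C (a ::ₘ I) * Nf C (b ::ₘ J) ≤ fac (k+p+1) / 3 * (fac (l+q+1) / 3) :=
      mul_le_mul b1 b2 (N_nonneg hC _) (by have := fac_pos (k+p+1); positivity)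
    have hc1 : (0:ℚ) < ((p+q).choose p : ℚ) := by exact_mod_cast Nat.choose_pos (by omega)
    have hmain : Nf C (a ::ₘ I) * Nf C (b ::ₘ J) * (n.choose k : ℚ) ≤ GG (X-1) / 9 * (1 / ((p+q).choose p : ℚ)) := by
      have h3 : (n.choose k : ℚ) * ((p+q).choose p : ℚ) ≤ ((k+p+(l+q)).choose (k+p) : ℚ) := by
        rw [← hcf]; exact_mod_cast hv
      have h4 : Nf C (a ::ₘ I) * Nf C (b ::ₘ J) * (n.choose k : ℚ) * ((p+q).choose p : ℚ) ≤ GG (X-1) / 9 := by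
        calc Nf C (a ::ₘ I) * Nf C (b ::ₘ J) * (n.choose k : ℚ) * ((p+q).choose p : ℚ)
            = Nf C (a ::ₘ I) * Nf C (b ::ₘ J) * ((n.choose k : ℚ) * ((p+q).choose p : ℚ)) := by ring
          _ ≤ fac (k+p+1) / 3 * (fac (l+q+1) / 3) * ((k+p+(l+q)).choose (k+p) : ℚ) := by
              apply mul_le_mul hprod h3 (by positivity)
              have := fac_pos (k+p+1); have := fac_pos (l+q+1); positivity
          _ = GG (X-1) / 9 := by rw [← hf2]; ring
      rw [mul_one_div, le_div_iff₀ hc1]; exact h4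
    refine hmain.trans (mul_le_mul_of_nonneg_left ?_ (by positivity))
    have s1 := spc_nonneg m a k
    have s2 := spc_nonneg m b (n-k)
    have hD2 : (0:ℚ) ≤ 1 / ((D:ℚ)+1) := by positivity
    have hle1 : 1 / ((p+q).choose p : ℚ) ≤ 1 := by
      rw [div_le_one hc1]; exact_mod_cast Nat.choose_pos (by omega)
    rcases Nat.eq_zero_or_pos p with hp0 | hp0
    · have : spc m a k = 1 := by
        unfold spc; rw [if_pos]
        rcases Nat.eq_zero_or_pos k with hk0 | hk0
        · have hI0 : I = 0 := Multiset.card_eq_zero.1 (hk ▸ hk0)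
          rw [hI0, wt_zero] at hI'
          left; omega
        · right
          have hk1 : k = 1 := by omega
          refine ⟨?_, hk1⟩
          rw [hk1] at hI2; omega
      linarith
    rcases Nat.eq_zero_or_pos q with hq0 | hq0
    · have : spc m b (n-k) = 1 := by
        have e : n - k = l := by omega
        rw [e]
        unfold spc; rw [if_pos]
        rcases Nat.eq_zero_or_pos l with hk0 | hk0
        · have hJ0 : J = 0 := Multiset.card_eq_zero.1 (hl ▸ hk0)
          rw [hJ0, wt_zero] at hJ'
          left; omega
        · right
          have hk1 : l = 1 := by omega
          refine ⟨?_, hk1⟩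
          rw [hk1] at hJ2; omega
      linarith
    · obtain ⟨p, rfl⟩ : ∃ p', p = p' + 1 := ⟨p - 1, by omega⟩
      obtain ⟨q, rfl⟩ : ∃ p', q = p' + 1 := ⟨q - 1, by omega⟩
      have := choose_ge p q
      rw [show p + 1 + (q + 1) = p + q + 2 by ring]
      have h5 : 1 / ((p+q+2).choose (p+1) : ℚ) ≤ 1 / ((D:ℚ)+1) := by
        apply one_div_le_one_div_of_le (by positivity)
        have : D + 1 ≤ (p+q+2).choose (p+1) := by omega
        exact_mod_cast this
      linarith
  refine (Finset.sum_le_sum key).trans ?_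
  simp only [← Finset.mul_sum]
  refine mul_le_mul_of_nonneg_left ?_ (by have := GG_pos (X-1); positivity)
  simp only [Finset.sum_add_distrib]
  have e1 := spc_sum m n
  have e2 : ∑ p ∈ Finset.HasAntidiagonal.antidiagonal m, ∑ k ∈ Finset.range (n+1), spc m p.2 (n-k) ≤ 1 := by
    have : ∀ b, ∑ k ∈ Finset.range (n+1), spc m b (n-k) = ∑ k ∈ Finset.range (n+1), spc m b k := by
      intro b
      rw [← Finset.sum_range_reflect]
      apply Finset.sum_congr rfl
      intro k hk
      rw [Finset.mem_range] at hk
      congr 1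
      omega
    simp only [this]
    have e4 := Finset.Nat.sum_antidiagonal_swap (n := m) (f := fun p : ℕ × ℕ => ∑ k ∈ Finset.range (n+1), spc m p.1 k)
    exact e4.le.trans e1
  have e3 : ∑ p ∈ Finset.HasAntidiagonal.antidiagonal m, ∑ k ∈ Finset.range (n+1), 1 / ((D:ℚ)+1) ≤ 5 := by
    simp only [Finset.sum_const, Finset.card_range, Finset.Nat.card_antidiagonal, nsmul_eq_mul]
    rw [← mul_assoc, mul_one_div, div_le_iff₀ (by positivity)]
    have : (m+1) * (n+1) ≤ 5 * (D+1) := by rw [hD] at hD0; nlinarith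
    exact_mod_cast this
  linarith

end WittenAsym

set_option autoImplicit false
namespace WittenAsym
open Alg
variable {C : List ℕ → ℚ}

theorem exists_min_mem (s : Multiset ℕ) (h : s ≠ 0) : ∃ a ∈ s, ∀ x ∈ s, a ≤ x := by
  obtain ⟨a, ha⟩ := Multiset.exists_mem_of_ne_zero h
  obtain ⟨b, hb, h⟩ := Finset.exists_min_image s.toFinset id ⟨a, by simpa using ha⟩
  exact ⟨b, by simpa using hb, fun x hx => h x (by simpa using hx)⟩

theorem exc_sum (m : ℕ) (c : ℚ) : ∑ p ∈ Finset.HasAntidiagonal.antidiagonal m,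
    ((if p.1 = 0 then c else 0) + (if p.2 = 0 then c else 0)) = 2 * c := by
  rw [Finset.sum_add_distrib]
  have e : ∑ p ∈ Finset.HasAntidiagonal.antidiagonal m, (if p.1 = 0 then c else 0) = c := by
    rw [Finset.Nat.sum_antidiagonal_eq_sum_range_succ (f := fun a _ => if a = 0 then c else 0),
      Finset.sum_ite_eq' (Finset.range (m+1)) 0 (fun _ => c)]
    simp
  have e4 := Finset.Nat.sum_antidiagonal_swap (n := m) (f := fun p : ℕ × ℕ => if p.1 = 0 then c else 0)
  have e5 : ∑ p ∈ Finset.HasAntidiagonal.antidiagonal m, (if p.2 = 0 then c else 0) = c := e4.trans e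
  rw [e, e5]; ring

/-- the recursion step for arguments with all entries at least 2 -/
theorem cap_step (hC : IsNormalizedWitten C) (s : Multiset ℕ) (X : ℕ) (hX : 19 ≤ X) (hw : wt s = 3 * X)
    (hs : ∀ x ∈ s, 2 ≤ x)
    (ih1 : ∀ Y, Y < X → ∀ s, wt s = 3 * Y → Nf C s ≤ fac Y / 3)
    (ih2 : ∀ s, wt s = 3 * (X-1) → s.count 0 = 0 → Nf C s ≤ fac (X-1) * hh (X-1))
    (ih3 : ∀ s, wt s = 3 * (X-1) → s.count 0 = 1 → Nf C s ≤ fac (X-1) * h1 (X-1)) :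
    Nf C s ≤ fac X * hh X := by
  have hs0 : s ≠ 0 := by rintro rfl; rw [wt_zero] at hw; omega
  obtain ⟨d, hd, hmin⟩ := exists_min_mem s hs0
  obtain ⟨f, rfl⟩ := Multiset.exists_cons_of_mem hd
  obtain ⟨m, rfl⟩ : ∃ m, d = m + 2 := ⟨d - 2, by have := hs d hd; omega⟩
  rw [wt_cons] at hw
  have hf : ∀ x ∈ f, m + 2 ≤ x := fun x hx => hmin x (Multiset.mem_cons_of_mem hx)
  have hq := quad_le hC m f X hX (by omega) hf ih1
  rw [N_big hC]
  have hxq : (0:ℚ) < (X:ℚ) - 2 := by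
    have : (19:ℚ) ≤ X := by exact_mod_cast hX
    linarith
  have hF := fac_pos (X-1)
  have hX1 : ((X-1 : ℕ) : ℚ) = (X:ℚ) - 1 := by rw [Nat.cast_sub (by omega)]; simp
  have hl : (f.map fun j : ℕ => 4 * (2 * (j:ℚ) + 1) * Nf C ((j + (m+1)) ::ₘ f.erase j)).sum
      ≤ 4 * (wt f : ℚ) * (fac (X-1) * hh (X-1)) := by
    rw [← sum_lin]
    apply Multiset.sum_map_le_sum_map
    intro j hj
    refine mul_le_mul_of_nonneg_left ?_ (by positivity)
    apply ih2
    · rw [wt_cons]; have := wt_erase hj; omega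
    · rw [Multiset.count_eq_zero, Multiset.mem_cons]
      rintro (h | h)
      · omega
      · have := hf _ (Multiset.mem_of_mem_erase h); omega
  have hm : ∑ p ∈ Finset.HasAntidiagonal.antidiagonal m, Nf C (p.2 ::ₘ p.1 ::ₘ f) ≤
      fac (X-1) * (((m:ℚ)+1) * hh (X-1) + 1 / (2 * ((X:ℚ)-1))) := by
    have : ∀ p ∈ Finset.HasAntidiagonal.antidiagonal m, Nf C (p.2 ::ₘ p.1 ::ₘ f) ≤
        fac (X-1) * (hh (X-1) + ((if p.1 = 0 then 1 / (4 * ((X:ℚ)-1)) else 0) + (if p.2 = 0 then 1 / (4 * ((X:ℚ)-1)) else 0))) := by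
      intro p hp
      rw [Finset.HasAntidiagonal.mem_antidiagonal] at hp
      obtain ⟨a, b⟩ := p
      simp only at hp ⊢
      have hw' : wt (b ::ₘ a ::ₘ f) = 3 * (X-1) := by rw [wt_cons, wt_cons]; omega
      have hf0 : f.count 0 = 0 := by
        rw [Multiset.count_eq_zero]; intro h; have := hf _ h; omega
      have hx1 : (0:ℚ) < (X:ℚ) - 1 := by linarith
      have q1 : h1 (X-1) ≤ hh (X-1) + 1 / (4 * ((X:ℚ)-1)) := by
        rw [h1_big (by omega), hh_big (by omega), hX1]
        have : 1/(X-1:ℚ) > 0 := by positivity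
        have e1 : 5 / (18 * ((X:ℚ)-1)) = 5/18 * (1/(X-1:ℚ)) := by field_simp
        have e2 : 1 / (2 * ((X:ℚ)-1)) = 1/2 * (1/(X-1:ℚ)) := by field_simp
        have e3 : 1 / (4 * ((X:ℚ)-1)) = 1/4 * (1/(X-1:ℚ)) := by field_simp
        rw [e1, e2, e3]; linarith
      rcases Nat.eq_zero_or_pos a with ha | ha <;> rcases Nat.eq_zero_or_pos b with hb | hb
      · rw [if_pos ha, if_pos hb]
        refine (ih1 (X-1) (by omega) _ hw').trans ?_
        rw [hh_big (by omega), hX1, div_eq_mul_one_div]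
        refine mul_le_mul_of_nonneg_left ?_ hF.le
        field_simp; linarith
      · rw [if_pos ha, if_neg hb.ne', add_zero]
        refine (ih3 _ hw' ?_).trans (mul_le_mul_of_nonneg_left q1 hF.le)
        rw [ha, Multiset.count_cons_of_ne (by omega), Multiset.count_cons_self, hf0]
      · rw [if_neg ha.ne', if_pos hb, zero_add]
        refine (ih3 _ hw' ?_).trans (mul_le_mul_of_nonneg_left q1 hF.le)
        rw [hb, Multiset.count_cons_self, Multiset.count_cons_of_ne (by omega), hf0]
      · rw [if_neg ha.ne', if_neg hb.ne', add_zero, add_zero]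
        apply ih2 _ hw'
        rw [Multiset.count_cons_of_ne (by omega), Multiset.count_cons_of_ne (by omega), hf0]
    refine (Finset.sum_le_sum this).trans (le_of_eq ?_)
    rw [← Finset.mul_sum, Finset.sum_add_distrib, exc_sum]
    simp only [Finset.sum_const, Finset.Nat.card_antidiagonal, nsmul_eq_mul]
    push_cast
    congr 2
    have hx1 : (X:ℚ) - 1 ≠ 0 := by linarith
    field_simp; norm_num
  have hGG : GG (X-1) = 2 * fac (X-1) / ((X:ℚ) - 2) := by
    rw [eq_div_iff hxq.ne', ← GG_fac (X-1) (by omega), hX1]; ring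
  rw [hGG] at hq
  have hwf : (wt f : ℚ) = 3 * X - 2 * m - 5 := by
    have : ((2 * (m+2) + 1 + wt f : ℕ) : ℚ) = ((3 * X : ℕ) : ℚ) := by rw [hw]
    push_cast at this; linarith
  rw [hwf] at hl
  rw [fac_step X (by omega)]
  have e1 : 12 * ((X:ℚ) - 1) * hh (X-1) + 4 / ((X:ℚ)-1) + 14 / (9 * ((X:ℚ) - 2)) ≤ 12 * ((X:ℚ) - 1) * hh X := by
    rw [hh_big (by omega), hh_big (by omega), hX1]
    obtain ⟨z, hz⟩ : ∃ z : ℚ, (X:ℚ) = 19 + z := ⟨X - 19, by ring⟩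
    have hz0 : 0 ≤ z := by
      have : (19:ℚ) ≤ X := by exact_mod_cast hX
      linarith
    rw [hz]
    have h1 : 19 + z ≠ 0 := by positivity
    have h2 : 19 + z - 1 = 18 + z := by ring
    have h3 : 19 + z - 2 = 17 + z := by ring
    rw [h2, h3]
    have h4 : 18 + z ≠ 0 := by positivity
    have h5 : 17 + z ≠ 0 := by positivity
    rw [← sub_nonneg]
    have : 12 * (18 + z) * (1 / 3 - 1 / (2 * (19 + z))) - (12 * (18 + z) * (1 / 3 - 1 / (2 * (18 + z))) + 4 / (18 + z) + 14 / (9 * (17 + z)))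
       = (4 * (19+z)^2 - 76 * (19+z) + 108) / (9 * (19+z) * (18+z) * (17+z)) := by
      field_simp; ring
    rw [this]
    apply div_nonneg
    · nlinarith
    · positivity
  have e2 := mul_le_mul_of_nonneg_left e1 hF.le
  calc _ ≤ 4 * (3 * (X:ℚ) - 2 * m - 5) * (fac (X-1) * hh (X-1)) + 8 * (fac (X-1) * (((m:ℚ)+1) * hh (X-1) + 1 / (2 * ((X:ℚ)-1))))
        + 2 * fac (X-1) / ((X:ℚ) - 2) / 9 * 7 := by linarith
    _ = fac (X-1) * (12 * ((X:ℚ) - 1) * hh (X-1) + 4 / ((X:ℚ)-1) + 14 / (9 * ((X:ℚ) - 2))) := by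
      have hx1 : (X:ℚ) - 1 ≠ 0 := by linarith
      have hx2 : (X:ℚ) - 2 ≠ 0 := by linarith
      field_simp; ring
    _ ≤ _ := e2
    _ = _ := by push_cast; ring

theorem reduced_split (s : Multiset ℕ) (h1 : 1 ∉ s) : ∃ p e, s = Multiset.replicate p 0 + e ∧ (∀ x ∈ e, 2 ≤ x) ∧ s.count 0 = p
    ∧ wt s = p + wt e := by
  refine ⟨s.count 0, s.filter (fun x => ¬ (x = 0)), ?_, ?_, rfl, ?_⟩
  · conv_lhs => rw [← Multiset.filter_add_not (fun x => x = 0) s, Multiset.filter_eq']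
  · intro x hx
    rw [Multiset.mem_filter] at hx
    have : x ≠ 1 := by rintro rfl; exact h1 hx.1
    have := hx.2
    omega
  · conv_lhs => rw [← Multiset.filter_add_not (fun x => x = 0) s, Multiset.filter_eq', wt_add]
    have : wt (Multiset.replicate (s.count 0) 0) = s.count 0 := by simp [wt]
    rw [this]

theorem cap_aux (hC : IsNormalizedWitten C) (X : ℕ) : ∀ s, wt s = 3 * X →
    (Nf C s ≤ fac X / 3) ∧ (s.count 0 = 0 → Nf C s ≤ fac X * hh X) ∧ (s.count 0 = 1 → Nf C s ≤ fac X * h1 X) := by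
  induction X using Nat.strong_induction_on with
  | _ X ih =>
  intro s hw
  have ih1 : ∀ Y, Y < X → ∀ s, wt s = 3 * Y → Nf C s ≤ fac Y / 3 := fun Y hY s hs => (ih Y hY s hs).1
  have hF := fac_pos X
  rcases Nat.eq_zero_or_pos X with hX0 | hX0
  · have : s = 0 := by
      rw [← Multiset.card_eq_zero]; have := card_le_wt s; omega
    rw [this, N_zero, hX0]
    rw [hX0] at hF
    refine ⟨by positivity, fun _ => ?_, fun _ => ?_⟩
    · refine mul_nonneg hF.le ?_; norm_num [hh]
    · refine mul_nonneg hF.le ?_; norm_num [h1]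
  by_cases h1s : 1 ∈ s
  · obtain ⟨t, rfl⟩ := Multiset.exists_cons_of_mem h1s
    rw [wt_cons] at hw
    rw [Multiset.count_cons_of_ne (by omega), N_one hC]
    by_cases ht : t = 0
    · rw [if_pos ht, ht, wt_zero, N_zero]
      rw [ht, wt_zero] at hw
      obtain rfl : X = 1 := by omega
      norm_num [fac, hh, h1]
    · rw [if_neg ht, add_zero]
      have hw' : wt t = 3 * (X-1) := by omega
      have hpos : 0 < wt t := by
        have := card_le_wt t; have := Multiset.card_pos.2 ht; omega
      obtain ⟨i1, i2, i3⟩ := ih (X-1) (by omega) t hw'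
      have hx : 2 ≤ X := by omega
      have hX1 : ((X-1 : ℕ) : ℚ) = (X:ℚ) - 1 := by rw [Nat.cast_sub (by omega)]; simp
      have hxp : (0:ℚ) < (X:ℚ) - 1 := by
        have : (2:ℚ) ≤ X := by exact_mod_cast hx
        linarith
      have m1 := hh_mono (X-1)
      have m2 := h1_mono (X-1)
      rw [Nat.sub_add_cancel hX0] at m1 m2
      have hF' := fac_pos (X-1)
      rw [hw', fac_step X hx]
      push_cast
      rw [hX1]
      have gen : ∀ b, Nf C t ≤ fac (X-1) * b → 4 * (3 * ((X:ℚ) - 1)) * Nf C t ≤ 12 * ((X:ℚ) - 1) * fac (X-1) * b := by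
        intro b hb
        have := mul_le_mul_of_nonneg_left hb (show 0 ≤ 12 * ((X:ℚ) - 1) by linarith)
        linarith
      refine ⟨?_, fun h => ?_, fun h => ?_⟩
      · have := gen (1/3) (by linarith); linarith
      · exact gen _ ((i2 h).trans (mul_le_mul_of_nonneg_left m1 hF'.le))
      · exact gen _ ((i3 h).trans (mul_le_mul_of_nonneg_left m2 hF'.le))
  obtain ⟨p, e, hse, he, hp, hwp⟩ := reduced_split s h1s
  have he0 : e.count 0 = 0 := by
    rw [Multiset.count_eq_zero]; intro h; have := he _ h; omega
  have A2 : s.count 0 = 0 → Nf C s ≤ fac X * hh X := by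
    intro h0
    have hp0 : p = 0 := by omega
    have hs : s = e := by rw [hse, hp0]; simp
    have hs2 : ∀ x ∈ s, 2 ≤ x := by rw [hs]; exact he
    rcases Nat.lt_or_ge X 19 with h | h
    · obtain ⟨-, t2, t3, -, -⟩ := tab_bound hC s hs2 0 X (by omega) (by omega) (by omega)
      rcases Nat.lt_or_ge X 15 with h' | h'
      · have := t3 rfl (by omega)
        unfold hh; rw [if_pos h']; linarith
      · have := t2 rfl h'
        rw [hh_big h']
        have hx : (0:ℚ) < X := by exact_mod_cast hX0
        have e : fac X * (1/3 - 1/(2*(X:ℚ))) = fac X * (2*X-3) / (6*X) := by field_simp; ring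
        rw [e, le_div_iff₀ (by positivity)]
        exact this
    · exact cap_step hC s X h hw hs2 ih1 (fun t ht => (ih (X-1) (by omega) t ht).2.1) (fun t ht => (ih (X-1) (by omega) t ht).2.2)
  have hX1 : 1 ≤ X → ((X-1 : ℕ) : ℚ) = (X:ℚ) - 1 := by intro h; rw [Nat.cast_sub (by omega)]; simp
  have A3 : s.count 0 = 1 → Nf C s ≤ fac X * h1 X := by
    intro h0
    have hp0 : p = 1 := by omega
    rcases Nat.lt_or_ge X 16 with h | h
    · obtain ⟨-, -, -, t5, -⟩ := tab_bound hC e he 1 X (by omega) (by omega) (by omega)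
      have := t5 rfl (by omega)
      rw [hse, hp0]
      unfold h1; rw [if_pos h]; linarith
    · have hs : s = 0 ::ₘ e := by rw [hse, hp0]; simp
      rw [hs]
      have := str_le hC e (fac (X-1) * hh (X-1)) (by rintro rfl; simp at he0) (by
        intro j hj hj0
        refine (ih (X-1) (by omega) _ ?_).2.1 ?_
        · rw [wt_cons]; have := wt_erase hj; omega
        · have := he j hj
          rw [Multiset.count_cons_of_ne (by omega)]
          have := Multiset.count_le_of_le 0 (Multiset.erase_le j e)
          omega)
      refine this.trans ?_
      rw [he0, fac_step X (by omega), hh_big (by omega), h1_big h, hX1 hX0]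
      have hwe : (wt e : ℚ) = 3 * X - 1 := by
        have : ((p + wt e : ℕ) : ℚ) = ((3 * X : ℕ) : ℚ) := by rw [← hwp, hw]
        rw [hp0] at this
        push_cast at this; linarith
      rw [hwe]
      have hx : (16:ℚ) ≤ X := by exact_mod_cast h
      have hF' := fac_pos (X-1)
      have hx1 : (0:ℚ) < (X:ℚ) - 1 := by linarith
      have hx0 : (0:ℚ) < (X:ℚ) := by linarith
      have e2 : 4 * (3 * (X:ℚ) - 1) * (1/3 - 1/(2*((X:ℚ)-1))) ≤ 12 * ((X:ℚ)-1) * (1/3 - 5/(18*X)) := by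
        rw [← sub_nonneg]
        have : 12 * ((X:ℚ)-1) * (1/3 - 5/(18*X)) - 4 * (3 * (X:ℚ) - 1) * (1/3 - 1/(2*((X:ℚ)-1)))
          = (22 * X - 10) / (3 * X * (X - 1)) := by field_simp; ring
        rw [this]
        apply div_nonneg
        · linarith
        · positivity
      have e3 := mul_le_mul_of_nonneg_left e2 hF'.le
      push_cast
      linarith
  refine ⟨?_, A2, A3⟩
  have lift : ∀ b, b ≤ 1/3 → Nf C s ≤ fac X * b → Nf C s ≤ fac X / 3 := by
    intro b hb h
    have := mul_le_mul_of_nonneg_left hb hF.le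
    linarith
  rcases Nat.lt_or_ge p 2 with h2 | h2
  · rcases Nat.eq_zero_or_pos p with h3 | h3
    · exact lift _ (hh_le X) (A2 (by omega))
    · exact lift _ (h1_le X) (A3 (by omega))
  obtain ⟨p, rfl⟩ : ∃ p', p = p' + 1 := ⟨p - 1, by omega⟩
  have hs : s = 0 ::ₘ (Multiset.replicate p 0 + e) := by rw [hse, Multiset.replicate_succ, Multiset.cons_add]
  set t := Multiset.replicate p 0 + e with ht
  have htc : t.count 0 = p := by rw [ht, Multiset.count_add, he0]; simp
  have htw : 1 + wt t = 3 * X := by rw [← hw, hs, wt_cons]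
  have htq : (wt t : ℚ) = 3 * X - 1 := by
    have : ((1 + wt t : ℕ) : ℚ) = ((3 * X : ℕ) : ℚ) := by rw [htw]
    push_cast at this; linarith
  have hF' := fac_pos (X-1)
  have ht1 : ∀ j ∈ t, j ≠ 0 → 2 ≤ j := by
    intro j hj hj0
    rw [ht, Multiset.mem_add] at hj
    rcases hj with hj | hj
    · exact absurd (Multiset.eq_of_mem_replicate hj) hj0
    · exact he j hj
  rcases Nat.eq_or_lt_of_le h2 with h3 | h3
  · have hp1 : p = 1 := by omega
    rcases Nat.lt_or_ge X 19 with h | h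
    · obtain ⟨t1, -⟩ := tab_bound hC e he 2 X (by omega) (by omega) (by omega)
      rw [hse, ← h3]; linarith
    · rw [hs]
      have := str_le hC t (fac (X-1) * h1 (X-1)) (by intro hh; rw [hh] at htc; simp at htc; omega) (by
        intro j hj hj0
        refine (ih (X-1) (by omega) _ ?_).2.2 ?_
        · rw [wt_cons]; have := wt_erase hj; omega
        · have := ht1 j hj hj0
          rw [Multiset.count_cons_of_ne (by omega), Multiset.count_erase_of_ne (by omega)]
          omega)
      refine this.trans ?_
      rw [htc, htq, fac_step X (by omega), h1_big (by omega), hX1 hX0, hp1]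
      have hx : (19:ℚ) ≤ X := by exact_mod_cast h
      have hx1 : (0:ℚ) < (X:ℚ) - 1 := by linarith
      have e2 : 4 * (3 * (X:ℚ) - 1 - 1) * (1/3 - 5/(18*((X:ℚ)-1))) ≤ 12 * ((X:ℚ)-1) / 3 := by
        rw [← sub_nonneg]
        have : 12 * ((X:ℚ)-1) / 3 - 4 * (3 * (X:ℚ) - 1 - 1) * (1/3 - 5/(18*((X:ℚ)-1)))
          = (18 * X - 8) / (9 * (X - 1)) := by field_simp; ring
        rw [this]
        apply div_nonneg
        · linarith
        · positivity
      have e3 := mul_le_mul_of_nonneg_left e2 hF'.le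
      push_cast
      linarith
  · rw [hs]
    by_cases ht0 : t = {0, 0}
    · rw [N_str hC, ht0]
      have : wt t = 2 := by rw [ht0]; rfl
      obtain rfl : X = 1 := by omega
      norm_num [dn, E0, fac]
    have hX2 : 2 ≤ X := by
      by_contra hc
      obtain rfl : X = 1 := by omega
      apply ht0
      have h4 : wt t = p + wt e := by rw [ht, wt_add]; congr 1; simp [wt]
      have hp2 : p = 2 := by omega
      have : e = 0 := by
        rw [← Multiset.card_eq_zero]; have := card_le_wt e; omega
      rw [ht, hp2, this]; rfl
    have := str_le hC t (fac (X-1) / 3) ht0 (by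
        intro j hj hj0
        refine (ih (X-1) (by omega) _ ?_).1
        rw [wt_cons]; have := wt_erase hj; omega)
    refine this.trans ?_
    rw [htc, htq, fac_step X hX2]
    have hp2 : (2:ℚ) ≤ p := by exact_mod_cast (by omega : 2 ≤ p)
    have e2 : 4 * (3 * (X:ℚ) - 1 - p) ≤ 12 * ((X:ℚ)-1) := by linarith
    have e3 := mul_le_mul_of_nonneg_left e2 hF'.le
    linarith

/-- `C ≤ 1/3`. -/
theorem cap (hC : IsNormalizedWitten C) (s : Multiset ℕ) (X : ℕ) (h : wt s = 3 * X) : Nf C s ≤ fac X / 3 :=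
  (cap_aux hC X s h).1

end WittenAsym

set_option autoImplicit false
namespace WittenAsym
open Alg
variable {C : List ℕ → ℚ}

/-! ### Lower bounds -/

theorem count_cons_le (a b : ℕ) (s : Multiset ℕ) : (a ::ₘ s).count b ≤ s.count b + 1 := by
  rw [Multiset.count_cons]; split_ifs <;> omega

theorem floor0 (hC : IsNormalizedWitten C) (X : ℕ) : ∀ s, s.count 0 ≤ 2 → 10 + s.count 1 ≤ X → wt s = 3 * X →
    289 / 1000 * fac X ≤ Nf C s := by
  induction X using Nat.strong_induction_on with
  | _ X ih =>
  intro s h0 h1 hw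
  have hX1 : ((X-1 : ℕ) : ℚ) = (X:ℚ) - 1 := by rw [Nat.cast_sub (by omega)]; simp
  have hxp : (9:ℚ) ≤ (X:ℚ) - 1 := by
    have : (10:ℚ) ≤ X := by exact_mod_cast (by omega : 10 ≤ X)
    linarith
  have hF' := fac_pos (X-1)
  have hst := fac_step X (by omega)
  by_cases h1s : 1 ∈ s
  · obtain ⟨t, rfl⟩ := Multiset.exists_cons_of_mem h1s
    rw [wt_cons] at hw
    rw [Multiset.count_cons_of_ne (by omega)] at h0
    rw [Multiset.count_cons_self] at h1
    have := ih (X-1) (by omega) t h0 (by omega) (by omega)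
    rw [N_one hC, hst, show wt t = 3 * (X-1) by omega]
    push_cast
    rw [hX1]
    have h2 := mul_le_mul_of_nonneg_left this (show 0 ≤ 12 * ((X:ℚ) - 1) by linarith)
    split_ifs <;> linarith
  rcases Nat.lt_or_ge X 13 with h13 | h13
  · obtain ⟨p, e, hse, he, hp, hwp⟩ := reduced_split s h1s
    obtain ⟨-, -, -, -, t⟩ := tab_bound hC e he p X (by omega) (by omega) (by omega)
    have := t (by omega) (by omega)
    rw [hse]; linarith
  have h1c : s.count 1 = 0 := Multiset.count_eq_zero.2 h1s
  by_cases h0s : 0 ∈ s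
  · obtain ⟨t, rfl⟩ := Multiset.exists_cons_of_mem h0s
    rw [wt_cons] at hw
    rw [Multiset.count_cons_self] at h0
    rw [Multiset.count_cons_of_ne (by omega)] at h1c
    have := str_ge hC t (289/1000 * fac (X-1)) (by
      intro j hj hj0
      have hj1 : j ≠ 1 := by rintro rfl; exact absurd h1c (Multiset.count_ne_zero.2 hj)
      apply ih (X-1) (by omega)
      · rw [Multiset.count_cons_of_ne (by omega), Multiset.count_erase_of_ne (by omega)]; omega
      · have := count_cons_le (j-1) 1 (t.erase j)
        rw [Multiset.count_erase_of_ne (by omega)] at this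
        omega
      · rw [wt_cons]; have := wt_erase hj; omega)
    refine le_trans ?_ this
    have hwt : (wt t : ℚ) = 3 * X - 1 := by
      have : ((2 * 0 + 1 + wt t : ℕ) : ℚ) = ((3 * X : ℕ) : ℚ) := by rw [hw]
      push_cast at this; linarith
    rw [hwt, hst]
    have hc : (t.count 0 : ℚ) ≤ 1 := by exact_mod_cast (by omega : t.count 0 ≤ 1)
    have e2 : 12 * ((X:ℚ)-1) ≤ 4 * (3 * (X:ℚ) - 1 - t.count 0) := by linarith
    have e3 := mul_le_mul_of_nonneg_right e2 hF'.le
    linarith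
  · have hs0 : s ≠ 0 := by rintro rfl; rw [wt_zero] at hw; omega
    obtain ⟨d, hd⟩ := Multiset.exists_mem_of_ne_zero hs0
    obtain ⟨f, rfl⟩ := Multiset.exists_cons_of_mem hd
    have hd0 : d ≠ 0 := by rintro rfl; exact h0s hd
    have hd1 : d ≠ 1 := by rintro rfl; exact h1s hd
    obtain ⟨m, rfl⟩ : ∃ m, d = m + 2 := ⟨d - 2, by omega⟩
    rw [wt_cons] at hw
    have f0 : f.count 0 = 0 := Multiset.count_eq_zero.2 (fun h => h0s (Multiset.mem_cons_of_mem h))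
    have f1 : f.count 1 = 0 := Multiset.count_eq_zero.2 (fun h => h1s (Multiset.mem_cons_of_mem h))
    rw [N_big hC]
    have hq : 0 ≤ ∑ p ∈ Finset.HasAntidiagonal.antidiagonal m, (sh p.1 (Nf C) * sh p.2 (Nf C)) f := by
      apply Finset.sum_nonneg
      intro p _
      apply mul_nonneg_of
      intro q _
      exact mul_nonneg (N_nonneg hC _) (N_nonneg hC _)
    have hl : 4 * (wt f : ℚ) * (289/1000 * fac (X-1)) ≤
        (f.map fun j : ℕ => 4 * (2 * (j:ℚ) + 1) * Nf C ((j + (m+1)) ::ₘ f.erase j)).sum := by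
      rw [← sum_lin]
      apply Multiset.sum_map_le_sum_map
      intro j hj
      refine mul_le_mul_of_nonneg_left ?_ (by positivity)
      have hle0 := Multiset.count_le_of_le 0 (Multiset.erase_le j f)
      have hle1 := Multiset.count_le_of_le 1 (Multiset.erase_le j f)
      have c0 := count_cons_le (j + (m+1)) 0 (f.erase j)
      have c1 := count_cons_le (j + (m+1)) 1 (f.erase j)
      apply ih (X-1) (by omega)
      · omega
      · omega
      · rw [wt_cons]; have := wt_erase hj; omega
    have hm : ((m:ℚ)+1) * (289/1000 * fac (X-1)) ≤ ∑ p ∈ Finset.HasAntidiagonal.antidiagonal m, Nf C (p.2 ::ₘ p.1 ::ₘ f) := by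
      have : ∑ p ∈ Finset.HasAntidiagonal.antidiagonal m, (289/1000 * fac (X-1)) = ((m:ℚ)+1) * (289/1000 * fac (X-1)) := by
        simp only [Finset.sum_const, Finset.Nat.card_antidiagonal, nsmul_eq_mul]; push_cast; rfl
      rw [← this]
      apply Finset.sum_le_sum
      intro p hp
      rw [Finset.HasAntidiagonal.mem_antidiagonal] at hp
      have c0 := count_cons_le p.2 0 (p.1 ::ₘ f)
      have c1 := count_cons_le p.2 1 (p.1 ::ₘ f)
      have c2 := count_cons_le p.1 0 f
      have c3 := count_cons_le p.1 1 f
      apply ih (X-1) (by omega)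
      · omega
      · omega
      · rw [wt_cons, wt_cons]; omega
    have hwf : (wt f : ℚ) = 3 * X - 2 * m - 5 := by
      have : ((2 * (m+2) + 1 + wt f : ℕ) : ℚ) = ((3 * X : ℕ) : ℚ) := by rw [hw]
      push_cast at this; linarith
    rw [hwf] at hl
    rw [hst]
    linarith

/-- adding one more zero -/
theorem zstep (hC : IsNormalizedWitten C) (p X : ℕ) (hX : 3 ≤ X) (b : ℚ)
    (ha : ∀ s, 1 ∉ s → s.count 0 = p → wt s = 3 * (X-1) → b * fac (X-1) ≤ Nf C s)
    (hb : ∀ s, 1 ∉ s → s.count 0 = p → wt s = 3 * (X-2) → b * fac (X-2) ≤ Nf C s)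
    (s : Multiset ℕ) (h1 : 1 ∉ s) (h0 : s.count 0 = p + 1) (hw : wt s = 3 * X) :
    b * (1 - ((p:ℚ) - 2) / (3 * ((X:ℚ)-1))) * fac X ≤ Nf C s := by
  have h0s : 0 ∈ s := by rw [← Multiset.count_pos]; omega
  obtain ⟨t, rfl⟩ := Multiset.exists_cons_of_mem h0s
  rw [wt_cons] at hw
  rw [Multiset.count_cons_self] at h0
  have h1c : 1 ∉ t := fun h => h1 (Multiset.mem_cons_of_mem h)
  have hx : (3:ℚ) ≤ X := by exact_mod_cast hX
  have := str_ge hC t (b * fac (X-1)) (by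
    intro j hj hj0
    have hj1 : j ≠ 1 := by rintro rfl; exact absurd hj h1c
    have h1e : 1 ∉ t.erase j := fun h => h1c (Multiset.mem_of_mem_erase h)
    have hwe := wt_erase hj
    have hce : (t.erase j).count 0 = p := by rw [Multiset.count_erase_of_ne (by omega)]; omega
    by_cases hj2 : j = 2
    · have h4 := hb (t.erase j) h1e hce (by omega)
      rw [hj2] at hwe h4 ⊢
      show _ ≤ Nf C (1 ::ₘ _)
      rw [N_one hC, show wt (t.erase 2) = 3 * (X-2) by omega]
      have hX2 : ((X-2 : ℕ) : ℚ) = (X:ℚ) - 2 := by rw [Nat.cast_sub (by omega)]; simp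
      have hX1 : ((X-1 : ℕ) : ℚ) = (X:ℚ) - 1 := by rw [Nat.cast_sub (by omega)]; simp
      have h5 : fac (X-1) = 12 * ((X:ℚ)-2) * fac (X-2) := by
        rw [fac_step (X-1) (by omega), hX1, show X - 1 - 1 = X - 2 by omega]; ring
      rw [h5]
      push_cast
      rw [hX2]
      have h2 := mul_le_mul_of_nonneg_left h4 (show 0 ≤ 12 * ((X:ℚ) - 2) by linarith)
      split_ifs <;> linarith
    · apply ha
      · rw [Multiset.mem_cons]
        rintro (h | h)
        · omega
        · exact h1e h
      · rw [Multiset.count_cons_of_ne (by omega), hce]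
      · rw [wt_cons]; omega)
  refine le_trans (le_of_eq ?_) this
  have hwt : (wt t : ℚ) = 3 * X - 1 := by
    have : ((2 * 0 + 1 + wt t : ℕ) : ℚ) = ((3 * X : ℕ) : ℚ) := by rw [hw]
    push_cast at this; linarith
  have hp : t.count 0 = p := by omega
  rw [hwt, hp, fac_step X (by omega)]
  have : (X:ℚ) - 1 ≠ 0 := by linarith
  field_simp; ring

theorem floor3 (hC : IsNormalizedWitten C) (X : ℕ) (hX : 12 ≤ X) (s : Multiset ℕ) (h1 : 1 ∉ s) (h0 : s.count 0 = 3)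
    (hw : wt s = 3 * X) : 289/1000 * fac X ≤ Nf C s := by
  have := zstep hC 2 X (by omega) (289/1000)
    (fun s h1 h0 hw => floor0 hC (X-1) s (by omega) (by rw [Multiset.count_eq_zero.2 h1]; omega) hw)
    (fun s h1 h0 hw => floor0 hC (X-2) s (by omega) (by rw [Multiset.count_eq_zero.2 h1]; omega) hw) s h1 h0 hw
  norm_num at this ⊢
  exact this

theorem floor4 (hC : IsNormalizedWitten C) (X : ℕ) (hX : 14 ≤ X) (s : Multiset ℕ) (h1 : 1 ∉ s) (h0 : s.count 0 = 4)
    (hw : wt s = 3 * X) : 289/1000 * (1 - 1 / (3 * ((X:ℚ)-1))) * fac X ≤ Nf C s := by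
  have := zstep hC 3 X (by omega) (289/1000) (floor3 hC (X-1) (by omega)) (floor3 hC (X-2) (by omega)) s h1 h0 hw
  norm_num at this ⊢
  exact this

theorem prod_lb (a b c d : ℚ) (ha : 0 < a) (hab : a ≤ b) (hc : 0 ≤ c) (hd : 0 ≤ d) : 1 - (c + d) / a ≤ (1 - c / a) * (1 - d / b) := by
  have h1 : d / b ≤ d / a := by gcongr
  have h2 : 0 ≤ c / a * (d / b) := by
    have : 0 < b := by linarith
    positivity
  have h3 : (c + d) / a = c / a + d / a := add_div _ _ _
  nlinarith

theorem mono_lb (a b c : ℚ) (ha : 0 < a) (hab : a ≤ b) (hc : 0 ≤ c) :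
    289/1000 * (1 - c / a) ≤ 289/1000 * (1 - c / b) := by
  have : c / b ≤ c / a := by gcongr
  linarith

theorem floor5 (hC : IsNormalizedWitten C) (X : ℕ) (hX : 16 ≤ X) (s : Multiset ℕ) (h1 : 1 ∉ s) (h0 : s.count 0 = 5)
    (hw : wt s = 3 * X) : 289/1000 * (1 - 1 / ((X:ℚ)-3)) * fac X ≤ Nf C s := by
  have hx : (16:ℚ) ≤ X := by exact_mod_cast hX
  have := zstep hC 4 X (by omega) (289/1000 * (1 - (1/3) / ((X:ℚ)-3))) (fun s h1 h0 hw => by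
      refine le_trans (mul_le_mul_of_nonneg_right ?_ (fac_pos _).le) (floor4 hC (X-1) (by omega) s h1 h0 hw)
      rw [Nat.cast_sub (by omega), ← div_div 1 3]
      push_cast
      exact mono_lb _ _ _ (by linarith) (by linarith) (by norm_num)) (fun s h1 h0 hw => by
      refine le_trans (mul_le_mul_of_nonneg_right ?_ (fac_pos _).le) (floor4 hC (X-2) (by omega) s h1 h0 hw)
      rw [Nat.cast_sub (by omega), ← div_div 1 3]
      push_cast
      exact mono_lb _ _ _ (by linarith) (by linarith) (by norm_num)) s h1 h0 hw
  refine le_trans (mul_le_mul_of_nonneg_right ?_ (fac_pos _).le) this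
  rw [mul_assoc]
  refine mul_le_mul_of_nonneg_left ?_ (by norm_num)
  have := prod_lb ((X:ℚ)-3) ((X:ℚ)-1) (1/3) (2/3) (by linarith) (by linarith) (by norm_num) (by norm_num)
  have e : (((4:ℕ):ℚ) - 2) / (3 * ((X:ℚ) - 1)) = 2/3 / ((X:ℚ)-1) := by
    have : (X:ℚ) - 1 ≠ 0 := by linarith
    field_simp; norm_num
  rw [e]
  refine le_trans (le_of_eq ?_) this
  norm_num

theorem floor6 (hC : IsNormalizedWitten C) (X : ℕ) (hX : 18 ≤ X) (s : Multiset ℕ) (h1 : 1 ∉ s) (h0 : s.count 0 = 6)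
    (hw : wt s = 3 * X) : 289/1000 * (1 - 2 / ((X:ℚ)-5)) * fac X ≤ Nf C s := by
  have hx : (18:ℚ) ≤ X := by exact_mod_cast hX
  have := zstep hC 5 X (by omega) (289/1000 * (1 - 1 / ((X:ℚ)-5))) (fun s h1 h0 hw => by
      refine le_trans (mul_le_mul_of_nonneg_right ?_ (fac_pos _).le) (floor5 hC (X-1) (by omega) s h1 h0 hw)
      rw [Nat.cast_sub (by omega)]
      push_cast
      exact mono_lb _ _ _ (by linarith) (by linarith) (by norm_num)) (fun s h1 h0 hw => by
      refine le_trans (mul_le_mul_of_nonneg_right ?_ (fac_pos _).le) (floor5 hC (X-2) (by omega) s h1 h0 hw)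
      rw [Nat.cast_sub (by omega)]
      push_cast
      exact mono_lb _ _ _ (by linarith) (by linarith) (by norm_num)) s h1 h0 hw
  refine le_trans (mul_le_mul_of_nonneg_right ?_ (fac_pos _).le) this
  rw [mul_assoc]
  refine mul_le_mul_of_nonneg_left ?_ (by norm_num)
  have := prod_lb ((X:ℚ)-5) ((X:ℚ)-1) 1 1 (by linarith) (by linarith) (by norm_num) (by norm_num)
  have e : (((5:ℕ):ℚ) - 2) / (3 * ((X:ℚ) - 1)) = 1 / ((X:ℚ)-1) := by
    have : (X:ℚ) - 1 ≠ 0 := by linarith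
    field_simp; norm_num
  rw [e]
  norm_num at this ⊢
  exact this

end WittenAsym

set_option autoImplicit false
namespace WittenAsym
open Alg
variable {C : List ℕ → ℚ}

/-! ### Bounds for products -/

/-- inverse binomial coefficient, cut off after the middle -/
def bz (N : ℕ) (j : ℕ → ℕ) (k : ℕ) : ℚ :=
  if k = 0 then 0 else if 2 * j k ≤ N then 1 / (N.choose (j k) : ℚ) else 0

theorem bz_nonneg (N : ℕ) (j : ℕ → ℕ) (k : ℕ) : 0 ≤ bz N j k := by
  unfold bz; split_ifs <;> positivity

/-- weighted sums of inverse binomial coefficients -/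
def tt (j : ℕ → ℕ) (n N : ℕ) : ℚ := ∑ k ∈ Finset.range (n + 1), (n.choose k : ℚ) * bz N j k

theorem choose_mono_half (N : ℕ) {a b : ℕ} (hab : a ≤ b) (hb : 2 * b ≤ N) : N.choose a ≤ N.choose b := by
  induction b, hab using Nat.le_induction with
  | base => exact le_rfl
  | succ b hab ih =>
    exact (ih (by omega)).trans (Nat.choose_le_succ_of_lt_half_left (by omega))

theorem inv_choose_le (N : ℕ) {a b : ℕ} (hab : a ≤ b) (hb : 2 * b ≤ N) :
    1 / (N.choose b : ℚ) ≤ 1 / (N.choose a : ℚ) := by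
  apply one_div_le_one_div_of_le
  · exact_mod_cast Nat.choose_pos (by omega)
  · exact_mod_cast choose_mono_half N hab hb

theorem tt_mono (j : ℕ → ℕ) (N : ℕ) {n m : ℕ} (h : n ≤ m) : tt j n N ≤ tt j m N := by
  unfold tt
  refine (Finset.sum_le_sum (f := fun k => (n.choose k : ℚ) * bz N j k) (g := fun k => (m.choose k : ℚ) * bz N j k) ?_).trans ?_
  · intro k _
    apply mul_le_mul_of_nonneg_right _ (bz_nonneg _ _ _)
    exact_mod_cast Nat.choose_le_choose k h
  · apply Finset.sum_le_sum_of_subset_of_nonneg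
    · intro k; simp only [Finset.mem_range]; omega
    · intro k _ _; have := bz_nonneg N j k; positivity

theorem S_closed (n : ℕ) : ∀ D r : ℕ, r ≤ D → ∑ k ∈ Finset.range (n + 1), (n.choose k : ℚ) * (1 / ((n + D).choose (k + r) : ℚ))
    = ((n:ℚ) + D + 1) / (((D:ℚ) + 1) * (D.choose r : ℚ)) := by
  induction n with
  | zero =>
    intro D r h
    have : (D.choose r : ℚ) ≠ 0 := by exact_mod_cast (Nat.choose_pos h).ne'
    have : (D:ℚ) + 1 ≠ 0 := by positivity
    simp; field_simp
  | succ n ih =>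
    intro D r h
    rw [choose_rec (fun k => 1 / ((n + 1 + D).choose (k + r) : ℚ))]
    have e1 := ih (D+1) r (by omega)
    have e2 := ih (D+1) (r+1) (by omega)
    rw [show n + (D+1) = n + 1 + D by ring] at e1 e2
    have e3 : ∀ k, k + 1 + r = k + (r + 1) := by intro k; ring
    simp only [e3]
    rw [e1, e2]
    have c0 : (0:ℚ) < (D.choose r : ℚ) := by exact_mod_cast (Nat.choose_pos h)
    have c1 : (0:ℚ) < ((D+1).choose r : ℚ) := by exact_mod_cast (Nat.choose_pos (by omega))
    have c2 : (0:ℚ) < ((D+1).choose (r+1) : ℚ) := by exact_mod_cast (Nat.choose_pos (by omega))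
    have q1 : ((D:ℚ)+1) * (D.choose r : ℚ) = ((D+1).choose (r+1) : ℚ) * (r+1) := by
      exact_mod_cast Nat.add_one_mul_choose_eq D r
    have q2 : (D.choose r : ℚ) * ((D:ℚ)+1) = ((D+1).choose r : ℚ) * ((D:ℚ)+1-r) := by
      have := Nat.choose_mul_succ_eq D r
      have h2 : (((D.choose r * (D+1) : ℕ)) : ℚ) = (((D+1).choose r * (D+1-r) : ℕ) : ℚ) := by rw [this]
      rw [Nat.cast_mul, Nat.cast_mul, Nat.cast_sub (by omega)] at h2
      push_cast at h2
      exact h2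
    have hr : (0:ℚ) < (D:ℚ)+1-r := by
      have : (r:ℚ) ≤ D := by exact_mod_cast h
      linarith
    have i1 : 1 / ((D+1).choose r : ℚ) = ((D:ℚ)+1-r) / ((D.choose r : ℚ) * ((D:ℚ)+1)) := by
      rw [q2]; field_simp
    have i2 : 1 / ((D+1).choose (r+1) : ℚ) = ((r:ℚ)+1) / (((D:ℚ)+1) * (D.choose r : ℚ)) := by
      rw [q1]; field_simp
    push_cast
    have hD : (0:ℚ) < (D:ℚ)+1+1 := by positivity
    have a1 : ((n:ℚ) + (D + 1) + 1) / (((D:ℚ) + 1 + 1) * ((D+1).choose r : ℚ)) = ((n:ℚ) + (D + 1) + 1) / ((D:ℚ) + 1 + 1) * (1 / ((D+1).choose r : ℚ)) := by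
      field_simp
    have a2 : ((n:ℚ) + (D + 1) + 1) / (((D:ℚ) + 1 + 1) * ((D+1).choose (r+1) : ℚ)) = ((n:ℚ) + (D + 1) + 1) / ((D:ℚ) + 1 + 1) * (1 / ((D+1).choose (r+1) : ℚ)) := by
      field_simp
    rw [a1, a2, i1, i2]
    field_simp
    ring

theorem tt_le (j : ℕ → ℕ) (r n D : ℕ) (hr : r ≤ D) (hj : ∀ k, 1 ≤ k → k + r ≤ j k) :
    tt j n (n + D) ≤ ((n:ℚ) + D + 1) / (((D:ℚ) + 1) * (D.choose r : ℚ)) := by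
  rw [← S_closed n D r hr]
  unfold tt
  apply Finset.sum_le_sum
  intro k hk
  refine mul_le_mul_of_nonneg_left ?_ (by positivity)
  unfold bz
  split_ifs with h0 h1
  · positivity
  · exact inv_choose_le _ (hj k (by omega)) h1
  · positivity

/-- Bound data for a function on reduced multisets. -/
def Bd (φ : Alg) (A : ℕ) (j : ℕ → ℕ) (α : ℚ) : Prop :=
  ∀ I : Multiset ℕ, (∀ x ∈ I, 2 ≤ x) → 0 ≤ φ I ∧ (φ I = 0 ∨ (1 ≤ Multiset.card I ∧
    ∃ i, 3 * (i + 1) = wt I + A ∧ j (Multiset.card I) ≤ i ∧ φ I ≤ α * fac (i + 1)))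

theorem inv_split (N i l : ℕ) (jA jB : ℕ → ℕ) (k : ℕ) (hk : 1 ≤ k) (hl : 1 ≤ l) (hiN : i ≤ N) (h1 : jA k ≤ i) (h2 : jB l ≤ N - i) :
    1 / (N.choose i : ℚ) ≤ bz N jA k + bz N jB l := by
  rcases Nat.lt_or_ge N (2 * i) with h | h
  · have h3 : 1 / (N.choose i : ℚ) ≤ bz N jB l := by
      unfold bz
      rw [if_neg (by omega), if_pos (by omega), ← Nat.choose_symm hiN]
      exact inv_choose_le N h2 (by omega)
    have := bz_nonneg N jA k
    linarith
  · have h3 : 1 / (N.choose i : ℚ) ≤ bz N jA k := by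
      unfold bz
      rw [if_neg (by omega), if_pos (by omega)]
      exact inv_choose_le N h1 (by omega)
    have := bz_nonneg N jB l
    linarith

theorem Bd_mul {φ ψ : Alg} {A A' : ℕ} {j j' : ℕ → ℕ} {α β : ℚ} (hφ : Bd φ A j α) (hψ : Bd ψ A' j' β) (hα : 0 ≤ α) (hβ : 0 ≤ β)
    (s : Multiset ℕ) (hs : ∀ x ∈ s, 2 ≤ x) (N : ℕ) (hN : 3 * (N + 2) = wt s + A + A') :
    (φ * ψ) s ≤ α * β * GG (N + 2) * (tt j (Multiset.card s) N + tt j' (Multiset.card s) N) := by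
  set n := Multiset.card s with hn
  have hG := GG_pos (N+2)
  have h := split_le φ ψ s (fun k => α * β * GG (N+2) * ((n.choose k : ℚ) * bz N j k + (n.choose (n-k) : ℚ) * bz N j' (n-k))) (by
    intro I J hIJ
    rw [← hn]
    have hcf : Multiset.card I + Multiset.card J = n := by rw [hn, ← hIJ]; simp
    have hwf : wt I + wt J = wt s := by rw [← hIJ, wt_add]
    obtain ⟨p1, p2⟩ := hφ I (fun x hx => hs x (by rw [← hIJ]; exact Multiset.mem_add.2 (Or.inl hx)))
    obtain ⟨q1, q2⟩ := hψ J (fun x hx => hs x (by rw [← hIJ]; exact Multiset.mem_add.2 (Or.inr hx)))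
    have b1 := bz_nonneg N j (Multiset.card I)
    have b2 := bz_nonneg N j' (n - Multiset.card I)
    have hB : 0 ≤ α * β * GG (N+2) * ((n.choose (Multiset.card I) : ℚ) * bz N j (Multiset.card I) + (n.choose (n-Multiset.card I) : ℚ) * bz N j' (n-Multiset.card I)) := by
      positivity
    rcases p2 with p2 | ⟨hk, i, hi, hji, p3⟩
    · rw [p2]; simpa using hB
    rcases q2 with q2 | ⟨hl, i', hi', hji', q3⟩
    · rw [q2]; simpa using hB
    have hii : i + i' = N := by omega
    have hck : n.choose (n - Multiset.card I) = n.choose (Multiset.card I) := Nat.choose_symm (by omega)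
    have hnl : n - Multiset.card I = Multiset.card J := by omega
    rw [hck, hnl]
    have hinv := inv_split N i (Multiset.card J) j j' (Multiset.card I) hk hl (by omega) hji (by omega)
    have hf := fac_mul i i'
    rw [hii] at hf
    have hcp : (0:ℚ) < (N.choose i : ℚ) := by exact_mod_cast Nat.choose_pos (by omega)
    have hpr : φ I * ψ J ≤ α * β * GG (N+2) * (1 / (N.choose i : ℚ)) := by
      have : φ I * ψ J ≤ α * fac (i+1) * (β * fac (i'+1)) :=
        mul_le_mul p3 q3 q1 (by have := fac_pos (i+1); positivity)
      refine this.trans (le_of_eq ?_)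
      rw [← hf]; field_simp
    have h5 : φ I * ψ J ≤ α * β * GG (N+2) * (bz N j (Multiset.card I) + bz N j' (Multiset.card J)) :=
      hpr.trans (mul_le_mul_of_nonneg_left hinv (by positivity))
    have h6 := mul_le_mul_of_nonneg_right h5 (show (0:ℚ) ≤ (n.choose (Multiset.card I) : ℚ) by positivity)
    refine h6.trans (le_of_eq ?_)
    ring)
  refine h.trans (le_of_eq ?_)
  rw [← hn, ← Finset.mul_sum, Finset.sum_add_distrib]
  congr 2
  unfold tt
  rw [← Finset.sum_range_reflect]
  apply Finset.sum_congr rfl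
  intro k hk
  rw [Finset.mem_range] at hk
  rw [show n - (n + 1 - 1 - k) = k by omega]

theorem Bd_basic (hC : IsNormalizedWitten C) (φ : Alg) (c : Multiset ℕ) (A : ℕ) (j : ℕ → ℕ) (hφ : ∀ I, φ I = Nf C (c + I))
    (hA : wt c = A) (hA3 : A % 3 ≠ 0)
    (hj : ∀ k i, 1 ≤ k → 5 * k + A ≤ 3 * (i + 1) → Multiset.card c + k ≤ i + 3 → j k ≤ i) : Bd φ A j (1/3) := by
  intro I hI
  rw [hφ]
  refine ⟨N_nonneg hC _, ?_⟩
  by_cases h : IG (c + I)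
  swap
  · left; exact N_vanish hC h
  right
  have h' := IG_dvd h
  obtain ⟨h1, h2⟩ := IG_iff'.1 h
  have hc := cap hC (c + I) _ h'
  rw [wt_add, hA] at h' h1 h2
  rw [Multiset.card_add] at h2
  have hwc := wt_ge_card 2 I hI
  have hc1 : 1 ≤ Multiset.card I := by
    by_contra h0
    have : I = 0 := Multiset.card_eq_zero.1 (by omega)
    rw [this, wt_zero] at h1
    omega
  obtain ⟨i, hi⟩ : ∃ i, XM (c + I) = i + 1 := ⟨XM (c + I) - 1, by omega⟩
  rw [hi] at h' hc
  refine ⟨hc1, i, by omega, hj _ i hc1 (by omega) (by omega), by linarith⟩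

/-- index functions -/
def jA (k : ℕ) : ℕ := (5 * k + 4) / 3
/-- index functions -/
def jB (k : ℕ) : ℕ := (5 * k + 6) / 3
/-- index functions -/
def jU (k : ℕ) : ℕ := max ((5 * k + 6) / 3) (k + 4)
/-- index functions -/
def j0 (k : ℕ) : ℕ := (5 * k + 1) / 3
/-- index functions -/
def jZ (k : ℕ) : ℕ := (5 * k + 9) / 3

theorem rho_le (n N : ℕ) (h1 : 1 ≤ n) (h : 5 * n + 4 ≤ 3 * N) : tt jA n N ≤ ((N:ℚ) + 1) / 56 := by
  obtain ⟨D, rfl⟩ : ∃ D, N = n + D := ⟨N - n, by omega⟩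
  rcases Nat.lt_or_ge D 5 with hD | hD
  · have hn : n ≤ 4 := by omega
    interval_cases n <;> interval_cases D <;> first | omega | (norm_num [tt, Finset.sum_range_succ, bz, jA, Nat.choose])
  · refine (tt_le jA 2 n D (by omega) (by intro k hk; unfold jA; omega)).trans ?_
    rw [Nat.cast_choose_two]
    push_cast
    have hd : (5:ℚ) ≤ D := by exact_mod_cast hD
    apply div_le_div_of_nonneg_left
    · positivity
    · norm_num
    · have : (0:ℚ) ≤ (D:ℚ) * (D - 1) := by nlinarith
      nlinarith

theorem Bd_Z {φ ψ : Alg} (hφ : Bd φ 5 jA (1/3)) (hψ : Bd ψ 5 jA (1/3)) (h0 : φ 0 = 0) : Bd (φ * ψ) 10 jZ (1/126) := by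
  intro I hI
  have hnn : 0 ≤ (φ * ψ) I := by
    apply mul_nonneg_of
    intro p hp
    rw [Multiset.mem_antidiagonal] at hp
    exact mul_nonneg (hφ p.1 (fun x hx => hI x (by rw [← hp]; exact Multiset.mem_add.2 (Or.inl hx)))).1
      (hψ p.2 (fun x hx => hI x (by rw [← hp]; exact Multiset.mem_add.2 (Or.inr hx)))).1
  refine ⟨hnn, ?_⟩
  by_cases hw : (wt I + 10) % 3 = 0
  swap
  · left
    rw [mul_app]
    apply Multiset.sum_eq_zero
    intro x hx
    obtain ⟨p, hp, rfl⟩ := Multiset.mem_map.1 hx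
    rw [Multiset.mem_antidiagonal] at hp
    have hwf : wt p.1 + wt p.2 = wt I := by rw [← hp, wt_add]
    obtain ⟨-, a⟩ := hφ p.1 (fun x hx => hI x (by rw [← hp]; exact Multiset.mem_add.2 (Or.inl hx)))
    obtain ⟨-, b⟩ := hψ p.2 (fun x hx => hI x (by rw [← hp]; exact Multiset.mem_add.2 (Or.inr hx)))
    rcases a with a | ⟨-, i, hi, -⟩
    · rw [a, zero_mul]
    rcases b with b | ⟨-, i', hi', -⟩
    · rw [b, mul_zero]
    omega
  rcases Nat.eq_zero_or_pos (Multiset.card I) with hc | hc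
  · left
    rw [Multiset.card_eq_zero.1 hc, mul_zero_app, h0, zero_mul]
  right
  have hwc := wt_ge_card 2 I hI
  obtain ⟨N, hN⟩ : ∃ N, 3 * (N + 2) = wt I + 10 := ⟨(wt I + 10) / 3 - 2, by omega⟩
  refine ⟨hc, N + 1, by omega, by unfold jZ; omega, ?_⟩
  have h1 := Bd_mul hφ hψ (by norm_num) (by norm_num) I hI N (by omega)
  have h2 := rho_le (Multiset.card I) N hc (by omega)
  have hG := GG_pos (N+2)
  have h3 := GG_fac (N+2) (by omega)
  have h4 := mul_le_mul_of_nonneg_left h2 hG.le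
  push_cast at h3
  show _ ≤ 1/126 * fac (N+2)
  nlinarith

end WittenAsym

set_option autoImplicit false
namespace WittenAsym
open Alg
variable {C : List ℕ → ℚ}

/-! ### The numerical inequality -/

/-- binomial coefficient in a form quick to evaluate -/
def chf (n k : ℕ) : ℕ := n.descFactorial k / k.factorial

theorem chf_eq (n k : ℕ) : chf n k = n.choose k := (Nat.choose_eq_descFactorial_div_factorial n k).symm

/-- integer upper bound for `10^12 * tt` -/
def tNr (j : ℕ → ℕ) (n N : ℕ) : ℕ → ℕ
  | 0 => 0
  | k + 1 => tNr j n N k + bif Nat.ble (2 * j (k + 1)) N then chf n (k + 1) * 1000000000000 / chf N (j (k + 1)) + 1 else 0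

theorem tNr_le (j : ℕ → ℕ) (n N m : ℕ) :
    (∑ k ∈ Finset.range (m + 1), (n.choose k : ℚ) * bz N j k) * 1000000000000 ≤ tNr j n N m := by
  induction m with
  | zero => simp [bz, tNr]
  | succ m ih =>
    rw [Finset.sum_range_succ, add_mul, tNr, Nat.cast_add]
    refine add_le_add ih ?_
    unfold bz
    rw [if_neg (by omega)]
    by_cases h : 2 * j (m + 1) ≤ N
    · rw [if_pos h, Nat.ble_eq_true_of_le h, cond_true, chf_eq, chf_eq]
      have hc : 0 < N.choose (j (m+1)) := Nat.choose_pos (by omega)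
      have hc' : (0:ℚ) < (N.choose (j (m+1)) : ℚ) := by exact_mod_cast hc
      have h1 : n.choose (m+1) * 1000000000000 ≤ (n.choose (m+1) * 1000000000000 / N.choose (j (m+1)) + 1) * N.choose (j (m+1)) :=
        (Nat.lt_mul_of_div_lt (Nat.lt_succ_self _) hc).le
      have h2 : ((n.choose (m+1) : ℚ)) * 1000000000000 ≤ ((n.choose (m+1) * 1000000000000 / N.choose (j (m+1)) + 1 : ℕ) : ℚ) * (N.choose (j (m+1)) : ℚ) := by
        exact_mod_cast h1
      rw [← div_le_iff₀ hc'] at h2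
      refine le_trans (le_of_eq ?_) h2
      ring
    · rw [if_neg h]
      have : (Nat.ble (2 * j (m+1)) N) = false := by
        rw [Bool.eq_false_iff]; intro h'; exact h (Nat.le_of_ble_eq_true h')
      rw [this, cond_false]; simp

theorem tt_le_tNr (j : ℕ → ℕ) (n N : ℕ) : tt j n N * 1000000000000 ≤ tNr j n N n := tNr_le j n N n

/-- the finite check -/
def chk (x : ℕ) : Bool :=
  Nat.ble ((80 * tNr jA (3*x/5) (x+2) (3*x/5) + 24 * tNr jB (3*x/5) (x+2) (3*x/5) + 56 * tNr jU (3*x/5) (x+2) (3*x/5)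
    + 3 * tNr j0 (3*x/5) (x+2) (3*x/5) + 3 * tNr jZ (3*x/5) (x+2) (3*x/5)) * (1000 * (x-3) * (x+2) * (x+1)))
    (1000000000000 * (18 * 289 * (17 * (x-5) * (x+1) + 33 * (x-3))))

theorem chk_all : ((List.range 75).all fun i => chk (i + 16)) = true := by decide +kernel

/-- the left hand side of the numerical inequality -/
def lhs (n N : ℕ) : ℚ := (1/9) * (40 * tt jA n N + 12 * tt jB n N + 28 * tt jU n N) + (1/6) * (tt j0 n N + tt jZ n N)

theorem num_small (x n : ℕ) (h1 : 16 ≤ x) (h2 : x ≤ 90) (hn : 5 * n ≤ 3 * x) :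
    lhs n (x+2) ≤ 289/1000 * (17 * (1 - 2/((x:ℚ)-3)) / ((x:ℚ)+2) + 33 / (((x:ℚ)+2) * ((x:ℚ)+1))) := by
  have hc := List.all_eq_true.1 chk_all (x - 16) (List.mem_range.2 (by omega))
  rw [show x - 16 + 16 = x by omega] at hc
  have hc := Nat.le_of_ble_eq_true hc
  have hm : n ≤ 3 * x / 5 := by omega
  have a1 := (tt_mono jA (x+2) hm)
  have a2 := (tt_mono jB (x+2) hm)
  have a3 := (tt_mono jU (x+2) hm)
  have a4 := (tt_mono j0 (x+2) hm)
  have a5 := (tt_mono jZ (x+2) hm)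
  have b1 := tt_le_tNr jA (3*x/5) (x+2)
  have b2 := tt_le_tNr jB (3*x/5) (x+2)
  have b3 := tt_le_tNr jU (3*x/5) (x+2)
  have b4 := tt_le_tNr j0 (3*x/5) (x+2)
  have b5 := tt_le_tNr jZ (3*x/5) (x+2)
  generalize tNr jA (3*x/5) (x+2) (3*x/5) = c1 at *
  generalize tNr jB (3*x/5) (x+2) (3*x/5) = c2 at *
  generalize tNr jU (3*x/5) (x+2) (3*x/5) = c3 at *
  generalize tNr j0 (3*x/5) (x+2) (3*x/5) = c4 at *
  generalize tNr jZ (3*x/5) (x+2) (3*x/5) = c5 at *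
  obtain ⟨y, rfl⟩ : ∃ y, x = y + 5 := ⟨x - 5, by omega⟩
  rw [show y + 5 - 3 = y + 2 by omega, show y + 5 - 5 = y by omega] at hc
  have hc' : ((80 * (c1:ℚ) + 24 * c2 + 56 * c3 + 3 * c4 + 3 * c5) * (1000 * ((y:ℚ)+2) * ((y:ℚ)+5+2) * ((y:ℚ)+5+1)))
    ≤ (1000000000000 * (18 * 289 * (17 * (y:ℚ) * ((y:ℚ)+5+1) + 33 * ((y:ℚ)+2)))) := by exact_mod_cast hc
  have hl : 18 * lhs n (y+5+2) * 1000000000000 ≤ 80 * (c1:ℚ) + 24 * c2 + 56 * c3 + 3 * c4 + 3 * c5 := by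
    unfold lhs; linarith
  have hP : (0:ℚ) < (1000 * ((y:ℚ)+2) * ((y:ℚ)+5+2) * ((y:ℚ)+5+1)) := by positivity
  have hm := (mul_le_mul_of_nonneg_right hl hP.le).trans hc'
  push_cast
  have e : 289/1000 * (17 * (1 - 2/((y:ℚ)+5-3)) / ((y:ℚ)+5+2) + 33 / (((y:ℚ)+5+2) * ((y:ℚ)+5+1)))
     = 289 * (17 * (y:ℚ) * ((y:ℚ)+5+1) + 33 * ((y:ℚ)+2)) / (1000 * ((y:ℚ)+2) * ((y:ℚ)+5+2) * ((y:ℚ)+5+1)) := by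
    rw [show (y:ℚ)+5-3 = y+2 by ring]
    have : (y:ℚ)+2 ≠ 0 := by positivity
    have : (y:ℚ)+5+2 ≠ 0 := by positivity
    have : (y:ℚ)+5+1 ≠ 0 := by positivity
    field_simp
    ring
  rw [e, le_div_iff₀ hP]
  linarith

theorem num_large (x n : ℕ) (h1 : 90 ≤ x) (hn : 5 * n ≤ 3 * x) :
    lhs n (x+2) ≤ 289/1000 * (17 * (1 - 2/((x:ℚ)-3)) / ((x:ℚ)+2) + 33 / (((x:ℚ)+2) * ((x:ℚ)+1))) := by
  obtain ⟨D, hD⟩ : ∃ D, x + 2 = n + D := ⟨x + 2 - n, by omega⟩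
  have hD2 : 2 * x + 10 ≤ 5 * D := by omega
  have t1 := tt_le jA 2 n D (by omega) (by intro k hk; unfold jA; omega)
  have t2 := tt_le jB 2 n D (by omega) (by intro k hk; unfold jB; omega)
  have t3 := tt_le jU 2 n D (by omega) (by intro k hk; unfold jU; omega)
  have t4 := tt_le j0 1 n D (by omega) (by intro k hk; unfold j0; omega)
  have t5 := tt_le jZ 1 n D (by omega) (by intro k hk; unfold jZ; omega)
  rw [← hD] at t1 t2 t3 t4 t5
  have hDq : (x:ℚ) + 2 = n + D := by exact_mod_cast hD
  rw [← hDq] at t1 t2 t3 t4 t5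
  rw [Nat.cast_choose_two] at t1 t2 t3
  rw [Nat.choose_one_right] at t4 t5
  have hd : 2 * (x:ℚ) + 10 ≤ 5 * D := by exact_mod_cast hD2
  have hx : (90:ℚ) ≤ x := by exact_mod_cast h1
  have hl : lhs n (x+2) ≤ (80/9) * (((x:ℚ) + 2 + 1) / (((D:ℚ) + 1) * ((D:ℚ) * ((D:ℚ) - 1) / 2)))
      + (1/3) * (((x:ℚ) + 2 + 1) / (((D:ℚ) + 1) * (D:ℚ))) := by
    unfold lhs; linarith
  refine hl.trans ?_
  obtain ⟨w, hw, hw0⟩ : ∃ w : ℚ, (x:ℚ) = 90 + 5 * w ∧ 0 ≤ w := ⟨((x:ℚ) - 90)/5, by ring, by linarith⟩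
  have hd' : 38 + 2 * w ≤ (D:ℚ) := by linarith
  have s1 : ((x:ℚ) + 2 + 1) / (((D:ℚ) + 1) * ((D:ℚ) * ((D:ℚ) - 1) / 2)) ≤ (93 + 5 * w) / ((39 + 2*w) * ((38 + 2*w) * (37 + 2*w) / 2)) := by
    rw [hw, show (90:ℚ) + 5 * w + 2 + 1 = 93 + 5 * w by ring]
    apply div_le_div_of_nonneg_left (by positivity) (by positivity)
    have q1 : 39 + 2*w ≤ (D:ℚ) + 1 := by linarith
    have q2 : 37 + 2*w ≤ (D:ℚ) - 1 := by linarith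
    gcongr
  have s2 : ((x:ℚ) + 2 + 1) / (((D:ℚ) + 1) * (D:ℚ)) ≤ (93 + 5 * w) / ((39 + 2*w) * (38 + 2*w)) := by
    rw [hw, show (90:ℚ) + 5 * w + 2 + 1 = 93 + 5 * w by ring]
    apply div_le_div_of_nonneg_left (by positivity) (by positivity)
    have q1 : 39 + 2*w ≤ (D:ℚ) + 1 := by linarith
    gcongr
  refine (add_le_add (mul_le_mul_of_nonneg_left s1 (by norm_num)) (mul_le_mul_of_nonneg_left s2 (by norm_num))).trans ?_
  rw [hw, show (90:ℚ) + 5 * w - 3 = 87 + 5 * w by ring, show (90:ℚ) + 5 * w + 2 = 92 + 5 * w by ring, show (90:ℚ) + 5 * w + 1 = 91 + 5 * w by ring]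
  have e1 : (80/9) * ((93 + 5 * w) / ((39 + 2*w) * ((38 + 2*w) * (37 + 2*w) / 2))) + (1/3) * ((93 + 5 * w) / ((39 + 2*w) * (38 + 2*w)))
      = (93 + 5 * w) * (160 + 3 * (37 + 2*w)) / (9 * ((39 + 2*w) * (38 + 2*w) * (37 + 2*w))) := by
    field_simp
    try ring
  have e2 : 289/1000 * (17 * (1 - 2/(87 + 5 * w)) / (92 + 5 * w) + 33 / ((92 + 5 * w) * (91 + 5 * w)))
     = 289 * (17 * (85 + 5 * w) * (91 + 5 * w) + 33 * (87 + 5 * w)) / (1000 * ((87 + 5 * w) * (92 + 5 * w) * (91 + 5 * w))) := by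
    field_simp
    ring
  rw [e1, e2, div_le_div_iff₀ (by positivity) (by positivity)]
  rw [← sub_nonneg]
  ring_nf
  positivity

theorem num_ineq (x n : ℕ) (h1 : 16 ≤ x) (hn : 5 * n ≤ 3 * x) :
    lhs n (x+2) ≤ 289/1000 * (17 * (1 - 2/((x:ℚ)-3)) / ((x:ℚ)+2) + 33 / (((x:ℚ)+2) * ((x:ℚ)+1))) := by
  rcases Nat.lt_or_ge 90 x with h | h
  · exact num_large x n h.le hn
  · exact num_small x n h1 h hn

end WittenAsym

set_option autoImplicit false
namespace WittenAsym
open Alg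
variable {C : List ℕ → ℚ}

/-! ### The large case of the main inequality -/

theorem u_app (F : Alg) (k : ℕ) : ∀ s, u F k s = F (Multiset.replicate (k + 2) 0 + s) := by
  induction k with
  | zero =>
    intro s
    show F (0 ::ₘ 0 ::ₘ s) = _
    congr 1
    simp [Multiset.replicate_succ]
  | succ k ih =>
    intro s
    rw [← sh0_u, sh_app, ih]
    congr 1
    rw [Multiset.replicate_succ 0 (k + 2), Multiset.cons_add, Multiset.add_cons]

/-- pointwise nonnegativity -/
def NN (φ : Alg) : Prop := ∀ s, 0 ≤ φ s

theorem NN.mul {φ ψ : Alg} (hφ : NN φ) (hψ : NN ψ) : NN (φ * ψ) :=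
  fun _ => mul_nonneg_of fun p _ => mul_nonneg (hφ p.1) (hψ p.2)

theorem NN_u (hC : IsNormalizedWitten C) (k : ℕ) : NN (u (Nf C) k) := by
  intro s; rw [u_app]; exact N_nonneg hC _

theorem single_ge {φ ψ : Alg} (hφ : NN φ) (hψ : NN ψ) (s : Multiset ℕ) : φ s * ψ 0 ≤ (φ * ψ) s := by
  rw [mul_app]
  apply Multiset.single_le_sum
  · intro x hx
    obtain ⟨p, -, rfl⟩ := Multiset.mem_map.1 hx
    exact mul_nonneg (hφ _) (hψ _)
  · exact Multiset.mem_map.2 ⟨(s, 0), by simp, rfl⟩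

theorem prod_ge {φ ψ : Alg} (hφ : NN φ) (hψ : NN ψ) (s : Multiset ℕ) (hs : s ≠ 0) : φ s * ψ 0 + φ 0 * ψ s ≤ (φ * ψ) s := by
  obtain ⟨a, ha⟩ := Multiset.exists_mem_of_ne_zero hs
  obtain ⟨t, rfl⟩ := Multiset.exists_cons_of_mem ha
  rw [mul_cons]
  have h1 : NN (sh a φ) := fun s => hφ (a ::ₘ s)
  have h2 : NN (sh a ψ) := fun s => hψ (a ::ₘ s)
  have e1 := single_ge h1 hψ t
  have e2 := single_ge h2 hφ t
  rw [mul_comm (sh a ψ) φ, sh_app] at e2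
  rw [sh_app] at e1
  linarith

theorem large_case (hC : IsNormalizedWitten C) (e : Multiset ℕ) (he : ∀ x ∈ e, 2 ≤ x) (x : ℕ) (hx : 16 ≤ x) (hw : wt e = 3 * x) :
    Nf C (1 ::ₘ 1 ::ₘ 1 ::ₘ 1 ::ₘ e) ≤ Nf C (4 ::ₘ 1 ::ₘ e) := by
  have hV := N_vir hC
  have he0 : e ≠ 0 := by rintro rfl; rw [wt_zero] at hw; omega
  have hne0 : 0 ∉ e := fun h => by have := he 0 h; omega
  have hne1 : 1 ∉ e := fun h => by have := he 1 h; omega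
  have hcard := wt_ge_card 2 e he
  set n := Multiset.card e with hn
  -- bound data
  have bp : Bd (sh 1 (u (Nf C) 0)) 5 jA (1/3) := Bd_basic hC _ (0 ::ₘ 0 ::ₘ {1}) 5 jA
    (by intro I; rw [sh_app, u_app]; congr 1; simp [Multiset.replicate_succ]; simp only [Multiset.cons_swap 1 0]) (by decide) (by norm_num) (by intro k i h1 h2 h3; unfold jA; omega)
  have b3 : Bd (u (Nf C) 3) 5 jA (1/3) := Bd_basic hC _ (Multiset.replicate 5 0) 5 jA
    (by intro I; rw [u_app]) (by decide) (by norm_num) (by intro k i h1 h2 h3; unfold jA; omega)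
  have bp2 : Bd (sh 1 (u (Nf C) 2)) 7 jB (1/3) := Bd_basic hC _ (0 ::ₘ 0 ::ₘ 0 ::ₘ 0 ::ₘ {1}) 7 jB
    (by intro I; rw [sh_app, u_app]; congr 1; simp [Multiset.replicate_succ]; simp only [Multiset.cons_swap 1 0]) (by decide) (by norm_num) (by intro k i h1 h2 h3; unfold jB; omega)
  have b5 : Bd (u (Nf C) 5) 7 jU (1/3) := Bd_basic hC _ (Multiset.replicate 7 0) 7 jU
    (by intro I; rw [u_app]) (by decide) (by norm_num)
    (by intro k i h1 h2 h3; rw [Multiset.card_replicate] at h3; unfold jU; omega)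
  have b0 : Bd (u (Nf C) 0) 2 j0 (1/3) := Bd_basic hC _ (Multiset.replicate 2 0) 2 j0
    (by intro I; rw [u_app]) (by decide) (by norm_num) (by intro k i h1 h2 h3; unfold j0; omega)
  have p0 : sh 1 (u (Nf C) 0) 0 = 0 := by
    rw [sh_app, u_app]
    apply N_vanish hC
    intro h
    have := (IG_iff'.1 h).1
    revert this; decide
  have u30 : u (Nf C) 3 0 = 0 := u_app_zero hV 1
  have bz1 : Bd (u (Nf C) 3 * sh 1 (u (Nf C) 0)) 10 jZ (1/126) := Bd_Z b3 bp u30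
  have bz2 : Bd (u (Nf C) 3 * u (Nf C) 3) 10 jZ (1/126) := Bd_Z b3 b3 u30
  have bz3 : Bd (sh 1 (u (Nf C) 0) * sh 1 (u (Nf C) 0)) 10 jZ (1/126) := Bd_Z bp bp p0
  have m1 := Bd_mul bp b5 (by norm_num) (by norm_num) e he (x+2) (by omega)
  have m2 := Bd_mul bp bp2 (by norm_num) (by norm_num) e he (x+2) (by omega)
  have m3 := Bd_mul bp2 b3 (by norm_num) (by norm_num) e he (x+2) (by omega)
  have m4 := Bd_mul b0 bz1 (by norm_num) (by norm_num) e he (x+2) (by omega)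
  have m5 := Bd_mul b0 bz2 (by norm_num) (by norm_num) e he (x+2) (by omega)
  have m6 := Bd_mul b0 bz3 (by norm_num) (by norm_num) e he (x+2) (by omega)
  rw [← hn] at m1 m2 m3 m4 m5 m6
  -- the positive part
  have N0 := NN_u hC 0
  have N1 := NN_u hC 1
  have N2 := NN_u hC 2
  have N3 := NN_u hC 3
  have N4 := NN_u hC 4
  have N5 := NN_u hC 5
  have N6 := NN_u hC 6
  have u10 := u1_app_zero hV
  have u40 : u (Nf C) 4 0 = 0 := u_app_zero hV 2
  have l2 := prod_ge N1 N1 e he0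
  have l3 := prod_ge (N1.mul N1) N1 e he0
  have l4 := prod_ge ((N1.mul N1).mul N1) N1 e he0
  have l5 := prod_ge (N1.mul N1) N4 e he0
  simp only [mul_zero_app, u10, u40] at l2 l3 l4 l5
  have f6 := floor6 hC (x+2) (by omega) (Multiset.replicate 6 0 + e) (by simp [hne1])
    (by rw [Multiset.count_add, Multiset.count_replicate_self, Multiset.count_eq_zero_of_notMem hne0])
    (by rw [wt_add, hw, show wt (Multiset.replicate 6 0) = 6 by decide]; ring)
  have f3 := floor3 hC (x+1) (by omega) (Multiset.replicate 3 0 + e) (by simp [hne1])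
    (by rw [Multiset.count_add, Multiset.count_replicate_self, Multiset.count_eq_zero_of_notMem hne0])
    (by rw [wt_add, hw, show wt (Multiset.replicate 3 0) = 3 by decide]; ring)
  rw [← u_app (Nf C) 4 e] at f6
  rw [← u_app (Nf C) 1 e] at f3
  have r1 := (N2.mul N6) e
  have r2 := (N3.mul N5) e
  have r3 := (N4.mul N4) e
  have r4 := ((N0.mul N0).mul N6) e
  have r5 := ((N0.mul N2).mul N4) e
  have r6 := ((N2.mul N2).mul N2) e
  have r7 := (((N0.mul N0).mul N0).mul N4) e
  have r8 := (((N0.mul N0).mul N2).mul N2) e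
  have r9 := ((((N0.mul N0).mul N0).mul N0).mul N2) e
  have r10 := (((((N0.mul N0).mul N0).mul N0).mul N0).mul N0) e
  -- factorials
  have hG := GG_pos (x+4)
  have g1 := GG_fac (x+4) (by omega)
  have g2 := fac_step (x+4) (by omega)
  have g3 := fac_step (x+3) (by omega)
  have g4 := fac_step (x+2) (by omega)
  rw [show x + 4 - 1 = x + 3 by omega] at g2
  rw [show x + 3 - 1 = x + 2 by omega] at g3
  rw [show x + 2 - 1 = x + 1 by omega] at g4
  push_cast at g1 g2 g3 g4 f6 f3
  have hxq : (16:ℚ) ≤ x := by exact_mod_cast hx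
  have k1 : fac (x+2) = GG (x+4) / (288 * ((x:ℚ)+2)) := by
    rw [eq_div_iff (by positivity)]
    have : ((x:ℚ)+3) ≠ 0 := by positivity
    apply mul_left_cancel₀ this
    rw [g2, g3] at g1
    linear_combination (-1) * g1
  have k2 : fac (x+1) = GG (x+4) / (3456 * (((x:ℚ)+2) * ((x:ℚ)+1))) := by
    rw [k1] at g4
    rw [eq_div_iff (by positivity)]
    rw [div_eq_iff (by positivity)] at g4
    linear_combination (-1) * g4
  have hnum := num_ineq x n hx (by omega)
  have hnum := mul_le_mul_of_nonneg_left hnum hG.le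
  rw [k1, show (x:ℚ) + 2 - 5 = x - 3 by ring] at f6
  rw [k2] at f3
  have kk : GG (x+4) * (289/1000 * (17 * (1 - 2/((x:ℚ)-3)) / ((x:ℚ)+2) + 33 / (((x:ℚ)+2) * ((x:ℚ)+1))))
      = 4896 * (289/1000 * (1 - 2/((x:ℚ)-3)) * (GG (x+4) / (288 * ((x:ℚ)+2)))) + 114048 * (289/1000 * (GG (x+4) / (3456 * (((x:ℚ)+2) * ((x:ℚ)+1))))) := by
    have : (x:ℚ) - 3 ≠ 0 := by linarith
    field_simp
    ring
  rw [kk] at hnum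
  unfold lhs at hnum
  have hGe := congrArg (fun φ : Alg => φ e) (G_eq hV)
  simp only [show (3584 * 8 : Alg) = 28672 by norm_num, show (1024 * 8 : Alg) = 8192 by norm_num, show (512 * 8 : Alg) = 4096 by norm_num,
    show (4608 * 8 : Alg) = 36864 by norm_num, show (3072 * 8 : Alg) = 24576 by norm_num, show (384 * 8 : Alg) = 3072 by norm_num,
    add_app, lit_mul_app] at hGe
  rw [show sh 1 (sh 4 (Nf C)) e = Nf C (4 ::ₘ 1 ::ₘ e) from rfl,
    show sh 1 (sh 1 (sh 1 (sh 1 (Nf C)))) e = Nf C (1 ::ₘ 1 ::ₘ 1 ::ₘ 1 ::ₘ e) from rfl] at hGe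
  rw [show x + 2 + 2 = x + 4 by ring] at m1 m2 m3 m4 m5 m6
  linarith

theorem main_reduced (hC : IsNormalizedWitten C) (e : Multiset ℕ) (he : ∀ x ∈ e, 2 ≤ x) (x : ℕ) (hw : wt e = 3 * x) :
    1728*(x:ℚ)*(x+1)*(x+2)*Nf C e ≤ Nf C (4 ::ₘ e) := by
  rcases Nat.lt_or_ge 15 x with h | h
  swap
  · exact tab_four hC e he x h hw
  have h1 := large_case hC e he x h hw
  have he0 : e ≠ 0 := by rintro rfl; rw [wt_zero] at hw; omega
  rw [Multiset.cons_swap 4 1 e, N_one hC, N_one hC, N_one hC, N_one hC, N_one hC] at h1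
  simp only [wt_cons, hw, Multiset.cons_ne_zero, he0, if_false, add_zero] at h1
  push_cast at h1
  have hx : (15:ℚ) < x := by exact_mod_cast h
  have h2 : 0 ≤ 12 * ((x:ℚ) + 3) * (Nf C (4 ::ₘ e) - 1728*(x:ℚ)*(x+1)*(x+2)*Nf C e) := by
    linarith
  have h3 := nonneg_of_mul_nonneg_right h2 (by positivity)
  linarith

end WittenAsym

set_option autoImplicit false
namespace WittenAsym
open Alg
variable {C : List ℕ → ℚ}

/-! ### Conclusion -/

theorem main_N (hC : IsNormalizedWitten C) : ∀ (k : ℕ) (e : Multiset ℕ), Multiset.card e = k → e ≠ 0 → (∀ x ∈ e, 1 ≤ x) → ∀ x : ℕ, wt e = 3 * x →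
    1728*(x:ℚ)*(x+1)*(x+2)*Nf C e ≤ Nf C (4 ::ₘ e) := by
  intro k
  induction k with
  | zero => intro e h h0; exact absurd (Multiset.card_eq_zero.1 h) h0
  | succ k ih =>
    intro e hk h0 he x hw
    by_cases h1 : 1 ∈ e
    swap
    · refine main_reduced hC e (fun y hy => ?_) x hw
      have := he y hy
      have : y ≠ 1 := by rintro rfl; exact h1 hy
      omega
    obtain ⟨t, rfl⟩ := Multiset.exists_cons_of_mem h1
    rw [Multiset.card_cons] at hk
    rw [wt_cons] at hw
    obtain ⟨y, rfl⟩ : ∃ y, x = y + 1 := ⟨x - 1, by omega⟩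
    have hwt : wt t = 3 * y := by omega
    rw [Multiset.cons_swap 4 1 t, N_one hC, N_one hC, wt_cons, hwt, if_neg (Multiset.cons_ne_zero)]
    by_cases ht : t = 0
    · subst ht
      rw [wt_zero] at hwt
      have hy : y = 0 := by omega
      subst hy
      have h4 : Nf C (4 ::ₘ 0) = 1680 := N4 (N_vir hC)
      rw [h4, N_zero, if_pos rfl]
      norm_num
    · have := ih t (by omega) ht (fun z hz => he z (Multiset.mem_cons_of_mem hz)) y hwt
      rw [if_neg ht]
      push_cast
      have h2 := mul_le_mul_of_nonneg_left this (show (0:ℚ) ≤ 12 * ((y:ℚ) + 3) by positivity)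
      linarith

theorem main_C (hC : IsNormalizedWitten C) (e : Multiset ℕ) (h0 : e ≠ 0) (he : ∀ x ∈ e, 1 ≤ x) (x : ℕ) (hw : wt e = 3 * x) :
    Cm C e ≤ Cm C (4 ::ₘ e) := by
  have h := main_N hC _ e rfl h0 he x hw
  have hx1 : 1 ≤ x := by
    have := card_le_wt e
    have := Multiset.card_pos.2 h0
    omega
  have hX : XM e = x := by unfold XM; omega
  have hX' : XM (4 ::ₘ e) = x + 3 := by unfold XM; rw [wt_cons]; omega
  rw [N_cons, hX', show Nf C e = fac (XM e) * Cm C e by simp [Nf, h0], hX] at h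
  have g2 := fac_step (x+3) (by omega)
  have g3 := fac_step (x+2) (by omega)
  have g4 := fac_step (x+1) (by omega)
  rw [show x + 3 - 1 = x + 2 by omega] at g2
  rw [show x + 2 - 1 = x + 1 by omega] at g3
  rw [show x + 1 - 1 = x by omega] at g4
  push_cast at g2 g3 g4
  have hf : fac (x+3) = 1728*(x:ℚ)*(x+1)*(x+2)*fac x := by rw [g2, g3, g4]; ring
  have hp := fac_pos (x+3)
  have h' : fac (x+3) * Cm C e ≤ fac (x+3) * Cm C (4 ::ₘ e) := by
    refine le_trans (le_of_eq ?_) h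
    rw [hf]; ring
  exact le_of_mul_le_mul_left h' hp

theorem C_bounds (hC : IsNormalizedWitten C) (l : List ℕ) (hl : l ≠ []) : 0 ≤ C l ∧ C l ≤ 1/3 := by
  rw [← Cm_coe hC l]
  have hl0 : (l : Multiset ℕ) ≠ 0 := by simpa using hl
  by_cases h : IG (l : Multiset ℕ)
  swap
  · rw [Cm_vanish hC h]; norm_num
  have h1 := N_nonneg hC (l : Multiset ℕ)
  have h2 := cap hC _ _ (IG_dvd h)
  rw [show Nf C (l : Multiset ℕ) = fac (XM (l : Multiset ℕ)) * Cm C (l : Multiset ℕ) by simp [Nf, hl]] at h1 h2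
  have hp := fac_pos (XM (l : Multiset ℕ))
  refine ⟨nonneg_of_mul_nonneg_right h1 hp, ?_⟩
  by_contra hc
  push Not at hc
  nlinarith

theorem theta_nonneg (hC : IsNormalizedWitten C) (X m : ℕ) (hm : 1 ≤ m) : 0 ≤ theta C X m := by
  unfold theta
  apply Real.sSup_nonneg
  rintro x ⟨e, h1, -, -, -, rfl⟩
  have := (C_bounds hC e (by rintro rfl; simp at h1; omega)).1
  exact_mod_cast this

theorem theta_main (hC : IsNormalizedWitten C) (X n : ℕ) (hX : 4 ≤ X) (hn : 2 ≤ n) : theta C (X-3) (n-1) ≤ theta C X n := by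
  have h0 := theta_nonneg hC X n (by omega)
  unfold theta at h0 ⊢
  refine Real.sSup_le ?_ h0
  rintro x ⟨e, h1, h2, h3, h4, rfl⟩
  have he : e ≠ [] := by rintro rfl; simp at h1; omega
  have hIG := (IG_coe e).1 h3
  have hw := IG_dvd hIG
  have hm := main_C hC (e : Multiset ℕ) (by simpa using he) (by simpa using h2) _ hw
  have hm' : C e ≤ C (4 :: e) := by
    rw [Multiset.cons_coe, Cm_coe hC, Cm_coe hC] at hm
    exact hm
  refine le_trans (show (C e : ℝ) ≤ (C (4 :: e) : ℝ) by exact_mod_cast hm') ?_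
  apply le_csSup
  · refine ⟨1/3, ?_⟩
    rintro y ⟨f, h1', -, -, -, rfl⟩
    have := (C_bounds hC f (by rintro rfl; simp at h1'; omega)).2
    have h : (C f : ℝ) ≤ ((1/3 : ℚ) : ℝ) := by exact_mod_cast this
    simpa using h
  · refine ⟨4 :: e, by simp; omega, ?_, ?_, ?_, rfl⟩
    · intro i hi
      rcases List.mem_cons.1 hi with rfl | hi
      · norm_num
      · exact h2 i hi
    · obtain ⟨g, hg⟩ := h3
      refine ⟨g + 1, ?_⟩
      unfold gQ at hg ⊢
      rw [List.sum_cons, List.length_cons, Nat.cast_add, Nat.cast_add, Nat.cast_add, hg]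
      push_cast [-Nat.cast_list_sum]
      ring
    · unfold XQ at h4 ⊢
      rw [Nat.cast_sub (by omega)] at h4
      rw [List.sum_cons, List.length_cons, Nat.cast_add, Nat.cast_add]
      push_cast [-Nat.cast_list_sum] at h4 ⊢
      linarith

theorem theta_shift_estimate (C : List ℕ → ℚ) (hC : IsNormalizedWitten C) :
    ∃ M : ℝ, 0 < M ∧ ∀ X n : ℕ, 4 ≤ X → 2 ≤ n →
      theta C (X - 3) (n - 1) ≤ theta C X n + M / ((X : ℝ) - 1) := by
  refine ⟨1, one_pos, fun X n hX hn => ?_⟩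
  have h := theta_main hC X n hX hn
  have hx : (4:ℝ) ≤ X := by exact_mod_cast hX
  have : (0:ℝ) ≤ 1 / ((X:ℝ) - 1) := div_nonneg zero_le_one (by linarith)
  linarith

end WittenAsym
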